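/- There is a ring isomorphism i : Θ(𝔗) → ℤ[u,v]/(uv) satisfying i(x₁) = u+v+2, i(x₂) = u+v+1, i(x₃) = u+v, i(x_m) = v+1−(m−2)(u+1) for every m ≥ 4, i(y) = u, and i(z) = u−v. -/

import Mathlib

/-! # Relational structures, embeddings, amalgamations, Fraïssé classes -/

namespace Paper

/-- A relational signature: a set `I` of relation symbols with arities `≥ 1`. -/
structure Signature : Type 1 where
  I : Type
  arity : I → ℕ
  arity_pos : ∀ i, 1 ≤ arity i

variable {σ : Signature}

/-- A (finite relational) structure for the signature `σ`. -/
structure Struc (σ : Signature) : Type 1 where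
  carrier : Type
  [fin : Finite carrier]
  rel : ∀ i : σ.I, (Fin (σ.arity i) → carrier) → Prop

attribute [instance] Struc.fin

/-- An embedding of structures: an injection under which the relations on the source are
exactly the restrictions of the relations on the target. -/
structure Emb (X Y : Struc σ) : Type where
  toFun : X.carrier → Y.carrier
  inj : Function.Injective toFun
  rel_iff : ∀ (i : σ.I) (v : Fin (σ.arity i) → X.carrier),
    Y.rel i (fun j => toFun (v j)) ↔ X.rel i v

/-- The identity embedding. -/
def Emb.id (X : Struc σ) : Emb X X where
  toFun := fun x => x
  inj := fun _ _ h => h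
  rel_iff := fun _ _ => Iff.rfl

/-- Composition of embeddings. -/
def Emb.comp {X Y Z : Struc σ} (g : Emb Y Z) (f : Emb X Y) : Emb X Z where
  toFun := fun x => g.toFun (f.toFun x)
  inj := fun _ _ h => f.inj (g.inj h)
  rel_iff := fun i v => (g.rel_iff i fun j => f.toFun (v j)).trans (f.rel_iff i v)

/-- An embedding is an isomorphism if it is surjective. -/
def Emb.IsIso {X Y : Struc σ} (f : Emb X Y) : Prop := Function.Surjective f.toFun

/-- Two structures are isomorphic. -/
def StrucIso (X Y : Struc σ) : Prop := ∃ f : Emb X Y, f.IsIso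

theorem strucIso_refl (X : Struc σ) : StrucIso X X := ⟨Emb.id X, fun y => ⟨y, rfl⟩⟩

/-- The induced structure on a subset of the carrier. -/
def Struc.restrict (X : Struc σ) (S : Set X.carrier) : Struc σ where
  carrier := S
  rel := fun i v => X.rel i (fun j => (v j : X.carrier))

/-- The inclusion embedding of an induced substructure into the whole structure. -/
def Struc.subEmb (X : Struc σ) (S : Set X.carrier) : Emb (X.restrict S) X where
  toFun := fun a => a.1
  inj := fun _ _ h => Subtype.ext h
  rel_iff := fun _ _ => Iff.rfl

/-- The inclusion embedding between induced substructures on nested subsets. -/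
def Struc.inclEmb (X : Struc σ) {S T : Set X.carrier} (h : S ⊆ T) :
    Emb (X.restrict S) (X.restrict T) where
  toFun := fun a => ⟨a.1, h a.2⟩
  inj := fun a b hab => Subtype.ext (Subtype.mk_eq_mk.mp (by exact hab))
  rel_iff := fun _ _ => Iff.rfl

/-- An amalgamation of `Y₁` and `Y₂` over `X` (along `i₁`, `i₂`). -/
structure Amalg {X Y₁ Y₂ : Struc σ} (i₁ : Emb X Y₁) (i₂ : Emb X Y₂) : Type 1 where
  Z : Struc σ
  j₁ : Emb Y₁ Z
  j₂ : Emb Y₂ Z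
  comm : ∀ x, j₁.toFun (i₁.toFun x) = j₂.toFun (i₂.toFun x)
  surj : ∀ z, z ∈ Set.range j₁.toFun ∪ Set.range j₂.toFun

/-- Isomorphism of amalgamations: a structure isomorphism commuting with the two
embeddings. -/
def Amalg.Iso {X Y₁ Y₂ : Struc σ} {i₁ : Emb X Y₁} {i₂ : Emb X Y₂}
    (A B : Amalg i₁ i₂) : Prop :=
  ∃ f : Emb A.Z B.Z, f.IsIso ∧ (∀ y, f.toFun (A.j₁.toFun y) = B.j₁.toFun y) ∧
    (∀ y, f.toFun (A.j₂.toFun y) = B.j₂.toFun y)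

/-- A structure lies in the class `F` up to isomorphism. -/
def MemUpIso (F : Set (Struc σ)) (X : Struc σ) : Prop := ∃ W ∈ F, StrucIso X W

theorem memUpIso_of_mem {F : Set (Struc σ)} {X : Struc σ} (h : X ∈ F) : MemUpIso F X :=
  ⟨X, h, strucIso_refl X⟩

/-- A Fraïssé class. -/
structure IsFraisse (F : Set (Struc σ)) : Prop where
  nonempty : F.Nonempty
  finClasses : ∀ n : ℕ, ∃ (m : ℕ) (r : Fin m → Struc σ),
    ∀ X ∈ F, Nat.card X.carrier = n → ∃ α, StrucIso X (r α)
  hereditary : ∀ X ∈ F, ∀ Y : Struc σ, Nonempty (Emb Y X) → MemUpIso F Y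
  amalg : ∀ (X Y₁ Y₂ : Struc σ), X ∈ F → Y₁ ∈ F → Y₂ ∈ F →
    ∀ (i₁ : Emb X Y₁) (i₂ : Emb X Y₂), ∃ A : Amalg i₁ i₂, MemUpIso F A.Z

theorem pair_compl_subset_left {α : Type*} (a b : α) : ({a, b} : Set α)ᶜ ⊆ ({a} : Set α)ᶜ :=
  Set.compl_subset_compl.mpr (fun _ hx => Set.mem_insert_iff.mpr (Or.inl hx))

theorem pair_compl_subset_right {α : Type*} (a b : α) : ({a, b} : Set α)ᶜ ⊆ ({b} : Set α)ᶜ :=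
  Set.compl_subset_compl.mpr (fun _ hx => Set.mem_insert_iff.mpr (Or.inr hx))

/-- The canonical amalgamation of `X∖{a}` and `X∖{b}` over `X∖{a,b}`, namely `X` itself. -/
def canonAmalg (X : Struc σ) (a b : X.carrier) (hab : a ≠ b) :
    Amalg (X.inclEmb (pair_compl_subset_left a b)) (X.inclEmb (pair_compl_subset_right a b)) where
  Z := X
  j₁ := X.subEmb ({a} : Set X.carrier)ᶜ
  j₂ := X.subEmb ({b} : Set X.carrier)ᶜ
  comm := fun _ => rfl
  surj := fun z => by
    by_cases hz : z = a
    · exact Or.inr ⟨⟨z, by simp only [Set.mem_compl_iff, Set.mem_singleton_iff, hz]; exact hab⟩, rfl⟩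
    · exact Or.inl ⟨⟨z, by simp [hz]⟩, rfl⟩

/-- Two distinct elements `a b` of `X` are separated (relative to the class `F`) if `X` is,
up to isomorphism of amalgamations, the unique amalgamation of `X∖{a}` and `X∖{b}` over
`X∖{a,b}` lying in `F`. -/
def Separated (F : Set (Struc σ)) (X : Struc σ) (a b : X.carrier) (hab : a ≠ b) : Prop :=
  ∀ A : Amalg (X.inclEmb (pair_compl_subset_left a b)) (X.inclEmb (pair_compl_subset_right a b)),
    MemUpIso F A.Z → A.Iso (canonAmalg X a b hab)

/-- Stably separated: every embedding into a member of `F` sends `a`, `b` to separated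
elements. -/
def StablySeparated (F : Set (Struc σ)) (X : Struc σ) (a b : X.carrier) (hab : a ≠ b) : Prop :=
  ∀ X' : Struc σ, MemUpIso F X' → ∀ f : Emb X X',
    Separated F X' (f.toFun a) (f.toFun b) (fun h => hab (f.inj h))

/-- Isomorphism of marked structures. -/
def MarkedIso (X : Struc σ) (a : X.carrier) (Y : Struc σ) (b : Y.carrier) : Prop :=
  ∃ f : Emb X Y, f.IsIso ∧ f.toFun a = b

/-- `b` is extraneous in the marked structure `(X, a)` if it is separated from `a`. -/
def Extraneous (F : Set (Struc σ)) (X : Struc σ) (a b : X.carrier) : Prop :=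
  ∃ h : a ≠ b, Separated F X a b h

/-- A marked structure is minimal if it has no extraneous elements. -/
def MinimalMarked (F : Set (Struc σ)) (X : Struc σ) (a : X.carrier) : Prop :=
  ∀ b : X.carrier, ¬ Extraneous F X a b

/-- `f : W → X` is a one-point extension missing exactly `a`. -/
def IsOnePointExt {W X : Struc σ} (f : Emb W X) (a : X.carrier) : Prop :=
  Set.range f.toFun = ({a} : Set X.carrier)ᶜ

end Paper

/-! # Trees and tree structures -/

namespace Paper

/-- A finite tree: a finite connected acyclic simple graph. -/
structure FinTree : Type 1 where
  V : Type
  [fin : Fintype V]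
  [dec : DecidableEq V]
  G : SimpleGraph V
  [adjDec : DecidableRel G.Adj]
  isTree : G.IsTree

attribute [instance] FinTree.fin FinTree.dec FinTree.adjDec

/-- A leaf is a vertex of valence `≤ 1` (in a tree with at least two vertices this is the
same as valence exactly `1`; in a tree with at most two vertices every vertex is a leaf). -/
def FinTree.IsLeaf (T : FinTree) (v : T.V) : Prop := T.G.degree v ≤ 1

instance (T : FinTree) : DecidablePred T.IsLeaf := fun v => by
  unfold FinTree.IsLeaf; infer_instance

/-- A node is a vertex which is not a leaf. -/
def FinTree.IsNode (T : FinTree) (v : T.V) : Prop := ¬ T.IsLeaf v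

/-- A tree is reduced if it has no node of valence 2. -/
def FinTree.Reduced (T : FinTree) : Prop := ∀ v : T.V, T.G.degree v ≠ 2

/-- The quaternary relation on the vertices of a tree: the four vertices are pairwise
distinct and the path from `x₁` to `x₂` has a common edge with the path from `y₁` to
`y₂`. -/
def FinTree.pathRel (T : FinTree) (x₁ x₂ y₁ y₂ : T.V) : Prop :=
  ([x₁, x₂, y₁, y₂] : List T.V).Nodup ∧
  ∃ (p : T.G.Walk x₁ x₂) (q : T.G.Walk y₁ y₂), p.IsPath ∧ q.IsPath ∧
    ∃ e : Sym2 T.V, e ∈ p.edges ∧ e ∈ q.edges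

/-- The signature of tree structures: a single quaternary relation. -/
abbrev treeSig : Signature where
  I := Unit
  arity := fun _ => 4
  arity_pos := fun _ => by norm_num

/-- The leaf structure `L(T)` of a tree `T`: the set of leaves together with the quaternary
relation `R(x₁,x₂;y₁,y₂)` expressing that the paths `x₁–x₂` and `y₁–y₂` share an edge. -/
def FinTree.leafStruc (T : FinTree) : Struc treeSig where
  carrier := {v : T.V // T.IsLeaf v}
  rel := fun _ v => T.pathRel (v 0).1 (v 1).1 (v 2).1 (v 3).1

/-- The class `𝔗` of all tree structures (together with the empty structure, the leaf
structure of the empty tree). -/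
def TreeClass : Set (Struc treeSig) :=
  {A | IsEmpty A.carrier ∨ ∃ T : FinTree, StrucIso A T.leafStruc}

/-- The level of a tree is at most `n`: every vertex has valence at most `n`. -/
def FinTree.LevelLe (T : FinTree) (n : ℕ) : Prop := ∀ v : T.V, T.G.degree v ≤ n

/-- The class `𝔗_n` of tree structures of level at most `n`. -/
def TreeClassN (n : ℕ) : Set (Struc treeSig) :=
  {A | IsEmpty A.carrier ∨ ∃ T : FinTree, T.LevelLe n ∧ StrucIso A T.leafStruc}

theorem leafStruc_mem_treeClass (T : FinTree) : T.leafStruc ∈ TreeClass :=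
  Or.inr ⟨T, strucIso_refl _⟩

/-- The set of leaves of a tree. -/
def FinTree.leafFinset (T : FinTree) : Finset T.V := Finset.univ.filter T.IsLeaf

/-- The number of leaves, `ℓ(T)`. -/
def FinTree.nLeaves (T : FinTree) : ℕ := T.leafFinset.card

/-- The set of nodes of a tree. -/
def FinTree.nodeFinset (T : FinTree) : Finset T.V := Finset.univ.filter (fun v => ¬ T.IsLeaf v)

/-- The number of nodes, `n(T)`. -/
def FinTree.nNodes (T : FinTree) : ℕ := T.nodeFinset.card

end Paper

/-! # The marked trees `X_m`, `Y`, `Z` (via their leaf structures) -/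

namespace Paper

/-- The leaf structure of the star tree `X_m` (one central node adjacent to `m` leaves; for
`m ≤ 2` the tree with `m` vertices): `m` leaves and the empty quaternary relation. -/
def XmStruc (m : ℕ) : Struc treeSig where
  carrier := Fin m
  rel := fun _ _ => False

/-- `(X, a)` is isomorphic as a marked structure to the marked leaf structure of the star
`X_m` (marked at one of its leaves). -/
def IsMarkedXm (m : ℕ) (hm : 0 < m) (X : Struc treeSig) (a : X.carrier) : Prop :=
  ∃ f : Emb (XmStruc m) X, f.IsIso ∧ f.toFun ⟨0, hm⟩ = a

/-- The leaf structure of the tree `Y`: two adjacent valence-3 nodes, each additionally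
adjacent to two leaves.  Leaves `0,1` hang off the first node and `2,3` off the second;
`R(x₁,x₂;y₁,y₂)` holds iff all four are distinct and both paths cross the middle edge. -/
def YStruc : Struc treeSig where
  carrier := Fin 4
  rel := fun _ v => Function.Injective v ∧
    ((((v 0 : Fin 4) : ℕ) < 2 ↔ ¬ (((v 1 : Fin 4) : ℕ) < 2)) ∧
     ((((v 2 : Fin 4) : ℕ) < 2 ↔ ¬ (((v 3 : Fin 4) : ℕ) < 2))))

/-- `(X, a)` is isomorphic as a marked structure to the marked leaf structure of `Y`. -/
def IsMarkedY (X : Struc treeSig) (a : X.carrier) : Prop :=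
  ∃ f : Emb YStruc X, f.IsIso ∧ f.toFun (0 : Fin 4) = a

/-- `x` is a leaf adjacent to the node `A` of the tree `Z` below. -/
def ZsideA (x : Fin 5) : Prop := (x : ℕ) < 2

/-- `x` is a leaf adjacent to the node `C` of the tree `Z` below. -/
def ZsideC (x : Fin 5) : Prop := 2 ≤ (x : ℕ) ∧ (x : ℕ) < 4

/-- The leaf structure of the tree `Z`: three valence-3 nodes forming a path `A–B–C`, with
leaves `0,1` adjacent to `A`, leaves `2,3` adjacent to `C` and leaf `4` adjacent to `B`.
`R(x₁,x₂;y₁,y₂)` holds iff all four are distinct and both paths cross the edge `A–B`, or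
both paths cross the edge `B–C`. -/
def ZStruc : Struc treeSig where
  carrier := Fin 5
  rel := fun _ v => Function.Injective v ∧
    (((ZsideA (v 0) ↔ ¬ ZsideA (v 1)) ∧ (ZsideA (v 2) ↔ ¬ ZsideA (v 3))) ∨
     ((ZsideC (v 0) ↔ ¬ ZsideC (v 1)) ∧ (ZsideC (v 2) ↔ ¬ ZsideC (v 3))))

/-- `(X, a)` is isomorphic as a marked structure to the marked leaf structure of `Z`
(marked at the leaf adjacent to the middle node). -/
def IsMarkedZ (X : Struc treeSig) (a : X.carrier) : Prop :=
  ∃ f : Emb ZStruc X, f.IsIso ∧ f.toFun (4 : Fin 5) = a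

end Paper

/-! # The ring `Θ(𝔉)` of a Fraïssé class -/

namespace Paper

variable {σ : Signature}

/-- Generators of `Θ(𝔉)`: one for each embedding between members of `𝔉`. -/
def ThetaGen (F : Set (Struc σ)) : Type 1 :=
  Σ (X : {X : Struc σ // X ∈ F}) (Y : {Y : Struc σ // Y ∈ F}), Emb X.1 Y.1

/-- The polynomial ring on the generators of `Θ(𝔉)`. -/
abbrev ThetaPoly (F : Set (Struc σ)) := MvPolynomial (ThetaGen F) ℤ

/-- The generator `[i]` for an embedding `i : X → Y` between members of `𝔉`. -/
noncomputable def thetaVar {F : Set (Struc σ)} (X Y : Struc σ) (hX : X ∈ F) (hY : Y ∈ F)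
    (f : Emb X Y) : ThetaPoly F :=
  MvPolynomial.X ⟨⟨X, hX⟩, ⟨Y, hY⟩, f⟩

/-- The defining relations of `Θ(𝔉)`: `[i] = 1` for isomorphisms, `[j∘i] = [j]·[i]`,
and the amalgamation relations `[i] = Σ_α [i'_α]` where `i'_α` runs over a complete
irredundant system of representatives of the isomorphism classes of amalgamations
lying in `𝔉`. -/
def ThetaRels (F : Set (Struc σ)) : Set (ThetaPoly F) :=
  {p | ∃ (X Y : Struc σ) (hX : X ∈ F) (hY : Y ∈ F) (f : Emb X Y),
      f.IsIso ∧ p = thetaVar X Y hX hY f - 1} ∪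
  {p | ∃ (X Y Z : Struc σ) (hX : X ∈ F) (hY : Y ∈ F) (hZ : Z ∈ F)
      (f : Emb X Y) (g : Emb Y Z),
      p = thetaVar X Z hX hZ (g.comp f) - thetaVar Y Z hY hZ g * thetaVar X Y hX hY f} ∪
  {p | ∃ (X Y X' : Struc σ) (hX : X ∈ F) (hY : Y ∈ F) (hX' : X' ∈ F)
      (i : Emb X Y) (f : Emb X X') (m : ℕ) (r : Fin m → Amalg i f)
      (hr : ∀ α, (r α).Z ∈ F),
      (∀ A : Amalg i f, MemUpIso F A.Z → ∃ α, A.Iso (r α)) ∧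
      (∀ α β, (r α).Iso (r β) → α = β) ∧
      p = thetaVar X Y hX hY i - ∑ α, thetaVar X' (r α).Z hX' (hr α) ((r α).j₂)}

/-- The ring `Θ(𝔉)`. -/
abbrev ThetaRing (F : Set (Struc σ)) : Type 1 :=
  ThetaPoly F ⧸ Ideal.span (ThetaRels F)

/-- The class `[i] ∈ Θ(𝔉)` of an embedding between members of `𝔉`. -/
noncomputable def thetaClass {F : Set (Struc σ)} (X Y : Struc σ) (hX : X ∈ F) (hY : Y ∈ F)
    (f : Emb X Y) : ThetaRing F :=
  Ideal.Quotient.mk _ (thetaVar X Y hX hY f)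

end Paper

namespace Paper

/-- The polynomial `u ∈ ℤ[u,v]`. -/
noncomputable def uP : MvPolynomial (Fin 2) ℤ := MvPolynomial.X 0

/-- The polynomial `v ∈ ℤ[u,v]`. -/
noncomputable def vP : MvPolynomial (Fin 2) ℤ := MvPolynomial.X 1

/-- The ring `ℤ[u,v]/(uv)`. -/
abbrev UVQuot : Type := MvPolynomial (Fin 2) ℤ ⧸ Ideal.span {uP * vP}

/-- The map `e` sends the class `[X,a]` of every marked tree structure isomorphic to the
marked pattern `(Pat, pt)` to the image of `val` in `ℤ[u,v]/(uv)`.  Here `[X,a]` is the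
class in `Θ(𝔗)` of any one-point extension `W → X` (with `W ∈ 𝔗`) whose image is
`X∖{a}`. -/
def SendsMarkedTo (e : ThetaRing TreeClass → UVQuot)
    (Pat : Struc treeSig) (pt : Pat.carrier) (val : MvPolynomial (Fin 2) ℤ) : Prop :=
  ∀ (X : Struc treeSig) (hX : X ∈ TreeClass) (a : X.carrier),
    (∃ f : Emb Pat X, f.IsIso ∧ f.toFun pt = a) →
    ∀ (W : Struc treeSig) (hW : W ∈ TreeClass) (g : Emb W X), IsOnePointExt g a →
      e (thetaClass W X hW hX g) = Ideal.Quotient.mk _ val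

end Paper

namespace Paper

/-! # Ultrametric representations of tree structures -/

section Ultra

/-- A natural-number valued ultrametric. -/
structure IsUltra {V : Type} (d : V → V → ℕ) : Prop where
  self : ∀ x, d x x = 0
  pos : ∀ x y, x ≠ y → 0 < d x y
  symm : ∀ x y, d x y = d y x
  tri : ∀ x y z, d x z ≤ max (d x y) (d y z)

/-- The pairs `x, y` and `z, w` are split by some ball of the ultrametric `d`. -/
def Split {V : Type} (d : V → V → ℕ) (x y z w : V) : Prop :=
  (d x y < d x z ∧ d x y < d x w) ∨ (d z w < d z x ∧ d z w < d z y)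

/-- The ultrametric `d` represents the tree structure `Y`. -/
structure Rep (Y : Struc treeSig) (d : Y.carrier → Y.carrier → ℕ) : Prop where
  ultra : IsUltra d
  rel_iff : ∀ v : Fin 4 → Y.carrier, Y.rel () v ↔ Function.Injective v ∧
    (Split d (v 0) (v 2) (v 1) (v 3) ∨ Split d (v 0) (v 3) (v 1) (v 2))

theorem IsUltra.comap {V W : Type} {d : V → V → ℕ} (h : IsUltra d) {f : W → V}
    (hf : Function.Injective f) : IsUltra (fun x y => d (f x) (f y)) where
  self _ := h.self _
  pos _ _ hxy := h.pos _ _ (hf.ne hxy)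
  symm _ _ := h.symm _ _
  tri _ _ _ := h.tri _ _ _

theorem Rep.comap {X Y : Struc treeSig} {d : Y.carrier → Y.carrier → ℕ} (h : Rep Y d)
    (f : Emb X Y) : Rep X (fun x y => d (f.toFun x) (f.toFun y)) where
  ultra := h.ultra.comap f.inj
  rel_iff v := by
    rw [← f.rel_iff () v, h.rel_iff]
    have : Function.Injective (fun j => f.toFun (v j)) ↔ Function.Injective v :=
      ⟨fun hi => Function.Injective.of_comp (f := f.toFun) hi, fun hi => f.inj.comp hi⟩
    exact and_congr this Iff.rfl

theorem injective_fin_four {V : Type} (v : Fin 4 → V) : Function.Injective v ↔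
    (v 0 ≠ v 1 ∧ v 0 ≠ v 2 ∧ v 0 ≠ v 3 ∧ v 1 ≠ v 2 ∧ v 1 ≠ v 3 ∧ v 2 ≠ v 3) := by
  constructor
  · intro h
    refine ⟨h.ne ?_, h.ne ?_, h.ne ?_, h.ne ?_, h.ne ?_, h.ne ?_⟩ <;> decide
  · rintro ⟨h1, h2, h3, h4, h5, h6⟩ i j hij
    fin_cases i <;> fin_cases j <;> simp_all

section Laminar

variable {V E : Type}

/-- A laminar family of subsets. -/
def IsLaminar (S : E → V → Prop) : Prop :=
  ∀ e f, (∀ x, S e x → S f x) ∨ (∀ x, S f x → S e x) ∨ (∀ x, ¬ (S e x ∧ S f x))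

/-- The members of the family containing two given points. -/
def commonSets (S : E → V → Prop) (x y : V) : Set E := {e | S e x ∧ S e y}

theorem commonSets_comm (S : E → V → Prop) (x y : V) : commonSets S x y = commonSets S y x := by
  ext e; exact and_comm

theorem IsLaminar.chain {S : E → V → Prop} (h : IsLaminar S) (x y z : V) :
    commonSets S x y ⊆ commonSets S x z ∨ commonSets S x z ⊆ commonSets S x y := by
  by_contra! hc
  obtain ⟨h1, h2⟩ := hc
  obtain ⟨e, he, he'⟩ := Set.not_subset.mp h1
  obtain ⟨f, hf, hf'⟩ := Set.not_subset.mp h2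
  simp only [commonSets, Set.mem_ofPred_eq] at *
  rcases h e f with h | h | h
  · exact hf' ⟨hf.1, h _ he.2⟩
  · exact he' ⟨he.1, h _ hf.2⟩
  · exact h x ⟨he.1, hf.1⟩

open Classical in
/-- The ultrametric attached to a laminar family. -/
noncomputable def lamDist (S : E → V → Prop) (x y : V) : ℕ :=
  if x = y then 0 else Nat.card E + 1 - (commonSets S x y).ncard

variable [Finite E]

theorem ncard_commonSets_le (S : E → V → Prop) (x y : V) :
    (commonSets S x y).ncard ≤ Nat.card E := Set.ncard_le_card _

theorem IsLaminar.isUltra {S : E → V → Prop} (h : IsLaminar S) : IsUltra (lamDist S) where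
  self _ := by simp [lamDist]
  pos x y hxy := by
    have := ncard_commonSets_le S x y
    simp only [lamDist, if_neg hxy]; omega
  symm x y := by
    by_cases hxy : x = y
    · simp [hxy]
    · simp [lamDist, hxy, Ne.symm hxy, commonSets_comm S x y]
  tri x y z := by
    have key : (commonSets S x y).ncard ≤ (commonSets S x z).ncard ∨
        (commonSets S y z).ncard ≤ (commonSets S x z).ncard := by
      rcases h.chain y x z with h | h
      · left
        refine Set.ncard_le_ncard (fun e he => ?_) (Set.toFinite _)
        exact ⟨he.1, (h (⟨he.2, he.1⟩ : e ∈ commonSets S y x)).2⟩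
      · right
        refine Set.ncard_le_ncard (fun e he => ?_) (Set.toFinite _)
        exact ⟨(h (he : e ∈ commonSets S y z)).2, he.2⟩
    by_cases hxz : x = z
    · simp [lamDist, hxz]
    by_cases hxy : x = y
    · subst hxy; simp
    by_cases hyz : y = z
    · subst hyz; simp
    simp only [lamDist, if_neg hxz, if_neg hxy, if_neg hyz]
    omega

theorem IsLaminar.lt_iff {S : E → V → Prop} (h : IsLaminar S) {x y z w : V} (hxy : x ≠ y)
    (hxz : x ≠ z) (hxw : x ≠ w) :
    (lamDist S x y < lamDist S x z ∧ lamDist S x y < lamDist S x w) ↔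
      ∃ e, S e x ∧ S e y ∧ ¬ S e z ∧ ¬ S e w := by
  have b1 := ncard_commonSets_le S x y
  have b2 := ncard_commonSets_le S x z
  have b3 := ncard_commonSets_le S x w
  simp only [lamDist, if_neg hxy, if_neg hxz, if_neg hxw]
  constructor
  · rintro ⟨h1, h2⟩
    have key : ∀ t, (commonSets S x t).ncard < (commonSets S x y).ncard →
        ∃ e ∈ commonSets S x y, e ∉ commonSets S x t := fun t ht => by
      by_contra! hc
      exact absurd (Set.ncard_le_ncard (show commonSets S x y ⊆ commonSets S x t from hc)
        (Set.toFinite _)) (by omega)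
    rcases h.chain x z w with hc | hc
    · obtain ⟨e, he, he'⟩ := key w (by omega)
      exact ⟨e, he.1, he.2, fun hz => he' (hc ⟨he.1, hz⟩), fun hw => he' ⟨he.1, hw⟩⟩
    · obtain ⟨e, he, he'⟩ := key z (by omega)
      exact ⟨e, he.1, he.2, fun hw => he' ⟨he.1, hw⟩, fun hz => he' (hc ⟨he.1, hz⟩)⟩
  · rintro ⟨e, hx, hy, hz, hw⟩
    have key : ∀ t, ¬ S e t → (commonSets S x t).ncard < (commonSets S x y).ncard := fun t ht => by
      refine Set.ncard_lt_ncard ⟨?_, fun hs => ht (hs (⟨hx, hy⟩ : e ∈ commonSets S x y)).2⟩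
        (Set.toFinite _)
      rcases h.chain x y t with hc | hc
      · exact absurd (hc (⟨hx, hy⟩ : e ∈ commonSets S x y)).2 ht
      · exact hc
    have k1 := key z hz
    have k2 := key w hw
    omega

theorem IsLaminar.split_iff {S : E → V → Prop} (h : IsLaminar S) {x y z w : V}
    (hxy : x ≠ y) (hxz : x ≠ z) (hxw : x ≠ w) (hyz : y ≠ z) (hzw : z ≠ w) :
    Split (lamDist S) x y z w ↔
      ∃ e, (S e x ↔ S e y) ∧ (S e z ↔ S e w) ∧ (S e x ↔ ¬ S e z) := by
  unfold Split
  rw [h.lt_iff hxy hxz hxw, h.lt_iff hzw hxz.symm hyz.symm, ← exists_or]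
  refine exists_congr fun e => ?_
  tauto

/-- A structure whose relation comes from a laminar family has an ultrametric
representation. -/
theorem IsLaminar.rep {Y : Struc treeSig} {S : E → Y.carrier → Prop} (h : IsLaminar S)
    (hY : ∀ v : Fin 4 → Y.carrier, Y.rel () v ↔ Function.Injective v ∧
      ∃ e, (S e (v 0) ↔ ¬ S e (v 1)) ∧ (S e (v 2) ↔ ¬ S e (v 3))) :
    Rep Y (lamDist S) where
  ultra := h.isUltra
  rel_iff v := by
    rw [hY]
    refine and_congr_right fun hv => ?_
    rw [injective_fin_four] at hv
    obtain ⟨h1, h2, h3, h4, h5, h6⟩ := hv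
    rw [h.split_iff h2 h1 h3 h4.symm h5, h.split_iff h3 h1 h2 h5.symm h4, ← exists_or]
    refine exists_congr fun e => ?_
    tauto

end Laminar

section TreeToUltra

open SimpleGraph

variable {V : Type} {G : SimpleGraph V}

theorem mem_edges_iff_not_reachable (hG : G.IsAcyclic) {x y : V} (p : G.Walk x y)
    (hp : p.IsPath) (e : Sym2 V) :
    e ∈ p.edges ↔ ¬ (G.deleteEdges {e}).Reachable x y := by
  classical
  constructor
  · rintro he ⟨q⟩
    have hq := q.toPath.2
    set q' : (G.deleteEdges {e}).Walk x y := q.toPath.1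
    have hle : G.deleteEdges {e} ≤ G := deleteEdges_le _
    have h1 : (q'.mapLe hle).IsPath := by
      rw [Walk.isPath_mapLe]; exact hq
    have h2 : (⟨p, hp⟩ : G.Path x y) = ⟨q'.mapLe hle, h1⟩ := (hG.subsingleton_path x y).elim _ _
    have h3 : p = q'.mapLe hle := congrArg Subtype.val h2
    rw [h3, Walk.edges_mapLe_eq_edges] at he
    have := Walk.edges_subset_edgeSet q' he
    simp [edgeSet_deleteEdges] at this
  · intro h
    by_contra he
    apply h
    refine ⟨p.toDeleteEdges {e} ?_⟩
    intro e' he' h'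
    rw [Set.mem_singleton_iff] at h'
    exact he (h' ▸ he')

theorem exists_edge_of_not_reachable (hG : G.Connected) {x y : V} {e : Sym2 V}
    (h : ¬ (G.deleteEdges {e}).Reachable x y) : e ∈ G.edgeSet := by
  by_contra he
  apply h
  rw [deleteEdges_eq_self.mpr (by simpa using he)]
  exact hG.preconnected x y

theorem reachable_or_of_connected (hG : G.Connected) (u v x : V) :
    (G.deleteEdges {s(u, v)}).Reachable u x ∨ (G.deleteEdges {s(u, v)}).Reachable v x := by
  obtain ⟨p⟩ := hG.preconnected u x
  have : ∀ (a b : V) (p : G.Walk a b), ((G.deleteEdges {s(u, v)}).Reachable u a ∨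
      (G.deleteEdges {s(u, v)}).Reachable v a) → ((G.deleteEdges {s(u, v)}).Reachable u b ∨
      (G.deleteEdges {s(u, v)}).Reachable v b) := by
    intro a b p
    induction p with
    | nil => exact id
    | @cons a c b hac p ih =>
      intro ha
      apply ih
      by_cases he : s(a, c) = s(u, v)
      · rw [Sym2.eq_iff] at he
        rcases he with ⟨-, rfl⟩ | ⟨-, rfl⟩
        · right; exact Reachable.refl _
        · left; exact Reachable.refl _
      · have hadj : (G.deleteEdges {s(u, v)}).Adj a c := by
          rw [deleteEdges_adj]; exact ⟨hac, by simpa using he⟩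
        exact ha.imp (fun h => h.trans hadj.reachable) (fun h => h.trans hadj.reachable)
  exact this u x p (Or.inl (Reachable.refl _))

/-- The vertex `x` is cut off from the root `ρ` by removing `e`. -/
def cutOff (G : SimpleGraph V) (ρ : V) (e : Sym2 V) (x : V) : Prop :=
  ¬ (G.deleteEdges {e}).Reachable ρ x

theorem cutOff_iff_of_reachable {ρ : V} {e : Sym2 V} {x y : V}
    (h : (G.deleteEdges {e}).Reachable x y) : cutOff G ρ e x ↔ cutOff G ρ e y :=
  not_congr ⟨fun h' => h'.trans h, fun h' => h'.trans h.symm⟩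

theorem reachable_iff_cutOff (hG : G.Connected) (ρ : V) (e : Sym2 V) (x y : V) :
    (G.deleteEdges {e}).Reachable x y ↔ (cutOff G ρ e x ↔ cutOff G ρ e y) := by
  refine ⟨cutOff_iff_of_reachable, fun h => ?_⟩
  by_cases hx : cutOff G ρ e x
  · have hy := h.mp hx
    induction e with
    | _ u v =>
    unfold cutOff at hx hy
    have h1 := reachable_or_of_connected hG u v ρ
    have h2 := reachable_or_of_connected hG u v x
    have h3 := reachable_or_of_connected hG u v y
    rcases h1 with h1 | h1
    · rcases h2 with h2 | h2
      · exact absurd (h1.symm.trans h2) hx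
      rcases h3 with h3 | h3
      · exact absurd (h1.symm.trans h3) hy
      exact h2.symm.trans h3
    · rcases h2 with h2 | h2
      · rcases h3 with h3 | h3
        · exact h2.symm.trans h3
        exact absurd (h1.symm.trans h3) hy
      exact absurd (h1.symm.trans h2) hx
  · have hy := (not_congr h).mp hx
    unfold cutOff at hx hy
    push Not at hx hy
    exact hx.symm.trans hy

theorem reachable_avoid {ρ u v : V} {e : Sym2 V}
    {x y : V} (p : (G.deleteEdges {e}).Walk x y) (hu : ¬ (cutOff G ρ e u ↔ cutOff G ρ e x)) :
    (G.deleteEdges {s(u, v)}).Reachable x y := by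
  induction p with
  | nil => exact Reachable.refl _
  | @cons a c b hac p ih =>
    have hc : cutOff G ρ e a ↔ cutOff G ρ e c := cutOff_iff_of_reachable hac.reachable
    have h1 := ih (by rwa [← hc])
    refine Reachable.trans (Adj.reachable ?_) h1
    rw [deleteEdges_adj]
    refine ⟨(deleteEdges_adj.mp hac).1, ?_⟩
    intro he
    rw [Set.mem_singleton_iff, Sym2.eq_iff] at he
    rcases he with ⟨rfl, rfl⟩ | ⟨rfl, rfl⟩ <;> tauto

theorem isLaminar_cutOff (hG : G.Connected) (ρ : V) : IsLaminar (cutOff G ρ) := by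
  intro e e'
  by_cases hee : e = e'
  · subst hee; exact Or.inl fun x h => h
  by_cases he' : e' ∈ G.edgeSet
  swap
  · right; right
    rintro x ⟨-, hx⟩
    exact he' (exists_edge_of_not_reachable hG hx)
  induction e' with
  | _ u v =>
  by_cases hu : cutOff G ρ e u
  · right; left
    intro x hx
    by_contra hx'
    have hx'' : (G.deleteEdges {e}).Reachable ρ x := not_not.mp hx'
    obtain ⟨p⟩ := hx''
    refine hx (reachable_avoid (ρ := ρ) (u := u) (v := v) p ?_)
    intro h
    exact (h.mp hu) (Reachable.refl _)
  · have key : ∀ x y, cutOff G ρ e x → cutOff G ρ e y →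
        (cutOff G ρ s(u, v) x → cutOff G ρ s(u, v) y) := by
      intro x y hx hy
      obtain ⟨p⟩ := (reachable_iff_cutOff hG ρ e x y).mpr (by tauto)
      exact (cutOff_iff_of_reachable (reachable_avoid (ρ := ρ) p (by tauto))).mp
    by_cases hex : ∃ x, cutOff G ρ e x ∧ cutOff G ρ s(u, v) x
    · obtain ⟨x, hx1, hx2⟩ := hex
      left
      intro y hy
      exact key x y hx1 hy hx2
    · right; right
      push Not at hex
      rintro x ⟨h1, h2⟩
      exact hex x h1 h2

theorem FinTree.pathRel_iff (T : FinTree) (x₁ x₂ y₁ y₂ : T.V) : T.pathRel x₁ x₂ y₁ y₂ ↔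
    ([x₁, x₂, y₁, y₂] : List T.V).Nodup ∧ ∃ e : Sym2 T.V,
      ¬ (T.G.deleteEdges {e}).Reachable x₁ x₂ ∧ ¬ (T.G.deleteEdges {e}).Reachable y₁ y₂ := by
  have hc := T.isTree.connected
  have ha := T.isTree.isAcyclic
  unfold FinTree.pathRel
  refine and_congr_right fun _ => ?_
  constructor
  · rintro ⟨p, q, hp, hq, e, h1, h2⟩
    exact ⟨e, (mem_edges_iff_not_reachable ha p hp e).mp h1,
      (mem_edges_iff_not_reachable ha q hq e).mp h2⟩
  · rintro ⟨e, h1, h2⟩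
    obtain ⟨p, hp⟩ := hc.exists_isPath x₁ x₂
    obtain ⟨q, hq⟩ := hc.exists_isPath y₁ y₂
    exact ⟨p, q, hp, hq, e, (mem_edges_iff_not_reachable ha p hp e).mpr h1,
      (mem_edges_iff_not_reachable ha q hq e).mpr h2⟩

theorem nodup_four_iff {V : Type} (v : Fin 4 → V) :
    ([v 0, v 1, v 2, v 3] : List V).Nodup ↔ Function.Injective v := by
  rw [injective_fin_four]
  simp only [List.nodup_cons, List.mem_cons, List.not_mem_nil, not_or, or_false, ne_eq]
  simp only [not_false_eq_true, List.nodup_nil, and_true]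
  tauto

theorem FinTree.exists_rep (T : FinTree) : ∃ d, Rep T.leafStruc d := by
  obtain ⟨ρ⟩ := T.isTree.connected.nonempty
  have hc := T.isTree.connected
  have hlam := isLaminar_cutOff hc ρ
  refine ⟨_, IsLaminar.rep (Y := T.leafStruc) (E := Sym2 T.V)
    (S := fun e (x : {v : T.V // T.IsLeaf v}) => cutOff T.G ρ e x.1) ?_ ?_⟩
  · intro e e'
    rcases hlam e e' with h | h | h
    · exact Or.inl fun x => h _
    · exact Or.inr (Or.inl fun x => h _)
    · exact Or.inr (Or.inr fun x => h _)
  · intro v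
    change T.pathRel (v 0).1 (v 1).1 (v 2).1 (v 3).1 ↔ _
    rw [T.pathRel_iff]
    have h1 := nodup_four_iff (fun i => (v i).1)
    have h2 : Function.Injective (fun i => (v i).1) ↔ Function.Injective v :=
      ⟨fun hi => Function.Injective.of_comp (f := Subtype.val) hi,
        fun hi => Subtype.val_injective.comp hi⟩
    refine and_congr (h1.trans h2) (exists_congr fun e => ?_)
    rw [reachable_iff_cutOff hc ρ e, reachable_iff_cutOff hc ρ e]
    tauto

end TreeToUltra

end Ultra

section UltraToTree

open SimpleGraph

variable {V : Type} (d : V → V → ℕ)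

/-- The closed balls of an ultrametric. -/
def Cluster : Type := {S : Set V // ∃ x y, S = {z | d x z ≤ d x y}}

instance : PartialOrder (Cluster d) := inferInstanceAs (PartialOrder (Subtype _))

instance [Finite V] : Finite (Cluster d) := inferInstanceAs (Finite (Subtype _))

variable {d}

/-- The ball around `x` reaching to `y`. -/
def ball (d : V → V → ℕ) (x y : V) : Cluster d := ⟨{z | d x z ≤ d x y}, x, y, rfl⟩

theorem mem_ball {x y z : V} : z ∈ (ball d x y).1 ↔ d x z ≤ d x y := Iff.rfl

namespace IsUltra

theorem mem_ball_left (h : IsUltra d) (x y : V) : x ∈ (ball d x y).1 := by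
  rw [mem_ball, h.self]; exact Nat.zero_le _

theorem cluster_nonempty (h : IsUltra d) (S : Cluster d) : ∃ x, x ∈ S.1 := by
  obtain ⟨S, x, y, rfl⟩ := S
  exact ⟨x, h.mem_ball_left x y⟩

theorem eq_ball_of_mem (h : IsUltra d) (S : Cluster d) {x : V} (hx : x ∈ S.1) : ∃ y ∈ S.1, S = ball d x y := by
  obtain ⟨S, a, b, rfl⟩ := S
  have hab : d a x ≤ d a b := hx
  by_cases hxb : d x b = d a b
  · refine ⟨b, le_refl (d a b), Subtype.ext ?_⟩
    ext z
    change d a z ≤ d a b ↔ d x z ≤ d x b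
    have h1 := h.tri a x z
    have h2 := h.tri x a z
    have h3 := h.symm a x
    omega
  · refine ⟨a, h.mem_ball_left a b, Subtype.ext ?_⟩
    ext z
    change d a z ≤ d a b ↔ d x z ≤ d x a
    have h1 := h.tri a x z
    have h2 := h.tri x a z
    have h3 := h.symm a x
    have h4 := h.tri a x b
    have h5 := h.tri x a b
    omega

theorem cluster_comparable (h : IsUltra d) (S T : Cluster d) {x : V} (hS : x ∈ S.1) (hT : x ∈ T.1) :
    S ≤ T ∨ T ≤ S := by
  obtain ⟨y, -, rfl⟩ := h.eq_ball_of_mem S hS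
  obtain ⟨z, -, rfl⟩ := h.eq_ball_of_mem T hT
  rcases le_total (d x y) (d x z) with hc | hc
  · exact Or.inl fun w hw => le_trans (mem_ball.mp hw) hc
  · exact Or.inr fun w hw => le_trans (mem_ball.mp hw) hc

theorem cluster_chain (h : IsUltra d) {S T U : Cluster d} (hT : S ≤ T) (hU : S ≤ U) : T ≤ U ∨ U ≤ T := by
  obtain ⟨x, hx⟩ := h.cluster_nonempty S
  exact h.cluster_comparable T U (hT hx) (hU hx)

theorem eq_of_covBy (h : IsUltra d) {S T U : Cluster d} (hT : S ⋖ T) (hU : S ⋖ U) : T = U := by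
  rcases h.cluster_chain hT.le hU.le with hc | hc
  · rcases hc.lt_or_eq with hc | hc
    · exact absurd hc (hU.2 hT.lt)
    · exact hc
  · rcases hc.lt_or_eq with hc | hc
    · exact absurd hc (hT.2 hU.lt)
    · exact hc.symm

/-- The singleton ball. -/
theorem mem_single (h : IsUltra d) {x y : V} : y ∈ (ball d x x).1 ↔ y = x := by
  rw [mem_ball, h.self]
  constructor
  · intro h0
    by_contra hne
    have := h.pos x y (Ne.symm hne)
    omega
  · rintro rfl; rw [h.self]

theorem single_le (h : IsUltra d) {x : V} {S : Cluster d} : ball d x x ≤ S ↔ x ∈ S.1 := by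
  constructor
  · intro hS; exact hS (h.mem_ball_left x x)
  · intro hx y hy
    rw [h.mem_single.mp hy]; exact hx

theorem lower_iff_of_adj (h : IsUltra d) {S T X Y : Cluster d} (hST : S ⋖ T)
    (hXY : ((hasse (Cluster d)).deleteEdges {s(S, T)}).Adj X Y) : X ≤ S ↔ Y ≤ S := by
  have key : ∀ X Y : Cluster d, X ⋖ Y → s(X, Y) ≠ s(S, T) → (X ≤ S ↔ Y ≤ S) := by
    intro X Y hc hne
    refine ⟨fun hX => ?_, fun hY => hc.le.trans hY⟩
    rcases hX.lt_or_eq with hX | rfl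
    · rcases h.cluster_chain hc.le hX.le with hc' | hc'
      · exact hc'
      · rcases hc'.lt_or_eq with hc' | rfl
        · exact absurd hc' (hc.2 hX)
        · exact le_refl _
    · exact absurd (by rw [h.eq_of_covBy hc hST]) hne
  rw [deleteEdges_adj, Set.mem_singleton_iff, hasse_adj] at hXY
  rcases hXY.1 with hc | hc
  · exact key X Y hc hXY.2
  · exact (key Y X hc (by rw [Sym2.eq_swap]; exact hXY.2)).symm

theorem lower_iff_of_reachable (h : IsUltra d) {S T X Y : Cluster d} (hST : S ⋖ T)
    (hXY : ((hasse (Cluster d)).deleteEdges {s(S, T)}).Reachable X Y) : X ≤ S ↔ Y ≤ S := by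
  obtain ⟨p⟩ := hXY
  induction p with
  | nil => rfl
  | cons ha _ ih => exact (h.lower_iff_of_adj hST ha).trans ih

theorem acyclic (h : IsUltra d) : (hasse (Cluster d)).IsAcyclic := by
  rw [isAcyclic_iff_forall_adj_isBridge]
  have key : ∀ S T : Cluster d, S ⋖ T → (hasse (Cluster d)).IsBridge s(S, T) := by
    intro S T hc
    rw [isBridge_iff]
    intro hr
    exact absurd ((h.lower_iff_of_reachable hc hr).mp le_rfl) hc.lt.not_ge
  intro S T hST
  rcases (hasse_adj.mp hST) with hc | hc
  · exact key S T hc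
  · rw [Sym2.eq_swap]; exact key T S hc

theorem exists_top [Finite V] [Nonempty V] : ∃ T : Cluster d, ∀ x, x ∈ T.1 := by
  obtain ⟨x⟩ := ‹Nonempty V›
  have : Nonempty V := ⟨x⟩
  obtain ⟨y, hy⟩ := Finite.exists_max (fun y => d x y)
  exact ⟨ball d x y, fun z => mem_ball.mpr (hy z)⟩

theorem connected [Finite V] [Nonempty V] : (hasse (Cluster d)).Connected := by
  obtain ⟨T, hT⟩ := IsUltra.exists_top (d := d)
  have key : ∀ S : Cluster d, (hasse (Cluster d)).Reachable S T := by
    intro S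
    induction S using WellFoundedGT.induction with
    | _ S ih =>
    have hle : S ≤ T := fun x _ => hT x
    rcases hle.lt_or_eq with hlt | rfl
    · obtain ⟨U, hU, -⟩ := exists_covBy_le_of_lt hlt
      exact (Adj.reachable (hasse_adj.mpr (Or.inl hU))).trans (ih U hU.lt)
    · exact Reachable.refl _
  exact { preconnected := fun S U => (key S).trans (key U).symm, nonempty := ⟨T⟩ }

theorem not_reachable_iff (h : IsUltra d) [Finite V] [Nonempty V] {S T : Cluster d} (hST : S ⋖ T)
    (X Y : Cluster d) :
    ¬ ((hasse (Cluster d)).deleteEdges {s(S, T)}).Reachable X Y ↔ ¬ (X ≤ S ↔ Y ≤ S) := by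
  refine ⟨fun hn he => hn ?_, fun hn hr => hn (h.lower_iff_of_reachable hST hr)⟩
  classical
  have key : ∀ X : Cluster d,
      if X ≤ S then ((hasse (Cluster d)).deleteEdges {s(S, T)}).Reachable S X
      else ((hasse (Cluster d)).deleteEdges {s(S, T)}).Reachable T X := by
    intro X
    have hr := reachable_or_of_connected (IsUltra.connected (d := d)) S T X
    split_ifs with hX
    · refine hr.resolve_right fun hr => ?_
      exact absurd ((h.lower_iff_of_reachable hST hr).mpr hX) hST.lt.not_ge
    · refine hr.resolve_left fun hr => ?_
      exact hX ((h.lower_iff_of_reachable hST hr).mp le_rfl)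
  have hX := key X
  have hY := key Y
  by_cases hXS : X ≤ S
  · rw [if_pos hXS] at hX
    rw [if_pos (he.mp hXS)] at hY
    exact hX.symm.trans hY
  · rw [if_neg hXS] at hX
    rw [if_neg (fun hc => hXS (he.mpr hc))] at hY
    exact hX.symm.trans hY

end IsUltra

open Classical in
/-- The tree of balls of an ultrametric. -/
noncomputable def ballTree [Finite V] [Nonempty V] (h : IsUltra d) : FinTree where
  V := Cluster d
  fin := Fintype.ofFinite _
  G := hasse (Cluster d)
  isTree := ⟨IsUltra.connected, h.acyclic⟩

theorem FinTree.isLeaf_iff (T : FinTree) (v : T.V) : T.IsLeaf v ↔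
    ∀ a, T.G.Adj v a → ∀ b, T.G.Adj v b → a = b := by
  unfold FinTree.IsLeaf
  rw [← card_neighborFinset_eq_degree, Finset.card_le_one]
  simp only [mem_neighborFinset]

theorem ballTree_isLeaf_iff [Finite V] [Nonempty V] (h : IsUltra d) (S : Cluster d) :
    (ballTree h).IsLeaf S ↔ ∃ x, S = ball d x x := by
  have hadj : ∀ X Y : Cluster d, (hasse (Cluster d)).Adj X Y ↔ X ⋖ Y ∨ Y ⋖ X := fun X Y => hasse_adj
  refine Iff.trans ((ballTree h).isLeaf_iff S) ?_
  change (∀ a, (hasse (Cluster d)).Adj S a → ∀ b, (hasse (Cluster d)).Adj S b → a = b) ↔ _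
  constructor
  · intro hS
    obtain ⟨x, hx⟩ := h.cluster_nonempty S
    refine ⟨x, ?_⟩
    by_contra hne
    have hlt : ball d x x < S := lt_of_le_of_ne (h.single_le.mpr hx) (Ne.symm hne)
    obtain ⟨C, hC1, hC2⟩ := exists_le_covBy_of_lt hlt
    obtain ⟨z, hz, hz'⟩ : ∃ z ∈ S.1, z ∉ C.1 := by
      by_contra! hc
      exact hC2.lt.not_ge hc
    have hlt' : ball d z z < S := by
      refine lt_of_le_of_ne (h.single_le.mpr hz) ?_
      rintro rfl
      have := h.mem_single.mp hx
      subst this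
      exact hne rfl
    obtain ⟨D, hD1, hD2⟩ := exists_le_covBy_of_lt hlt'
    have := hS C ((hadj _ _).mpr (Or.inr hC2)) D ((hadj _ _).mpr (Or.inr hD2))
    subst this
    exact hz' (h.single_le.mp hD1)
  · rintro ⟨x, rfl⟩
    have key : ∀ X, (hasse (Cluster d)).Adj (ball d x x) X → ball d x x ⋖ X := by
      intro X hX
      rcases (hadj _ _).mp hX with hX | hX
      · exact hX
      · exfalso
        obtain ⟨y, hy⟩ := h.cluster_nonempty X
        have := h.mem_single.mp (hX.le hy)
        subst this
        exact hX.lt.not_ge (h.single_le.mpr hy)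
    intro X hX Y hY
    exact h.eq_of_covBy (key X hX) (key Y hY)

theorem exists_cover_split [Finite V] (h : IsUltra d) (x y z w : V) :
    (∃ S T : Cluster d, S ⋖ T ∧ x ∈ S.1 ∧ y ∈ S.1 ∧ z ∉ S.1 ∧ w ∉ S.1) ↔
      (d x y < d x z ∧ d x y < d x w) := by
  constructor
  · rintro ⟨S, T, -, hx, hy, hz, hw⟩
    obtain ⟨t, -, rfl⟩ := h.eq_ball_of_mem S hx
    rw [mem_ball] at hy hz hw
    omega
  · rintro ⟨h1, h2⟩
    have : Nonempty V := ⟨x⟩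
    obtain ⟨U, hU⟩ := IsUltra.exists_top (d := d)
    have hlt : ball d x y < U := by
      refine lt_of_le_of_ne (fun t _ => hU t) ?_
      rintro rfl
      exact absurd (mem_ball.mp (hU z)) (by omega)
    obtain ⟨T, hT, -⟩ := exists_covBy_le_of_lt hlt
    exact ⟨ball d x y, T, hT, h.mem_ball_left x y, mem_ball.mpr le_rfl,
      fun hc => absurd (mem_ball.mp hc) (by omega), fun hc => absurd (mem_ball.mp hc) (by omega)⟩

theorem split_prop (s a b c e : Prop) : (s ∧ ¬ (a ↔ b) ∧ ¬ (c ↔ e)) ↔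
    ((s ∧ a ∧ c ∧ ¬ b ∧ ¬ e ∨ s ∧ b ∧ e ∧ ¬ a ∧ ¬ c) ∨
      (s ∧ a ∧ e ∧ ¬ b ∧ ¬ c ∨ s ∧ b ∧ c ∧ ¬ a ∧ ¬ e)) := by
  by_cases a <;> by_cases b <;> simp_all <;> tauto

theorem Rep.mem_treeClass {Y : Struc treeSig} {d : Y.carrier → Y.carrier → ℕ} (hR : Rep Y d) :
    Y ∈ TreeClass := by
  rcases isEmpty_or_nonempty Y.carrier with he | hne
  · exact Or.inl he
  right
  have h := hR.ultra
  refine ⟨ballTree h, ⟨fun x => ⟨ball d x x, (ballTree_isLeaf_iff h _).mpr ⟨x, rfl⟩⟩, ?_, ?_⟩, ?_⟩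
  · intro x y hxy
    have h1 : ball d x x = ball d y y := congrArg Subtype.val hxy
    have h2 : x ∈ (ball d y y).1 := h1 ▸ h.mem_ball_left x x
    exact h.mem_single.mp h2
  · intro i v
    change (ballTree h).pathRel (ball d (v 0) (v 0)) (ball d (v 1) (v 1)) (ball d (v 2) (v 2))
      (ball d (v 3) (v 3)) ↔ Y.rel () v
    have hinj : Function.Injective (fun x => ball d x x) := by
      intro x y (h1 : ball d x x = ball d y y)
      have h2 : x ∈ (ball d y y).1 := h1 ▸ h.mem_ball_left x x
      exact h.mem_single.mp h2
    refine ((ballTree h).pathRel_iff _ _ _ _).trans (Iff.trans ?_ (hR.rel_iff v).symm)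
    have hnd := nodup_four_iff (fun i : Fin 4 => ball d (v i) (v i))
    have hnd' : Function.Injective (fun i : Fin 4 => ball d (v i) (v i)) ↔
        Function.Injective v :=
      ⟨fun hi => Function.Injective.of_comp (f := fun x => ball d x x) hi, fun hi => hinj.comp hi⟩
    refine and_congr (hnd.trans hnd') ?_
    have he : (∃ e : Sym2 (Cluster d),
        ¬ ((hasse (Cluster d)).deleteEdges {e}).Reachable (ball d (v 0) (v 0))
          (ball d (v 1) (v 1)) ∧
        ¬ ((hasse (Cluster d)).deleteEdges {e}).Reachable (ball d (v 2) (v 2))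
          (ball d (v 3) (v 3))) ↔
        ∃ S T : Cluster d, S ⋖ T ∧ ¬ (v 0 ∈ S.1 ↔ v 1 ∈ S.1) ∧ ¬ (v 2 ∈ S.1 ↔ v 3 ∈ S.1) := by
      have key : ∀ S T : Cluster d, S ⋖ T → ∀ x y : Y.carrier,
          (¬ ((hasse (Cluster d)).deleteEdges {s(S, T)}).Reachable (ball d x x) (ball d y y) ↔
          ¬ (x ∈ S.1 ↔ y ∈ S.1)) := by
        intro S T hST x y
        rw [h.not_reachable_iff hST, h.single_le, h.single_le]
      constructor
      · rintro ⟨e, h1, h2⟩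
        have hmem := exists_edge_of_not_reachable (IsUltra.connected (d := d)) h1
        induction e with
        | _ S T =>
        rw [mem_edgeSet, hasse_adj] at hmem
        rcases hmem with hc | hc
        · exact ⟨S, T, hc, (key S T hc _ _).mp h1, (key S T hc _ _).mp h2⟩
        · rw [Sym2.eq_swap] at h1 h2
          exact ⟨T, S, hc, (key T S hc _ _).mp h1, (key T S hc _ _).mp h2⟩
      · rintro ⟨S, T, hc, h1, h2⟩
        exact ⟨s(S, T), (key S T hc _ _).mpr h1, (key S T hc _ _).mpr h2⟩
    refine Iff.trans he ?_
    unfold Split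
    simp only [← exists_cover_split h, ← exists_or]
    exact exists_congr fun S => exists_congr fun T => split_prop _ _ _ _ _
  · rintro ⟨S, hS⟩
    obtain ⟨x, hx⟩ := (ballTree_isLeaf_iff h S).mp hS
    exact ⟨x, Subtype.ext hx.symm⟩

/-- Tree structures are exactly the structures with an ultrametric representation. -/
theorem mem_treeClass_iff (Y : Struc treeSig) : Y ∈ TreeClass ↔ ∃ d, Rep Y d := by
  constructor
  · rintro (he | ⟨T, f, -⟩)
    · exact ⟨fun x _ => isEmptyElim x, ⟨⟨fun x => isEmptyElim x, fun x => isEmptyElim x,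
        fun x => isEmptyElim x, fun x => isEmptyElim x⟩, fun v => isEmptyElim (v 0)⟩⟩
    · obtain ⟨d, hd⟩ := T.exists_rep
      exact ⟨_, hd.comap f⟩
  · rintro ⟨d, hd⟩
    exact hd.mem_treeClass

theorem treeClass_of_emb {X Y : Struc treeSig} (f : Emb X Y) (hY : Y ∈ TreeClass) :
    X ∈ TreeClass := by
  rw [mem_treeClass_iff] at hY ⊢
  obtain ⟨d, hd⟩ := hY
  exact ⟨_, hd.comap f⟩

theorem memUpIso_treeClass {X : Struc treeSig} : MemUpIso TreeClass X ↔ X ∈ TreeClass :=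
  ⟨fun ⟨_, hW, f, _⟩ => treeClass_of_emb f hW, memUpIso_of_mem⟩

end UltraToTree


/-- The leaves `x, y` are separated from the leaves `z, w` by an edge. -/
def DD (Y : Struc treeSig) (x y z w : Y.carrier) : Prop :=
  Y.rel () ![x, z, y, w] ∧ Y.rel () ![x, w, y, z]

/-- Four points are pairwise distinct. -/
def Distinct4 {V : Type} (x y z w : V) : Prop :=
  x ≠ y ∧ x ≠ z ∧ x ≠ w ∧ y ≠ z ∧ y ≠ w ∧ z ≠ w

section Quads

theorem IsUltra.two_largest {V : Type} {d : V → V → ℕ} (h : IsUltra d) (x y z : V) :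
    (d x y = d x z ∧ d y z ≤ d x y) ∨ (d x y = d y z ∧ d x z ≤ d x y) ∨
      (d x z = d y z ∧ d x y ≤ d x z) := by
  have e1 := h.symm y x
  have e2 := h.symm z x
  have e3 := h.symm z y
  have t1 := h.tri x y z
  have t2 := h.tri x z y
  have t3 := h.tri y x z
  omega

theorem IsUltra.split_iff_sum {V : Type} {d : V → V → ℕ} (h : IsUltra d) (x y z w : V) :
    Split d x y z w ↔ d x y + d z w < d x z + d y w ∧ d x y + d z w < d x w + d y z := by
  have e2 := h.symm z x
  have e4 := h.symm z y
  have t1 := h.two_largest x y z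
  have t2 := h.two_largest x y w
  have t3 := h.two_largest x z w
  have t4 := h.two_largest y z w
  unfold Split
  rw [e2, e4]
  omega


theorem injective_vec {V : Type} (x y z w : V) :
    Function.Injective ![x, y, z, w] ↔ Distinct4 x y z w := by
  rw [injective_fin_four]; rfl

theorem comp_vec {V W : Type} (f : V → W) (x y z w : V) :
    (fun j => f (![x, y, z, w] j)) = ![f x, f y, f z, f w] := by
  ext j; fin_cases j <;> rfl

theorem Emb.rel_vec {X Y : Struc treeSig} (f : Emb X Y) (x y z w : X.carrier) :
    Y.rel () ![f.toFun x, f.toFun y, f.toFun z, f.toFun w] ↔ X.rel () ![x, y, z, w] := by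
  rw [← f.rel_iff () ![x, y, z, w]]
  exact iff_of_eq (congrArg _ (comp_vec f.toFun x y z w).symm)

theorem Emb.DD_iff {X Y : Struc treeSig} (f : Emb X Y) (x y z w : X.carrier) :
    DD Y (f.toFun x) (f.toFun y) (f.toFun z) (f.toFun w) ↔ DD X x y z w :=
  and_congr (f.rel_vec _ _ _ _) (f.rel_vec _ _ _ _)

variable {Y : Struc treeSig} {d : Y.carrier → Y.carrier → ℕ}

theorem Rep.rel_vec_iff (h : Rep Y d) (x y z w : Y.carrier) :
    Y.rel () ![x, y, z, w] ↔ Distinct4 x y z w ∧ (Split d x z y w ∨ Split d x w y z) := by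
  rw [h.rel_iff, injective_vec]; rfl

theorem Rep.DD_iff (h : Rep Y d) (x y z w : Y.carrier) :
    DD Y x y z w ↔ Distinct4 x y z w ∧ Split d x y z w := by
  unfold DD
  rw [h.rel_vec_iff, h.rel_vec_iff]
  have e1 := h.ultra.symm x y
  have e2 := h.ultra.symm x z
  have e3 := h.ultra.symm x w
  have e4 := h.ultra.symm y z
  have e5 := h.ultra.symm y w
  have e6 := h.ultra.symm z w
  simp only [h.ultra.split_iff_sum]
  unfold Distinct4
  constructor
  · rintro ⟨⟨⟨h1, h2, h3, h4, h5, h6⟩, h7⟩, ⟨-, h8⟩⟩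
    exact ⟨⟨h2, h1, h3, Ne.symm h4, h6, h5⟩, by omega⟩
  · rintro ⟨⟨h1, h2, h3, h4, h5, h6⟩, h7⟩
    exact ⟨⟨⟨h2, h1, h3, Ne.symm h4, h6, h5⟩, by omega⟩,
      ⟨⟨h3, h1, h2, Ne.symm h5, Ne.symm h6, h4⟩, by omega⟩⟩

theorem rel_iff_DD (hY : Y ∈ TreeClass) (v : Fin 4 → Y.carrier) :
    Y.rel () v ↔ DD Y (v 0) (v 2) (v 1) (v 3) ∨ DD Y (v 0) (v 3) (v 1) (v 2) := by
  obtain ⟨d, h⟩ := (mem_treeClass_iff Y).mp hY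
  rw [h.DD_iff, h.DD_iff, h.rel_iff, injective_fin_four]
  have e4 := h.ultra.symm (v 1) (v 2)
  have e5 := h.ultra.symm (v 1) (v 3)
  have e6 := h.ultra.symm (v 2) (v 3)
  unfold Distinct4
  constructor
  · rintro ⟨⟨h1, h2, h3, h4, h5, h6⟩, h7⟩
    have := h4.symm
    have := h5.symm
    have := h6.symm
    tauto
  · rintro (⟨⟨h1, h2, h3, h4, h5, h6⟩, h7⟩ | ⟨⟨h1, h2, h3, h4, h5, h6⟩, h7⟩)
    · exact ⟨⟨h2, h1, h3, h4.symm, h6, h5⟩, Or.inl h7⟩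
    · exact ⟨⟨h2, h3, h1, h6, h4.symm, h5.symm⟩, Or.inr h7⟩

/-- An injection between tree structures preserving `DD` is an embedding. -/
def embOfDD {X Y : Struc treeSig} (hX : X ∈ TreeClass) (hY : Y ∈ TreeClass)
    (f : X.carrier → Y.carrier) (hf : Function.Injective f)
    (h : ∀ x y z w, DD Y (f x) (f y) (f z) (f w) ↔ DD X x y z w) : Emb X Y where
  toFun := f
  inj := hf
  rel_iff := fun _ v => by
    have h1 := rel_iff_DD hX v
    have h2 := rel_iff_DD hY (fun j => f (v j))
    exact h2.trans ((or_congr (h _ _ _ _) (h _ _ _ _)).trans h1.symm)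

theorem DD_distinct (hY : Y ∈ TreeClass) {x y z w : Y.carrier} (h : DD Y x y z w) :
    Distinct4 x y z w := by
  obtain ⟨d, hd⟩ := (mem_treeClass_iff Y).mp hY
  exact ((hd.DD_iff _ _ _ _).mp h).1

theorem DD_swap_left (hY : Y ∈ TreeClass) {x y z w : Y.carrier} (h : DD Y x y z w) :
    DD Y y x z w := by
  obtain ⟨d, hd⟩ := (mem_treeClass_iff Y).mp hY
  rw [hd.DD_iff] at h ⊢
  obtain ⟨⟨h1, h2, h3, h4, h5, h6⟩, h7⟩ := h
  refine ⟨⟨h1.symm, h4, h5, h2, h3, h6⟩, ?_⟩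
  have e1 := hd.ultra.symm x y
  rw [hd.ultra.split_iff_sum] at h7 ⊢
  omega

theorem DD_swap (hY : Y ∈ TreeClass) {x y z w : Y.carrier} (h : DD Y x y z w) :
    DD Y z w x y := by
  obtain ⟨d, hd⟩ := (mem_treeClass_iff Y).mp hY
  rw [hd.DD_iff] at h ⊢
  obtain ⟨⟨h1, h2, h3, h4, h5, h6⟩, h7⟩ := h
  exact ⟨⟨h6, h2.symm, h4.symm, h3.symm, h5.symm, h1⟩, Or.symm h7⟩

theorem DD_swap_right (hY : Y ∈ TreeClass) {x y z w : Y.carrier} (h : DD Y x y z w) :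
    DD Y x y w z := DD_swap hY (DD_swap_left hY (DD_swap hY h))

theorem DD_comm_left (hY : Y ∈ TreeClass) {x y z w : Y.carrier} : DD Y x y z w ↔ DD Y y x z w :=
  ⟨DD_swap_left hY, DD_swap_left hY⟩

theorem DD_comm_right (hY : Y ∈ TreeClass) {x y z w : Y.carrier} : DD Y x y z w ↔ DD Y x y w z :=
  ⟨DD_swap_right hY, DD_swap_right hY⟩

theorem DD_exclusive (hY : Y ∈ TreeClass) {x y z w : Y.carrier} (h : DD Y x y z w) :
    ¬ DD Y x z y w := by
  obtain ⟨d, hd⟩ := (mem_treeClass_iff Y).mp hY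
  rw [hd.DD_iff] at h ⊢
  rintro ⟨-, h8⟩
  obtain ⟨-, h7⟩ := h
  have e1 := hd.ultra.symm x y
  have e2 := hd.ultra.symm x z
  have e3 := hd.ultra.symm x w
  have e4 := hd.ultra.symm y z
  have e5 := hd.ultra.symm y w
  have e6 := hd.ultra.symm z w
  rw [hd.ultra.split_iff_sum] at h7 h8
  omega

end Quads

section Rooted

/-- The ultrametric `d` represents `Y` and puts the root `a` at distance `N` from all other
points. -/
structure Rooted (Y : Struc treeSig) (d : Y.carrier → Y.carrier → ℕ) (a : Y.carrier)
    (N : ℕ) : Prop where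
  rep : Rep Y d
  root : ∀ x, x ≠ a → d a x = N
  lt : ∀ x y, x ≠ a → y ≠ a → d x y < N

open Classical in
/-- The Farris transform of an ultrametric. -/
noncomputable def farris {V : Type} (d : V → V → ℕ) (a : V) (N : ℕ) (x y : V) : ℕ :=
  if x = y then 0 else N + d x y - d x a - d y a

theorem IsUltra.farris {V : Type} {d : V → V → ℕ} (h : IsUltra d) (a : V) (N : ℕ)
    (hN : ∀ x y, d x y + d x y < N) : IsUltra (farris d a N) where
  self x := by simp [Paper.farris]
  pos x y hxy := by
    have h1 := hN x a
    have h2 := hN y a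
    simp only [Paper.farris, if_neg hxy]; omega
  symm x y := by
    by_cases hxy : x = y
    · simp [hxy]
    · have := h.symm x y
      simp only [Paper.farris, if_neg hxy, if_neg (Ne.symm hxy)]; omega
  tri x y z := by
    by_cases hxz : x = z
    · simp [Paper.farris, hxz]
    by_cases hxy : x = y
    · subst hxy; simp
    by_cases hyz : y = z
    · subst hyz; simp
    simp only [Paper.farris, if_neg hxz, if_neg hxy, if_neg hyz]
    have n1 := hN x a
    have n2 := hN y a
    have n3 := hN z a
    have t1 := h.two_largest x y z
    have t2 := h.two_largest x y a
    have t3 := h.two_largest x z a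
    have t4 := h.two_largest y z a
    omega

theorem exists_rooted {Y : Struc treeSig} (hY : Y ∈ TreeClass) (a : Y.carrier) :
    ∃ d N, Rooted Y d a N := by
  obtain ⟨d, hd⟩ := (mem_treeClass_iff Y).mp hY
  have hu := hd.ultra
  obtain ⟨K, hK⟩ : ∃ K, ∀ x y, d x y < K := by
    obtain ⟨K, hK⟩ := (Set.finite_range (fun p : Y.carrier × Y.carrier => d p.1 p.2)).bddAbove
    exact ⟨K + 1, fun x y => Nat.lt_succ_of_le (hK ⟨(x, y), rfl⟩)⟩
  have hN : ∀ x y, d x y + d x y < 2 * K := fun x y => by have := hK x y; omega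
  refine ⟨farris d a (2 * K), 2 * K, ⟨hu.farris a _ hN, fun v => ?_⟩, fun x hx => ?_,
    fun x y hx hy => ?_⟩
  · rw [hd.rel_iff]
    refine and_congr_right fun hv => ?_
    rw [injective_fin_four] at hv
    obtain ⟨h1, h2, h3, h4, h5, h6⟩ := hv
    have key : ∀ x y z w, x ≠ y → x ≠ z → x ≠ w → y ≠ z → y ≠ w → z ≠ w →
        (Split d x y z w ↔ Split (farris d a (2 * K)) x y z w) := by
      intro x y z w h1 h2 h3 h4 h5 h6
      rw [hu.split_iff_sum, (hu.farris a _ hN).split_iff_sum]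
      simp only [farris, if_neg h1, if_neg h2, if_neg h3, if_neg h4, if_neg h5, if_neg h6]
      have n1 := hK x a
      have n2 := hK y a
      have n3 := hK z a
      have n4 := hK w a
      omega
    exact or_congr (key _ _ _ _ h2 h1 h3 h4.symm h6 h5)
      (key _ _ _ _ h3 h1 h2 h5.symm h6.symm h4)
  · rw [farris, if_neg hx.symm, hu.self, hu.symm a x]; omega
  · by_cases hxy : x = y
    · rw [farris, if_pos hxy]; have := hK x a; omega
    · rw [farris, if_neg hxy]
      have t := hu.tri x a y
      have p1 := hu.pos x a hx
      have p2 := hu.pos y a hy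
      have := hu.symm a y
      have := hK x a
      have := hK y a
      omega

theorem Rooted.DD_root {Y : Struc treeSig} {d : Y.carrier → Y.carrier → ℕ} {a : Y.carrier} {N : ℕ}
    (h : Rooted Y d a N) {x y z : Y.carrier} (hx : x ≠ a) (hy : y ≠ a) (hz : z ≠ a) (hxy : x ≠ y)
    (hxz : x ≠ z) (hyz : y ≠ z) : DD Y x y a z ↔ d x y < d x z := by
  rw [h.rep.DD_iff]
  have h1 := h.root x hx
  have h2 := h.root y hy
  have h3 := h.root z hz
  have h4 := h.lt x y hx hy
  have h5 := h.lt x z hx hz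
  have h6 := h.rep.ultra.symm a x
  unfold Split Distinct4
  constructor
  · rintro ⟨-, h7⟩; omega
  · intro h7
    exact ⟨⟨hxy, hx, hxz, hy, hyz, hz.symm⟩, by omega⟩

/-- A structure on the same points with the same order of distances is the same. -/
theorem DD_congr_of_order {X Y : Struc treeSig} {d : X.carrier → X.carrier → ℕ}
    {d' : Y.carrier → Y.carrier → ℕ} (hX : Rep X d) (hY : Rep Y d') (f : X.carrier → Y.carrier)
    (hf : Function.Injective f)
    (h : ∀ x y z, x ≠ y → x ≠ z → y ≠ z → (d x y < d x z ↔ d' (f x) (f y) < d' (f x) (f z)))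
    (x y z w : X.carrier) : DD Y (f x) (f y) (f z) (f w) ↔ DD X x y z w := by
  rw [hX.DD_iff, hY.DD_iff]
  have hd : Distinct4 (f x) (f y) (f z) (f w) ↔ Distinct4 x y z w := by
    unfold Distinct4; simp only [hf.ne_iff]
  refine (and_congr_left' hd).trans (and_congr_right ?_)
  rintro ⟨h1, h2, h3, h4, h5, h6⟩
  unfold Split
  rw [h x y z h1 h2 h4, h x y w h1 h3 h5, h z w x h6 h2.symm h3.symm, h z w y h6 h4.symm h5.symm]

/-- The structure of a tree is determined by the triples seen from a fixed leaf. -/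
theorem Rooted.order_iff {V : Type} {X Y : Struc treeSig} {d : X.carrier → X.carrier → ℕ}
    {d' : Y.carrier → Y.carrier → ℕ} {f : V → X.carrier} {f' : V → Y.carrier} {a : V} {N N' : ℕ}
    (hd : Rooted X d (f a) N) (hd' : Rooted Y d' (f' a) N') (hf : Function.Injective f)
    (hf' : Function.Injective f')
    (h : ∀ x y z, x ≠ a → y ≠ a → z ≠ a → x ≠ y → x ≠ z → y ≠ z →
      (DD Y (f' x) (f' y) (f' a) (f' z) ↔ DD X (f x) (f y) (f a) (f z)))
    (x y z : V) (hxy : x ≠ y) (hxz : x ≠ z) (hyz : y ≠ z) :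
    d (f x) (f y) < d (f x) (f z) ↔ d' (f' x) (f' y) < d' (f' x) (f' z) := by
  by_cases hx : x = a
  · subst hx
    rw [hd.root _ (hf.ne hxy.symm), hd.root _ (hf.ne hxz.symm), hd'.root _ (hf'.ne hxy.symm),
      hd'.root _ (hf'.ne hxz.symm)]
    simp
  by_cases hy : y = a
  · subst hy
    have h1 := hd.root _ (hf.ne hx)
    have h2 := hd'.root _ (hf'.ne hx)
    have h3 := hd.lt _ _ (hf.ne hx) (hf.ne hyz.symm)
    have h4 := hd'.lt _ _ (hf'.ne hx) (hf'.ne hyz.symm)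
    rw [hd.rep.ultra.symm (f x) (f y), hd'.rep.ultra.symm (f' x) (f' y), h1, h2]
    omega
  by_cases hz : z = a
  · subst hz
    have h1 := hd.root _ (hf.ne hx)
    have h2 := hd'.root _ (hf'.ne hx)
    have h3 := hd.lt _ _ (hf.ne hx) (hf.ne hyz)
    have h4 := hd'.lt _ _ (hf'.ne hx) (hf'.ne hyz)
    rw [hd.rep.ultra.symm (f x) (f z), hd'.rep.ultra.symm (f' x) (f' z), h1, h2]
    omega
  rw [← hd.DD_root (hf.ne hx) (hf.ne hy) (hf.ne hz) (hf.ne hxy) (hf.ne hxz) (hf.ne hyz),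
    ← hd'.DD_root (hf'.ne hx) (hf'.ne hy) (hf'.ne hz) (hf'.ne hxy) (hf'.ne hxz) (hf'.ne hyz),
    h x y z hx hy hz hxy hxz hyz]

theorem DD_congr_of_root {X Y : Struc treeSig} (hX : X ∈ TreeClass) (hY : Y ∈ TreeClass)
    (f : X.carrier → Y.carrier) (hf : Function.Injective f) (a : X.carrier)
    (h : ∀ x y z, x ≠ a → y ≠ a → z ≠ a → x ≠ y → x ≠ z → y ≠ z →
      (DD Y (f x) (f y) (f a) (f z) ↔ DD X x y a z))
    (x y z w : X.carrier) : DD Y (f x) (f y) (f z) (f w) ↔ DD X x y z w := by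
  obtain ⟨d, N, hd⟩ := exists_rooted hX a
  obtain ⟨d', N', hd'⟩ := exists_rooted hY (f a)
  exact DD_congr_of_order hd.rep hd'.rep f hf (fun x y z hxy hxz hyz =>
    hd.order_iff (f := id) hd' Function.injective_id hf h x y z hxy hxz hyz) x y z w

end Rooted


section Code

/-- Two points of `S` lie in the same branch as seen from `a`. -/
def Eqv (Y : Struc treeSig) (S : Set Y.carrier) (a x y : Y.carrier) : Prop :=
  x = y ∨ ∃ z ∈ S, DD Y x y a z

/-- The branch of `x` in `S` as seen from `a`. -/
def cls (Y : Struc treeSig) (S : Set Y.carrier) (a x : Y.carrier) : Set Y.carrier :=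
  {y | y ∈ S ∧ Eqv Y S a x y}

/-- The number of branches of `S` as seen from `a`. -/
noncomputable def numCls (Y : Struc treeSig) (S : Set Y.carrier) (a : Y.carrier) : ℕ :=
  (cls Y S a '' S).ncard

/-- The number of branches consisting of a single leaf. -/
noncomputable def numSing (Y : Struc treeSig) (S : Set Y.carrier) (a : Y.carrier) : ℕ :=
  {x | x ∈ S ∧ ∀ y ∈ S, Eqv Y S a x y → y = x}.ncard

/-- The numerical invariant of the one-point extension of `S` by `a`. -/
noncomputable def code (Y : Struc treeSig) (S : Set Y.carrier) (a : Y.carrier) : ℕ × ℕ :=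
  (numCls Y S a, if numCls Y S a = 2 then numSing Y S a else 0)

/-- All pairs in `W` are separated from `a, b` by an edge. -/
def Cherry (Z : Struc treeSig) (W : Set Z.carrier) (a b : Z.carrier) : Prop :=
  ∀ x ∈ W, ∀ y ∈ W, x ≠ y → DD Z x y a b

/-- The points of `W` that are grouped with `b` as seen from `a`. -/
def Near (Z : Struc treeSig) (W : Set Z.carrier) (a b : Z.carrier) : Set Z.carrier :=
  {x | x ∈ W ∧ ∃ y ∈ W, DD Z x b a y}

/-- The points `a` and `b` extend `W` in the same way. -/
def SameType (Z : Struc treeSig) (W : Set Z.carrier) (a b : Z.carrier) : Prop :=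
  ∀ x ∈ W, ∀ y ∈ W, ∀ z ∈ W, (DD Z x y a z ↔ DD Z x y b z)

open Classical in
/-- The indicator of being a singleton. -/
noncomputable def sg {V : Type} (B : Set V) : ℕ := if ∃ x, B = {x} then 1 else 0

variable {V : Type}

theorem ncard_image_eq_of_ker {C D : Type} {S : Set V} (f : V → C) (g : V → D)
    (h : ∀ x ∈ S, ∀ y ∈ S, (f x = f y ↔ g x = g y)) : (f '' S).ncard = (g '' S).ncard := by
  classical
  rcases S.eq_empty_or_nonempty with rfl | ⟨x₀, -⟩
  · simp
  have : Nonempty V := ⟨x₀⟩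
  refine Set.ncard_congr (fun c _ => g (Function.invFunOn f S c)) ?_ ?_ ?_
  · intro c hc
    exact ⟨_, Function.invFunOn_mem hc, rfl⟩
  · intro c c' hc hc' he
    have := (h _ (Function.invFunOn_mem hc) _ (Function.invFunOn_mem hc')).mpr he
    rwa [Function.invFunOn_eq hc, Function.invFunOn_eq hc'] at this
  · rintro _ ⟨x, hx, rfl⟩
    have hc : f x ∈ f '' S := ⟨x, hx, rfl⟩
    refine ⟨f x, hc, ?_⟩
    exact (h _ (Function.invFunOn_mem hc) _ hx).mp (Function.invFunOn_eq hc)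

theorem ncard_single_eq_sg (B : Set V) : {x | x ∈ B ∧ ∀ y ∈ B, y = x}.ncard = sg B := by
  unfold sg
  split_ifs with h
  · obtain ⟨x, rfl⟩ := h
    rw [Set.ncard_eq_one]
    refine ⟨x, ?_⟩
    ext y; simp +contextual [eq_comm]
  · have : {x | x ∈ B ∧ ∀ y ∈ B, y = x} = ∅ := by
      ext x
      simp only [Set.mem_ofPred_eq, Set.mem_empty_iff_false, iff_false]
      rintro ⟨h1, h2⟩
      exact h ⟨x, Set.eq_singleton_iff_unique_mem.mpr ⟨h1, h2⟩⟩
    rw [this, Set.ncard_empty]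

/-- A rooted ultrametric for `Z` with the maximum `M` of the distances inside `S`. -/
structure Spread (Z : Struc treeSig) (S : Set Z.carrier) (a : Z.carrier)
    (d : Z.carrier → Z.carrier → ℕ) (N M : ℕ) : Prop where
  rooted : Rooted Z d a N
  root_notMem : a ∉ S
  le : ∀ x ∈ S, ∀ y ∈ S, d x y ≤ M
  att : ∃ x ∈ S, ∃ y ∈ S, d x y = M
  pos : 0 < M

variable {Z : Struc treeSig} {S W : Set Z.carrier} {a b : Z.carrier}
  {d : Z.carrier → Z.carrier → ℕ} {N M : ℕ}

theorem exists_spread (hZ : Z ∈ TreeClass) (hS : S.Nontrivial) (ha : a ∉ S) :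
    ∃ d N M, Spread Z S a d N M := by
  obtain ⟨d, N, hd⟩ := exists_rooted hZ a
  obtain ⟨x, hx, y, hy, hxy⟩ := hS
  obtain ⟨p, hp, hp'⟩ := Set.exists_max_image (S ×ˢ S) (fun p => d p.1 p.2) (Set.toFinite _)
    ⟨(x, y), hx, hy⟩
  refine ⟨d, N, d p.1 p.2, hd, ha, fun x hx y hy => hp' (x, y) ⟨hx, hy⟩,
    ⟨p.1, hp.1, p.2, hp.2, rfl⟩, ?_⟩
  exact lt_of_lt_of_le (hd.rep.ultra.pos x y hxy) (hp' (x, y) ⟨hx, hy⟩)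

namespace Spread

theorem ne (c : Spread Z S a d N M) {x : Z.carrier} (hx : x ∈ S) : x ≠ a := by
  rintro rfl; exact c.root_notMem hx

theorem partner (c : Spread Z S a d N M) {x : Z.carrier} (hx : x ∈ S) : ∃ y ∈ S, d x y = M := by
  obtain ⟨p, hp, q, hq, hpq⟩ := c.att
  have h1 := c.rooted.rep.ultra.two_largest x p q
  have h2 := c.le x hx p hp
  have h3 := c.le x hx q hq
  by_cases h : d x p = M
  · exact ⟨p, hp, h⟩
  · exact ⟨q, hq, by omega⟩

theorem ne_of_eq (c : Spread Z S a d N M) {x y : Z.carrier} (h : d x y = M) : x ≠ y := by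
  rintro rfl
  have := c.pos
  rw [c.rooted.rep.ultra.self] at h
  omega

theorem eqv_iff (c : Spread Z S a d N M) {x y : Z.carrier} (hx : x ∈ S) (hy : y ∈ S) :
    Eqv Z S a x y ↔ d x y < M := by
  constructor
  · rintro (rfl | ⟨z, hz, h⟩)
    · rw [c.rooted.rep.ultra.self]; exact c.pos
    · have hd := DD_distinct c.rooted.rep.mem_treeClass h
      obtain ⟨h1, h2, h3, h4, h5, h6⟩ := hd
      rw [c.rooted.DD_root h2 h4 h6.symm h1 h3 h5] at h
      exact lt_of_lt_of_le h (c.le x hx z hz)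
  · intro h
    by_cases hxy : x = y
    · exact Or.inl hxy
    obtain ⟨z, hz, hxz⟩ := c.partner hx
    refine Or.inr ⟨z, hz, ?_⟩
    have h1 := c.ne_of_eq hxz
    have h2 : y ≠ z := by rintro rfl; omega
    rw [c.rooted.DD_root (c.ne hx) (c.ne hy) (c.ne hz) hxy h1 h2]
    omega

theorem numCls_eq {C : Type} (c : Spread Z S a d N M) (f : Z.carrier → C)
    (hf : ∀ x ∈ S, ∀ y ∈ S, (d x y < M ↔ f x = f y)) : numCls Z S a = (f '' S).ncard := by
  have hu := c.rooted.rep.ultra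
  refine ncard_image_eq_of_ker _ _ fun x hx y hy => ?_
  rw [← hf x hx y hy]
  constructor
  · intro h
    have : y ∈ cls Z S a x := h ▸ ⟨hy, Or.inl rfl⟩
    exact (c.eqv_iff hx hy).mp this.2
  · intro h
    ext z
    refine and_congr_right fun hz => ?_
    rw [c.eqv_iff hx hz, c.eqv_iff hy hz]
    have := hu.two_largest x y z
    omega

theorem numSing_eq (c : Spread Z S a d N M) :
    numSing Z S a = {x | x ∈ S ∧ ∀ y ∈ S, d x y < M → y = x}.ncard := by
  unfold numSing
  congr 1
  ext x
  refine and_congr_right fun hx => forall_congr' fun y => forall_congr' fun hy => ?_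
  rw [c.eqv_iff hx hy]

/-- The branch of `x` described by distances. -/
def col (d : Z.carrier → Z.carrier → ℕ) (S : Set Z.carrier) (M : ℕ) (x : Z.carrier) :
    Set Z.carrier := {y | y ∈ S ∧ d x y < M}

theorem col_eq_iff (c : Spread Z S a d N M) {x y : Z.carrier} (hx : x ∈ S) :
    d x y < M ↔ col d S M x = col d S M y := by
  have hu := c.rooted.rep.ultra
  constructor
  · intro h
    ext z
    refine and_congr_right fun hz => ?_
    have := hu.two_largest x y z
    omega
  · intro h
    have : x ∈ col d S M x := ⟨hx, by rw [hu.self]; exact c.pos⟩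
    rw [h] at this
    rw [hu.symm]
    exact this.2

theorem numCls_eq_col (c : Spread Z S a d N M) : numCls Z S a = (col d S M '' S).ncard :=
  c.numCls_eq _ fun _ hx _ _ => c.col_eq_iff hx

theorem numCls_eq_two_iff (c : Spread Z S a d N M) {x₀ y₀ : Z.carrier} (hx : x₀ ∈ S) (hy : y₀ ∈ S)
    (h : d x₀ y₀ = M) : numCls Z S a = 2 ↔ ∀ z ∈ S, d z x₀ < M ∨ d z y₀ < M := by
  have hne : col d S M x₀ ≠ col d S M y₀ := by
    rw [Ne, ← c.col_eq_iff hx]; omega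
  rw [c.numCls_eq_col]
  have hsub : {col d S M x₀, col d S M y₀} ⊆ col d S M '' S := by
    rintro _ (rfl | rfl)
    · exact ⟨x₀, hx, rfl⟩
    · exact ⟨y₀, hy, rfl⟩
  have h2 : ({col d S M x₀, col d S M y₀} : Set (Set Z.carrier)).ncard = 2 := Set.ncard_pair hne
  constructor
  · intro h3 z hz
    have := Set.eq_of_subset_of_ncard_le hsub (by omega) (Set.toFinite _)
    have hz' : col d S M z ∈ col d S M '' S := ⟨z, hz, rfl⟩
    rw [← this] at hz'
    rcases hz' with hz' | hz'
    · exact Or.inl ((c.col_eq_iff hz).mpr hz')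
    · exact Or.inr ((c.col_eq_iff hz).mpr hz')
  · intro h3
    rw [← h2]
    congr 1
    refine Set.Subset.antisymm ?_ hsub
    rintro _ ⟨z, hz, rfl⟩
    rcases h3 z hz with h | h
    · exact Or.inl ((c.col_eq_iff hz).mp h)
    · exact Or.inr ((c.col_eq_iff hz).mp h)

theorem two_le_numCls (c : Spread Z S a d N M) : 2 ≤ numCls Z S a := by
  obtain ⟨x, hx, y, hy, hxy⟩ := c.att
  rw [c.numCls_eq_col, ← Set.ncard_pair (a := col d S M x) (b := col d S M y)]
  · refine Set.ncard_le_ncard ?_ (Set.toFinite _)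
    rintro _ (rfl | rfl)
    · exact ⟨x, hx, rfl⟩
    · exact ⟨y, hy, rfl⟩
  · rw [Ne, ← c.col_eq_iff hx]; omega

section Point

theorem DD_near (c : Spread Z W a d N M) (hb : b ∉ W) (hab : a ≠ b) {x y : Z.carrier} (hx : x ∈ W)
    (hy : y ∈ W) : DD Z x b a y ↔ x ≠ y ∧ d x b < d x y := by
  have hxb : x ≠ b := fun h => hb (h ▸ hx)
  have hyb : y ≠ b := fun h => hb (h ▸ hy)
  by_cases hxy : x = y
  · subst hxy
    simp only [ne_eq, not_true, false_and, iff_false]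
    intro h
    exact (DD_distinct c.rooted.rep.mem_treeClass h).2.2.1 rfl
  · rw [c.rooted.DD_root (c.ne hx) hab.symm (c.ne hy) hxb hxy hyb.symm]
    simp [hxy]

theorem DD_far (c : Spread Z W a d N M) (hb : b ∉ W) (hab : a ≠ b) {x y : Z.carrier} (hx : x ∈ W)
    (hy : y ∈ W) : DD Z x y a b ↔ x ≠ y ∧ d x y < d x b := by
  have hxb : x ≠ b := fun h => hb (h ▸ hx)
  have hyb : y ≠ b := fun h => hb (h ▸ hy)
  by_cases hxy : x = y
  · subst hxy
    simp only [ne_eq, not_true, false_and, iff_false]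
    intro h
    exact (DD_distinct c.rooted.rep.mem_treeClass h).1 rfl
  · rw [c.rooted.DD_root (c.ne hx) (c.ne hy) hab.symm hxy hxb hyb]
    simp [hxy]

theorem DD_split (c : Spread Z W a d N M) (hb : b ∉ W) {x y z : Z.carrier} (hx : x ∈ W)
    (hy : y ∈ W) (hz : z ∈ W) :
    DD Z x y b z ↔ (x ≠ y ∧ x ≠ z ∧ y ≠ z) ∧ ((d x y < d x b ∧ d x y < d x z) ∨
      (d z b < d x b ∧ d z b < d y b)) := by
  have hxb : x ≠ b := fun h => hb (h ▸ hx)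
  have hyb : y ≠ b := fun h => hb (h ▸ hy)
  have hzb : b ≠ z := fun h => hb (h ▸ hz)
  have hu := c.rooted.rep.ultra
  rw [c.rooted.rep.DD_iff, Split, hu.symm b z, hu.symm b x, hu.symm b y]
  unfold Distinct4
  tauto

theorem DD_root' (c : Spread Z W a d N M) {x y z : Z.carrier} (hx : x ∈ W)
    (hy : y ∈ W) (hz : z ∈ W) :
    DD Z x y a z ↔ (x ≠ y ∧ x ≠ z ∧ y ≠ z) ∧ d x y < d x z := by
  constructor
  · intro h
    obtain ⟨h1, h2, h3, h4, h5, h6⟩ := DD_distinct c.rooted.rep.mem_treeClass h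
    exact ⟨⟨h1, h3, h5⟩, (c.rooted.DD_root h2 h4 h6.symm h1 h3 h5).mp h⟩
  · rintro ⟨⟨h1, h3, h5⟩, h⟩
    exact (c.rooted.DD_root (c.ne hx) (c.ne hy) (c.ne hz) h1 h3 h5).mpr h

theorem trichotomy (c : Spread Z W a d N M) : (∀ x ∈ W, M < d x b) ∨ (∀ x ∈ W, d x b = M) ∨
    ∃ x ∈ W, d x b < M := by
  by_cases h : ∃ x ∈ W, d x b < M
  · exact Or.inr (Or.inr h)
  push Not at h
  by_cases h' : ∀ x ∈ W, M < d x b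
  · exact Or.inl h'
  push Not at h'
  obtain ⟨x, hx, hxb⟩ := h'
  right; left
  intro y hy
  have h1 := h y hy
  have h2 := c.le x hx y hy
  have := c.rooted.rep.ultra.two_largest x y b
  omega

theorem cherry_iff (c : Spread Z W a d N M) (hb : b ∉ W) (hab : a ≠ b) :
    Cherry Z W a b ↔ ∀ x ∈ W, M < d x b := by
  constructor
  · intro h x hx
    obtain ⟨y, hy, hxy⟩ := c.partner hx
    have := (c.DD_far hb hab hx hy).mp (h x hx y hy (c.ne_of_eq hxy))
    omega
  · intro h x hx y hy hxy
    exact (c.DD_far hb hab hx hy).mpr ⟨hxy, lt_of_le_of_lt (c.le x hx y hy) (h x hx)⟩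

theorem mem_near_iff (c : Spread Z W a d N M) (hb : b ∉ W) (hab : a ≠ b) {x : Z.carrier} :
    x ∈ Near Z W a b ↔ x ∈ W ∧ d x b < M := by
  constructor
  · rintro ⟨hx, y, hy, h⟩
    exact ⟨hx, lt_of_lt_of_le ((c.DD_near hb hab hx hy).mp h).2 (c.le x hx y hy)⟩
  · rintro ⟨hx, h⟩
    obtain ⟨y, hy, hxy⟩ := c.partner hx
    exact ⟨hx, y, hy, (c.DD_near hb hab hx hy).mpr ⟨c.ne_of_eq hxy, by omega⟩⟩

theorem sameType_of_le (c : Spread Z W a d N M) (hb : b ∉ W) (h : ∀ x ∈ W, ∀ y ∈ W, d x b = d y b)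
    (h' : ∀ x ∈ W, M ≤ d x b) : SameType Z W a b := by
  intro x hx y hy z hz
  rw [c.DD_root' hx hy hz, c.DD_split hb hx hy hz]
  refine and_congr_right fun _ => ?_
  have := h x hx z hz
  have := h' x hx
  have := c.le x hx z hz
  omega

theorem insert_spread (c : Spread Z W a d N M) (hab : a ≠ b) (h : ∀ x ∈ W, d x b ≤ M) :
    Spread Z (insert b W) a d N M where
  rooted := c.rooted
  root_notMem := by
    rintro (h | h)
    · exact hab h
    · exact c.root_notMem h
  le := by
    have hu := c.rooted.rep.ultra
    rintro x (rfl | hx) y (rfl | hy)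
    · rw [hu.self]; exact Nat.zero_le _
    · rw [hu.symm]; exact h y hy
    · exact h x hx
    · exact c.le x hx y hy
  att := by
    obtain ⟨x, hx, y, hy, h⟩ := c.att
    exact ⟨x, Or.inr hx, y, Or.inr hy, h⟩
  pos := c.pos

theorem col_insert (c : Spread Z W a d N M) {x y : Z.carrier}
    (hx : x ∈ insert b W) (hy : y ∈ insert b W) :
    d x y < M ↔ col d W M x = col d W M y := by
  have hu := c.rooted.rep.ultra
  rcases hx with rfl | hx
  · rcases hy with rfl | hy
    · simp [hu.self, c.pos]
    · rw [hu.symm, c.col_eq_iff hy]; exact eq_comm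
  · exact c.col_eq_iff hx

theorem le_of_near (c : Spread Z W a d N M) {x₀ : Z.carrier} (hx₀ : x₀ ∈ W) (h : d x₀ b < M) :
    ∀ x ∈ W, d x b ≤ M := by
  intro x hx
  have h1 := c.le x hx x₀ hx₀
  have := c.rooted.rep.ultra.two_largest x x₀ b
  omega

theorem numCls_insert_of_near (c : Spread Z W a d N M) (hab : a ≠ b) {x₀ : Z.carrier}
    (hx₀ : x₀ ∈ W) (h : d x₀ b < M) : numCls Z (insert b W) a = numCls Z W a := by
  have c' := c.insert_spread hab (c.le_of_near hx₀ h)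
  rw [c'.numCls_eq (col d W M) (fun x hx y hy => c.col_insert hx hy), c.numCls_eq_col]
  congr 1
  rw [Set.image_insert_eq, Set.insert_eq_of_mem]
  exact ⟨x₀, hx₀, (c.col_eq_iff hx₀).mp h⟩

theorem numCls_insert_of_node (c : Spread Z W a d N M) (hab : a ≠ b)
    (h : ∀ x ∈ W, d x b = M) : numCls Z (insert b W) a = numCls Z W a + 1 := by
  have c' := c.insert_spread hab (fun x hx => (h x hx).le)
  rw [c'.numCls_eq (col d W M) (fun x hx y hy => c.col_insert hx hy), c.numCls_eq_col,
    Set.image_insert_eq, Set.ncard_insert_of_notMem _ (Set.toFinite _)]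
  rintro ⟨x, hx, hxb⟩
  have := (c.col_eq_iff hx).mpr hxb
  have := h x hx
  omega

theorem code_insert_of_cherry (c : Spread Z W a d N M) (hb : b ∉ W) (hab : a ≠ b)
    (h : ∀ x ∈ W, M < d x b) : code Z (insert b W) a = (2, 1) := by
  have hu := c.rooted.rep.ultra
  obtain ⟨p, hp, q, hq, hpq⟩ := c.att
  have hconst : ∀ x ∈ W, d x b = d p b := by
    intro x hx
    have := hu.two_largest x p b
    have := c.le x hx p hp
    have := h x hx
    have := h p hp
    omega
  have c' : Spread Z (insert b W) a d N (d p b) := by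
    refine ⟨c.rooted, ?_, ?_, ⟨p, Or.inr hp, b, Or.inl rfl, rfl⟩, by have := h p hp; omega⟩
    · rintro (h | h)
      · exact hab h
      · exact c.root_notMem h
    · rintro x (rfl | hx) y (rfl | hy)
      · rw [hu.self]; exact Nat.zero_le _
      · rw [hu.symm]; exact (hconst y hy).le
      · exact (hconst x hx).le
      · have := c.le x hx y hy
        have := h p hp
        omega
  have h2 : numCls Z (insert b W) a = 2 := by
    rw [c'.numCls_eq_two_iff (Or.inr hp) (Or.inl rfl) rfl]
    rintro z (rfl | hz)
    · right; rw [hu.self]; exact c'.pos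
    · left
      have := c.le z hz p hp
      have := h p hp
      omega
  have h3 : numSing Z (insert b W) a = 1 := by
    rw [c'.numSing_eq, Set.ncard_eq_one]
    refine ⟨b, ?_⟩
    ext x
    constructor
    · rintro ⟨rfl | hx, hx'⟩
      · rfl
      · exfalso
        obtain ⟨y, hy, hxy⟩ := c.partner hx
        have := h p hp
        exact c.ne_of_eq hxy (hx' y (Or.inr hy) (by omega)).symm
    · rintro rfl
      refine ⟨Or.inl rfl, ?_⟩
      rintro y (rfl | hy) hlt
      · rfl
      · have := hconst y hy
        have := hu.symm x y
        omega
  simp [code, h2, h3]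

end Point

end Spread

end Code


section Types

variable {Z : Struc treeSig} {W : Set Z.carrier} {a b : Z.carrier}
  {d : Z.carrier → Z.carrier → ℕ} {N M : ℕ}

theorem SameType.symm (h : SameType Z W a b) : SameType Z W b a :=
  fun x hx y hy z hz => (h x hx y hy z hz).symm

theorem cherry_comm (hZ : Z ∈ TreeClass) : Cherry Z W a b ↔ Cherry Z W b a := by
  refine forall_congr' fun x => forall_congr' fun _ => forall_congr' fun y => forall_congr' fun _ =>
    forall_congr' fun _ => DD_comm_right hZ

theorem near_nonempty_comm (hZ : Z ∈ TreeClass) :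
    (Near Z W a b).Nonempty ↔ (Near Z W b a).Nonempty := by
  constructor <;>
  · rintro ⟨x, hx, y, hy, h⟩
    exact ⟨y, hy, x, hx, DD_swap_left hZ (DD_swap_right hZ (DD_swap hZ h))⟩

theorem near_subset : Near Z W a b ⊆ W := fun _ h => h.1

theorem SameType.eqv_iff (h : SameType Z W a b) {x y : Z.carrier} (hx : x ∈ W) (hy : y ∈ W) :
    Eqv Z W a x y ↔ Eqv Z W b x y :=
  or_congr Iff.rfl (exists_congr fun z => and_congr_right fun hz => h x hx y hy z hz)

theorem SameType.cls_eq (h : SameType Z W a b) {x : Z.carrier} (hx : x ∈ W) :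
    cls Z W a x = cls Z W b x := by
  ext y
  exact and_congr_right fun hy => h.eqv_iff hx hy

theorem SameType.numCls_eq (h : SameType Z W a b) : numCls Z W a = numCls Z W b := by
  unfold numCls
  congr 1
  exact Set.image_congr fun x hx => h.cls_eq hx

theorem SameType.numSing_eq (h : SameType Z W a b) : numSing Z W a = numSing Z W b := by
  unfold numSing
  congr 1
  ext x
  refine and_congr_right fun hx => forall_congr' fun y => forall_congr' fun hy => ?_
  rw [h.eqv_iff hx hy]

theorem SameType.code_eq (h : SameType Z W a b) : code Z W a = code Z W b := by
  unfold code
  rw [h.numCls_eq, h.numSing_eq]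

namespace Spread

theorem sameType_of_cherry (c : Spread Z W a d N M) (hb : b ∉ W) (hab : a ≠ b)
    (h : Cherry Z W a b) : SameType Z W a b := by
  rw [c.cherry_iff hb hab] at h
  refine c.sameType_of_le hb (fun x hx y hy => ?_) (fun x hx => (h x hx).le)
  have := h x hx
  have := h y hy
  have := c.le x hx y hy
  have := c.rooted.rep.ultra.two_largest x y b
  omega

theorem eq_of_node (c : Spread Z W a d N M) (hb : b ∉ W) (hab : a ≠ b)
    (h : ¬ Cherry Z W a b) (h' : Near Z W a b = ∅) : ∀ x ∈ W, d x b = M := by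
  rcases c.trichotomy (b := b) with h1 | h1 | ⟨x, hx, h1⟩
  · exact absurd ((c.cherry_iff hb hab).mpr h1) h
  · exact h1
  · have : x ∈ Near Z W a b := (c.mem_near_iff hb hab).mpr ⟨hx, h1⟩
    simp [h'] at this

theorem sameType_of_node (c : Spread Z W a d N M) (hb : b ∉ W) (hab : a ≠ b)
    (h : ¬ Cherry Z W a b) (h' : Near Z W a b = ∅) : SameType Z W a b := by
  have h1 := c.eq_of_node hb hab h h'
  exact c.sameType_of_le hb (fun x hx y hy => by rw [h1 x hx, h1 y hy]) (fun x hx => (h1 x hx).ge)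

end Spread

theorem sameType_of_cherry (hZ : Z ∈ TreeClass) (hW : W.Nontrivial) (ha : a ∉ W) (hb : b ∉ W)
    (hab : a ≠ b) (h : Cherry Z W a b) : SameType Z W a b := by
  obtain ⟨d, N, M, c⟩ := exists_spread hZ hW ha
  exact c.sameType_of_cherry hb hab h

theorem code_insert_of_cherry (hZ : Z ∈ TreeClass) (hW : W.Nontrivial) (ha : a ∉ W) (hb : b ∉ W)
    (hab : a ≠ b) (h : Cherry Z W a b) : code Z (insert b W) a = (2, 1) := by
  obtain ⟨d, N, M, c⟩ := exists_spread hZ hW ha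
  exact c.code_insert_of_cherry hb hab ((c.cherry_iff hb hab).mp h)

theorem sameType_of_node (hZ : Z ∈ TreeClass) (hW : W.Nontrivial) (ha : a ∉ W) (hb : b ∉ W)
    (hab : a ≠ b) (h : ¬ Cherry Z W a b) (h' : Near Z W a b = ∅) : SameType Z W a b := by
  obtain ⟨d, N, M, c⟩ := exists_spread hZ hW ha
  exact c.sameType_of_node hb hab h h'

theorem two_le_numCls (hZ : Z ∈ TreeClass) (hW : W.Nontrivial) (ha : a ∉ W) :
    2 ≤ numCls Z W a := by
  obtain ⟨d, N, M, c⟩ := exists_spread hZ hW ha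
  exact c.two_le_numCls

theorem code_insert_of_node (hZ : Z ∈ TreeClass) (hW : W.Nontrivial) (ha : a ∉ W) (hb : b ∉ W)
    (hab : a ≠ b) (h : ¬ Cherry Z W a b) (h' : Near Z W a b = ∅) :
    code Z (insert b W) a = (numCls Z W a + 1, 0) := by
  obtain ⟨d, N, M, c⟩ := exists_spread hZ hW ha
  have h1 := c.numCls_insert_of_node hab (c.eq_of_node hb hab h h')
  have := c.two_le_numCls
  unfold code
  rw [h1, if_neg (by omega)]

theorem code_insert_of_not_sameType (hZ : Z ∈ TreeClass) (hW : W.Nontrivial) (ha : a ∉ W)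
    (hb : b ∉ W) (hab : a ≠ b) (h : ¬ SameType Z W a b) :
    code Z (insert b W) a = code Z W a := by
  obtain ⟨d, N, M, c⟩ := exists_spread hZ hW ha
  have hu := c.rooted.rep.ultra
  have hc : ¬ Cherry Z W a b := fun h' => h (c.sameType_of_cherry hb hab h')
  obtain ⟨x₁, hx₁⟩ : (Near Z W a b).Nonempty := by
    rw [Set.nonempty_iff_ne_empty]
    exact fun h' => h (c.sameType_of_node hb hab hc h')
  rw [c.mem_near_iff hb hab] at hx₁
  obtain ⟨hx₁, hlt⟩ := hx₁
  have hcls := c.numCls_insert_of_near hab hx₁ hlt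
  have c' := c.insert_spread hab (c.le_of_near hx₁ hlt)
  unfold code
  rw [hcls]
  split_ifs with h2
  swap
  · rfl
  congr 1
  rw [c'.numSing_eq, c.numSing_eq]
  congr 1
  ext x
  constructor
  · rintro ⟨rfl | hx, hx'⟩
    · exfalso
      have := hx' x₁ (Or.inr hx₁) (by rwa [hu.symm])
      exact hb (this ▸ hx₁)
    · exact ⟨hx, fun y hy => hx' y (Or.inr hy)⟩
  · rintro ⟨hx, hx'⟩
    refine ⟨Or.inr hx, ?_⟩
    rintro y (rfl | hy) hxy
    swap
    · exact hx' y hy hxy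
    exfalso
    apply h
    obtain ⟨y₀, hy₀, hy₀'⟩ := c.partner hx
    rw [c.numCls_eq_two_iff hx hy₀ hy₀'] at h2
    have hM : ∀ p ∈ W, p ≠ x → d p x = M := by
      intro p hp hpx
      have h3 := c.le p hp x hx
      by_contra hne
      have h4 : d x p < M := by rw [hu.symm]; omega
      exact hpx (hx' p hp h4)
    have hy₁ : ∀ p ∈ W, p ≠ x → d p y₀ < M := by
      intro p hp hpx
      have := hM p hp hpx
      rcases h2 p hp with h3 | h3
      · omega
      · exact h3
    have hM' : ∀ p ∈ W, p ≠ x → d p y = M := by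
      intro p hp hpx
      have h3 := hM p hp hpx
      have h4 := hu.two_largest p x y
      omega
    intro p hp q hq r hr
    rw [c.DD_root' hp hq hr, c.DD_split hb hp hq hr]
    refine and_congr_right ?_
    rintro ⟨hpq, hpr, hqr⟩
    have s1 := hu.symm p q
    by_cases hpx : p = x
    · subst hpx
      have := hM q hq hpq.symm
      have := hM' q hq hpq.symm
      have := hM' r hr hpr.symm
      have := hM r hr hpr.symm
      have := hu.symm p r
      omega
    · have := hM p hp hpx
      have := hM' p hp hpx
      by_cases hqx : q = x
      · subst hqx
        have := hM' r hr hqr.symm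
        have := c.le p hp r hr
        omega
      · have := hM' q hq hqx
        have := hy₁ p hp hpx
        have := hy₁ q hq hqx
        have := hu.two_largest p q y₀
        by_cases hrx : r = x
        · subst hrx
          omega
        · have := hM' r hr hrx
          omega

/-- The consequences of `b` subdividing an edge of the tree at `a`. -/
theorem edge_of_near (hZ : Z ∈ TreeClass) (hW : W.Nontrivial) (ha : a ∉ W) (hb : b ∉ W)
    (hab : a ≠ b) (h : SameType Z W a b) (hN : (Near Z W a b).Nonempty) :
    numCls Z W a = 2 ∧ code Z (insert b W) a = (2, sg (W \ Near Z W a b)) ∧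
      numSing Z W a = sg (Near Z W a b) + sg (W \ Near Z W a b) ∧
      Near Z W b a = W \ Near Z W a b ∧ ∀ x ∈ Near Z W a b, Near Z W a b = cls Z W a x := by
  obtain ⟨d, N, M, c⟩ := exists_spread hZ hW ha
  have hu := c.rooted.rep.ultra
  obtain ⟨x₀, hx₀⟩ := hN
  rw [c.mem_near_iff hb hab] at hx₀
  obtain ⟨hx₀, hlt⟩ := hx₀
  obtain ⟨y₀, hy₀, hy₀'⟩ := c.partner hx₀
  have hfar : ∀ z ∈ W, M ≤ d z b → d z y₀ < M := by
    intro z hz hzb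
    have h3 := c.le z hz y₀ hy₀
    have h4 := c.le z hz x₀ hx₀
    by_contra hne
    have h5 := hu.two_largest z x₀ b
    have h6 := hu.two_largest x₀ y₀ b
    have h7 := (h z hz y₀ hy₀ x₀ hx₀)
    rw [c.DD_root' hz hy₀ hx₀, c.DD_split hb hz hy₀ hx₀] at h7
    have n1 : z ≠ y₀ := by rintro rfl; rw [hu.self] at hne; have := c.pos; omega
    have n2 : z ≠ x₀ := by rintro rfl; omega
    have n3 : y₀ ≠ x₀ := (c.ne_of_eq hy₀').symm
    have h8 := (h7.mpr ⟨⟨n1, n2, n3⟩, by omega⟩).2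
    omega
  have hnear : ∀ z ∈ W, d z b < M → d z x₀ < M := by
    intro z hz hzb
    have h5 := hu.two_largest z x₀ b
    omega
  have h2 : numCls Z W a = 2 := by
    rw [c.numCls_eq_two_iff hx₀ hy₀ hy₀']
    intro z hz
    by_cases hzb : d z b < M
    · exact Or.inl (hnear z hz hzb)
    · exact Or.inr (hfar z hz (by omega))
  have hle := c.le_of_near hx₀ hlt
  have hcls := c.numCls_insert_of_near hab hx₀ hlt
  have c' := c.insert_spread hab hle
  have hsep : ∀ x ∈ W, ∀ y ∈ W, (d x y < M ↔ (d x b < M ↔ d y b < M)) := by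
    intro x hx y hy
    have h3 := hu.two_largest x y b
    by_cases h4 : d x b < M
    · simp only [h4, true_iff]; omega
    · by_cases h5 : d y b < M
      · simp [h4, h5]; omega
      · have h6 := hfar x hx (by omega)
        have h7 := hfar y hy (by omega)
        have h8 := hu.two_largest x y y₀
        simp [h4, h5]; omega
  have e2 : {x | x ∈ W \ Near Z W a b ∧ ∀ y ∈ W \ Near Z W a b, y = x} =
      {x | x ∈ insert b W ∧ ∀ y ∈ insert b W, d x y < M → y = x} := by
    ext x
    constructor
    · rintro ⟨⟨hx, hx'⟩, hx''⟩
      rw [c.mem_near_iff hb hab] at hx'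
      refine ⟨Or.inr hx, ?_⟩
      rintro y (rfl | hy) hxy
      · exact absurd ⟨hx, hxy⟩ hx'
      · refine hx'' y ⟨hy, fun h => ?_⟩
        rw [c.mem_near_iff hb hab] at h
        exact hx' ⟨hx, ((hsep x hx y hy).mp hxy).mpr h.2⟩
    · rintro ⟨rfl | hx, hx'⟩
      · exfalso
        have := hx' x₀ (Or.inr hx₀) (by rwa [hu.symm])
        exact hb (this ▸ hx₀)
      · have hxb : ¬ d x b < M := fun h' => hb (by rw [hx' b (Or.inl rfl) h']; exact hx)
        refine ⟨⟨hx, fun h => ?_⟩, ?_⟩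
        · exact hxb ((c.mem_near_iff hb hab).mp h).2
        · rintro y ⟨hy, hy'⟩
          refine hx' y (Or.inr hy) ((hsep x hx y hy).mpr ?_)
          rw [c.mem_near_iff hb hab] at hy'
          exact ⟨fun h => absurd h hxb, fun h => absurd ⟨hy, h⟩ hy'⟩
  refine ⟨h2, ?_, ?_, ?_, ?_⟩
  · unfold code
    rw [hcls, if_pos h2, h2, c'.numSing_eq, ← e2, ncard_single_eq_sg]
  · rw [c.numSing_eq, ← ncard_single_eq_sg, ← ncard_single_eq_sg, ← Set.ncard_union_eq]
    · congr 1
      ext x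
      constructor
      · rintro ⟨hx, hx'⟩
        by_cases hxb : d x b < M
        · left
          refine ⟨(c.mem_near_iff hb hab).mpr ⟨hx, hxb⟩, fun y hy => ?_⟩
          rw [c.mem_near_iff hb hab] at hy
          exact hx' y hy.1 ((hsep x hx y hy.1).mpr (iff_of_true hxb hy.2))
        · right
          refine ⟨⟨hx, fun h => hxb ((c.mem_near_iff hb hab).mp h).2⟩, fun y hy => ?_⟩
          have hyb : ¬ d y b < M := fun h => hy.2 ((c.mem_near_iff hb hab).mpr ⟨hy.1, h⟩)
          exact hx' y hy.1 ((hsep x hx y hy.1).mpr (iff_of_false hxb hyb))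
      · rintro (⟨hx, hx'⟩ | ⟨hx, hx'⟩)
        · rw [c.mem_near_iff hb hab] at hx
          refine ⟨hx.1, fun y hy hxy => hx' y ((c.mem_near_iff hb hab).mpr ⟨hy, ?_⟩)⟩
          exact ((hsep x hx.1 y hy).mp hxy).mp hx.2
        · have hxb : ¬ d x b < M := fun h => hx.2 ((c.mem_near_iff hb hab).mpr ⟨hx.1, h⟩)
          refine ⟨hx.1, fun y hy hxy => hx' y ⟨hy, fun h => hxb ?_⟩⟩
          exact ((hsep x hx.1 y hy).mp hxy).mpr ((c.mem_near_iff hb hab).mp h).2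
    · rw [Set.disjoint_left]
      rintro x ⟨hx, -⟩ ⟨hx', -⟩
      exact hx'.2 hx
  · ext x
    rw [Set.mem_sdiff, c.mem_near_iff hb hab]
    constructor
    · rintro ⟨hx, y, hy, hD⟩
      refine ⟨hx, fun hxb => ?_⟩
      have hD' : DD Z y b a x := DD_swap_left hZ (DD_swap_right hZ (DD_swap hZ hD))
      rw [c.DD_near hb hab hy hx] at hD'
      have h3 := hu.two_largest x y b
      have h4 := hu.symm x y
      have h5 := hxb.2
      have h6 : d y b < M := by omega
      have h7 := hu.two_largest x₀ y₀ b
      have h8 := hu.two_largest x y₀ b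
      have h9 := hu.two_largest y y₀ b
      have h10 := h x hx y₀ hy₀ y hy
      have n1 : x ≠ y₀ := by rintro rfl; omega
      have n2 : y₀ ≠ y := by rintro rfl; omega
      rw [c.DD_root' hx hy₀ hy, c.DD_split hb hx hy₀ hy] at h10
      have h11 := (h10.mpr ⟨⟨n1, hD'.1.symm, n2⟩, by omega⟩).2
      omega
    · rintro ⟨hx, hx'⟩
      refine ⟨hx, x₀, hx₀, ?_⟩
      have hxb : ¬ d x b < M := fun h => hx' ⟨hx, h⟩
      have : DD Z x₀ b a x := by
        have n1 : x₀ ≠ x := by rintro rfl; exact hxb hlt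
        refine (c.DD_near hb hab hx₀ hx).mpr ⟨n1, ?_⟩
        have := hu.two_largest x₀ x b
        omega
      exact DD_swap_left hZ (DD_swap_right hZ (DD_swap hZ this))
  · intro x hx
    have hx' := (c.mem_near_iff hb hab).mp hx
    ext y
    rw [c.mem_near_iff hb hab]
    refine and_congr_right fun hy => ?_
    rw [c.eqv_iff hx'.1 hy, hsep x hx'.1 y hy]
    simp [hx'.2]

end Types


section Weight

variable {Z : Struc treeSig} {W S : Set Z.carrier} {a b : Z.carrier}

theorem code_of_star (h : ∀ x ∈ S, ∀ y ∈ S, Eqv Z S a x y → x = y) :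
    code Z S a = (S.ncard, if S.ncard = 2 then 2 else 0) := by
  have h1 : numCls Z S a = S.ncard := by
    unfold numCls
    refine Set.InjOn.ncard_image fun x hx y hy hxy => ?_
    have : y ∈ cls Z S a x := by
      have h' : y ∈ cls Z S a y := ⟨hy, Or.inl rfl⟩
      exact hxy ▸ h'
    exact h x hx y hy this.2
  have h2 : numSing Z S a = S.ncard := by
    unfold numSing
    congr 1
    ext x
    exact ⟨fun hx => hx.1, fun hx => ⟨hx, fun y hy hxy => (h x hx y hy hxy).symm⟩⟩
  unfold code
  rw [h1, h2]
  split_ifs with h3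
  · rw [h3]
  · rfl

theorem code_of_ncard_le_two (hZ : Z ∈ TreeClass) (hS : S.ncard ≤ 2) :
    code Z S a = (S.ncard, if S.ncard = 2 then 2 else 0) := by
  refine code_of_star ?_
  rintro x hx y hy (h | ⟨z, hz, h⟩)
  · exact h
  · exfalso
    obtain ⟨h1, h2, h3, h4, h5, h6⟩ := DD_distinct hZ h
    have : ({x, y, z} : Set Z.carrier).ncard ≤ S.ncard := by
      refine Set.ncard_le_ncard ?_ (Set.toFinite _)
      rintro _ (rfl | rfl | rfl) <;> assumption
    rw [Set.ncard_eq_three.mpr ⟨x, y, z, h1, h3, h5, rfl⟩] at this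
    omega

/-- The relations satisfied by the classes of marked structures, indexed by their codes. -/
structure GCond {A : Type*} [CommRing A] (G : ℕ × ℕ → A) : Prop where
  zero : G (0, 0) = 1 + G (1, 0)
  one : G (1, 0) = 1 + G (2, 2)
  two : ∀ s t, s ≤ 1 → t ≤ 1 → G (2, s + t) = 1 + G (3, 0) + G (2, 1) + (G (2, s) + G (2, t))
  large : ∀ k, 3 ≤ k → G (k, 0) = 1 + G (k + 1, 0) + G (2, 1)
  cross : G (2, 1) * G (2, 0) = G (2, 1) * G (2, 1)

theorem sg_le_one {V : Type} (B : Set V) : sg B ≤ 1 := by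
  unfold sg; split_ifs <;> omega

theorem nontrivial_of_two_le {V : Type} [Finite V] {S : Set V} (h : ¬ S.Nontrivial) :
    S.ncard ≤ 1 := by
  rw [Set.not_nontrivial_iff] at h
  exact Set.ncard_le_one_iff_subsingleton.mpr h

theorem GCond.edge_comm {A : Type*} [CommRing A] {G : ℕ × ℕ → A} (hG : GCond G) {s t : ℕ}
    (hs : s ≤ 1) (ht : t ≤ 1) : G (2, s + t) * G (2, s) = G (2, s + t) * G (2, t) := by
  have := hG.cross
  interval_cases s <;> interval_cases t <;> simp_all

theorem weight_comm {A : Type*} [CommRing A] {G : ℕ × ℕ → A} (hG : GCond G) (hZ : Z ∈ TreeClass)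
    (ha : a ∉ W) (hb : b ∉ W) (hab : a ≠ b) :
    G (code Z W a) * G (code Z (insert a W) b) = G (code Z W b) * G (code Z (insert b W) a) := by
  by_cases hW : W.Nontrivial
  swap
  · have h1 := nontrivial_of_two_le hW
    have h2 : (insert a W).ncard = W.ncard + 1 := Set.ncard_insert_of_notMem ha
    have h3 : (insert b W).ncard = W.ncard + 1 := Set.ncard_insert_of_notMem hb
    rw [code_of_ncard_le_two (a := a) hZ (by omega : W.ncard ≤ 2),
      code_of_ncard_le_two (a := b) hZ (by omega : W.ncard ≤ 2),
      code_of_ncard_le_two (a := b) hZ (by omega : (insert a W).ncard ≤ 2),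
      code_of_ncard_le_two (a := a) hZ (by omega : (insert b W).ncard ≤ 2), h2, h3]
  by_cases hs : SameType Z W a b
  swap
  · rw [code_insert_of_not_sameType hZ hW ha hb hab hs,
      code_insert_of_not_sameType hZ hW hb ha hab.symm (fun h => hs h.symm), mul_comm]
  by_cases hc : Cherry Z W a b
  · rw [code_insert_of_cherry hZ hW ha hb hab hc,
      code_insert_of_cherry hZ hW hb ha hab.symm ((cherry_comm hZ).mp hc), hs.code_eq]
  by_cases hN : (Near Z W a b).Nonempty
  · obtain ⟨h1, h2, h3, h4, -⟩ := edge_of_near hZ hW ha hb hab hs hN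
    obtain ⟨h1', h2', h3', h4', -⟩ := edge_of_near hZ hW hb ha hab.symm hs.symm
      ((near_nonempty_comm hZ).mp hN)
    rw [h2, h2', ← hs.code_eq, ← h4', code, if_pos h1, h1, h3]
    exact hG.edge_comm (sg_le_one _) (sg_le_one _)
  · have hN' : ¬ (Near Z W b a).Nonempty := fun h => hN ((near_nonempty_comm hZ).mpr h)
    rw [Set.not_nonempty_iff_eq_empty] at hN hN'
    rw [code_insert_of_node hZ hW ha hb hab hc hN,
      code_insert_of_node hZ hW hb ha hab.symm (fun h => hc ((cherry_comm hZ).mpr h)) hN',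
      hs.code_eq, hs.numCls_eq]

end Weight

section Unique

variable {V : Type} [Finite V]

/-- The structure on `V` with the given quaternary relation. -/
abbrev mkS (R : (Fin 4 → V) → Prop) : Struc treeSig := ⟨V, fun _ => R⟩

/-- Agreement of the quartet relations of two structures on the points of `S`. -/
def AgreeOn (R R' : (Fin 4 → V) → Prop) (S : Set V) : Prop :=
  ∀ x ∈ S, ∀ y ∈ S, ∀ z ∈ S, ∀ w ∈ S, (DD (mkS R) x y z w ↔ DD (mkS R') x y z w)

variable {R R' : (Fin 4 → V) → Prop} {W : Set V} {a b : V}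

theorem eq_of_agreeOn_univ (hR : mkS R ∈ TreeClass) (hR' : mkS R' ∈ TreeClass)
    (h : ∀ x y z w, (DD (mkS R) x y z w ↔ DD (mkS R') x y z w)) : R = R' := by
  funext v
  exact propext ((rel_iff_DD hR v).trans ((or_congr (h _ _ _ _) (h _ _ _ _)).trans
    (rel_iff_DD hR' v).symm))

theorem AgreeOn.eqv_iff (h : AgreeOn R R' (insert a W)) {x y : V} (hx : x ∈ W) (hy : y ∈ W) :
    Eqv (mkS R) W a x y ↔ Eqv (mkS R') W a x y :=
  or_congr Iff.rfl (exists_congr fun _ => and_congr_right fun hz =>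
    h x (Or.inr hx) y (Or.inr hy) a (Or.inl rfl) _ (Or.inr hz))

/-- The quartets involving both `a` and `b`, in terms of the position of `b` seen from `a`. -/
theorem DD_of_cherry {Z : Struc treeSig} {W : Set Z.carrier} {a b : Z.carrier}
    (hZ : Z ∈ TreeClass) (h : Cherry Z W a b) {x y : Z.carrier} (hx : x ∈ W) (hy : y ∈ W)
    (hxy : x ≠ y) : DD Z x y a b ∧ ¬ DD Z x b a y := by
  have h1 := h x hx y hy hxy
  refine ⟨h1, fun h2 => ?_⟩
  exact DD_exclusive hZ (DD_swap_right hZ h1) (DD_swap_right hZ h2)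

theorem DD_of_node {Z : Struc treeSig} {W : Set Z.carrier} {a b : Z.carrier}
    (hZ : Z ∈ TreeClass) (hW : W.Nontrivial) (ha : a ∉ W) (hb : b ∉ W) (hab : a ≠ b)
    (h : ¬ Cherry Z W a b) (h' : Near Z W a b = ∅) {x y : Z.carrier} (hx : x ∈ W) (hy : y ∈ W)
    (hxy : x ≠ y) : (DD Z x y a b ↔ Eqv Z W a x y) ∧ ¬ DD Z x b a y := by
  obtain ⟨d, N, M, c⟩ := exists_spread hZ hW ha
  have h1 := c.eq_of_node hb hab h h' x hx
  constructor
  · rw [c.DD_far hb hab hx hy, c.eqv_iff hx hy, h1]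
    simp [hxy]
  · intro h2
    have : x ∈ Near Z W a b := ⟨hx, y, hy, h2⟩
    simp [h'] at this

theorem DD_of_near {Z : Struc treeSig} {W : Set Z.carrier} {a b : Z.carrier}
    (hZ : Z ∈ TreeClass) (hW : W.Nontrivial) (ha : a ∉ W) (hb : b ∉ W) (hab : a ≠ b)
    (hN : (Near Z W a b).Nonempty) {x y y₀ : Z.carrier} (hx : x ∈ W) (hy : y ∈ W)
    (hy₀ : y₀ ∈ W) (hy₀' : y₀ ∉ Near Z W a b) (hxy : x ≠ y) :
    (DD Z x y a b ↔ Eqv Z W a x y ∧ (x ∉ Near Z W a b ∨ DD Z x y b y₀)) ∧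
      (DD Z x b a y ↔ x ∈ Near Z W a b ∧ (y ∉ Near Z W a b ∨ DD Z x b y y₀)) := by
  obtain ⟨d, N, M, c⟩ := exists_spread hZ hW ha
  have hu := c.rooted.rep.ultra
  obtain ⟨x₁, hx₁⟩ := hN
  rw [c.mem_near_iff hb hab] at hx₁
  have hle := c.le_of_near hx₁.1 hx₁.2
  have hxb : x ≠ b := fun h => hb (h ▸ hx)
  have hyb : y ≠ b := fun h => hb (h ▸ hy)
  have hy₀b : y₀ ≠ b := fun h => hb (h ▸ hy₀)
  rw [c.DD_far hb hab hx hy, c.eqv_iff hx hy, c.DD_near hb hab hx hy, c.mem_near_iff hb hab,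
    c.mem_near_iff hb hab, c.DD_split hb hx hy hy₀, c.rooted.rep.DD_iff]
  rw [c.mem_near_iff hb hab] at hy₀'
  have h1 := hle x hx
  have h2 := hle y hy
  have h3 := hle y₀ hy₀
  have h4 : d y₀ b = M := by
    by_contra h
    exact hy₀' ⟨hy₀, by omega⟩
  have t1 := hu.two_largest x y b
  have t2 := hu.two_largest x y₀ b
  have t3 := hu.two_largest y y₀ b
  have t4 := hu.two_largest x y y₀
  have s1 := hu.symm b y
  have s2 := hu.symm b y₀
  have s3 := hu.symm b x
  have s4 := hu.symm y y₀
  have s5 := hu.symm y x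
  have s6 := hu.symm y₀ x
  have n1 : d x b < M → x ≠ y₀ := by rintro h rfl; omega
  have n2 : d y b < M → y ≠ y₀ := by rintro h rfl; omega
  unfold Split Distinct4
  simp only [hx, hy, true_and, hxy, ne_eq, not_false_iff, hxb, hyb.symm, hy₀b.symm]
  constructor
  · constructor
    · intro h
      refine ⟨by omega, ?_⟩
      by_cases h5 : d x b < M
      · right
        exact ⟨⟨n1 h5, n2 (by omega)⟩, by omega⟩
      · exact Or.inl h5
    · rintro ⟨h, h5 | ⟨-, h5⟩⟩ <;> omega
  · constructor
    · intro h
      refine ⟨by have := c.le x hx y hy; omega, ?_⟩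
      by_cases h5 : d y b < M
      · right
        exact ⟨⟨n1 (by omega), n2 h5⟩, by omega⟩
      · exact Or.inl h5
    · rintro ⟨h, h5 | ⟨-, h5⟩⟩ <;> omega

/-- A tree structure on `W ∪ {a, b}` is determined by its restrictions and the position of `b`
seen from `a`. -/
theorem eq_of_agree (hR : mkS R ∈ TreeClass) (hR' : mkS R' ∈ TreeClass)
    (ha : a ∉ W) (hb : b ∉ W) (hab : a ≠ b) (huniv : ∀ x, x ≠ a → x ≠ b → x ∈ W)
    (h1 : AgreeOn R R' (insert a W)) (h2 : AgreeOn R R' (insert b W))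
    (hC : Cherry (mkS R) W a b ↔ Cherry (mkS R') W a b)
    (hN : Near (mkS R) W a b = Near (mkS R') W a b) : R = R' := by
  refine eq_of_agreeOn_univ hR hR' fun x y z w => ?_
  have key : ∀ x ∈ W, ∀ y ∈ W, x ≠ y → (DD (mkS R) x y a b ↔ DD (mkS R') x y a b) ∧
      (DD (mkS R) x b a y ↔ DD (mkS R') x b a y) := by
    intro x hx y hy hxy
    have hW : W.Nontrivial := ⟨x, hx, y, hy, hxy⟩
    by_cases hc : Cherry (mkS R) W a b
    · have t1 := DD_of_cherry hR hc hx hy hxy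
      have t2 := DD_of_cherry hR' (hC.mp hc) hx hy hxy
      exact ⟨iff_of_true t1.1 t2.1, iff_of_false t1.2 t2.2⟩
    have hc' := fun h => hc (hC.mpr h)
    rcases (Near (mkS R) W a b).eq_empty_or_nonempty with h0 | h0
    · have t1 := DD_of_node hR hW ha hb hab hc h0 hx hy hxy
      have t2 := DD_of_node hR' hW ha hb hab hc' (hN ▸ h0) hx hy hxy
      exact ⟨t1.1.trans ((h1.eqv_iff hx hy).trans t2.1.symm), iff_of_false t1.2 t2.2⟩
    · obtain ⟨y₀, hy₀, hy₀'⟩ : ∃ y₀ ∈ W, y₀ ∉ Near (mkS R) W a b := by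
        obtain ⟨p, hp⟩ := h0
        obtain ⟨d, N, M, c⟩ := exists_spread hR hW ha
        rw [c.mem_near_iff hb hab] at hp
        obtain ⟨q, hq, hpq⟩ := c.partner hp.1
        refine ⟨q, hq, ?_⟩
        rw [c.mem_near_iff hb hab]
        rintro ⟨-, h⟩
        have := c.rooted.rep.ultra.two_largest p q b
        omega
      have t1 := DD_of_near hR hW ha hb hab h0 hx hy hy₀ hy₀' hxy
      have t2 := DD_of_near hR' hW ha hb hab (hN ▸ h0) hx hy hy₀ (hN ▸ hy₀') hxy
      have e1 := h2 x (Or.inr hx) y (Or.inr hy) b (Or.inl rfl) y₀ (Or.inr hy₀)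
      have e2 := h2 x (Or.inr hx) b (Or.inl rfl) y (Or.inr hy) y₀ (Or.inr hy₀)
      rw [t1.1, t1.2, t2.1, t2.2, hN, e1, e2, h1.eqv_iff hx hy]
      exact ⟨Iff.rfl, Iff.rfl⟩
  refine (DD_congr_of_root (X := mkS R') (Y := mkS R) hR' hR id Function.injective_id a ?_ x y z w)
  intro x y z hx hy hz hxy hxz hyz
  simp only [id]
  by_cases hxb : x = b
  · subst hxb
    rw [DD_comm_left hR, DD_comm_left hR']
    exact (key y (huniv y hy hxy.symm) z (huniv z hz hxz.symm) hyz).2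
  by_cases hyb : y = b
  · subst hyb
    exact (key x (huniv x hx hxy) z (huniv z hz hyz.symm) hxz).2
  by_cases hzb : z = b
  · subst hzb
    exact (key x (huniv x hx hxb) y (huniv y hy hyb) hxy).1
  · exact h1 x (Or.inr (huniv x hx hxb)) y (Or.inr (huniv y hy hyb)) a (Or.inl rfl) z
      (Or.inr (huniv z hz hzb))

end Unique


section Extend

variable {V : Type}

/-- Extension of a distance by one point. -/
def extD (d : V → V → ℕ) (δ : V → ℕ) : Option V → Option V → ℕ
  | none, none => 0
  | none, some y => δ y
  | some x, none => δ x
  | some x, some y => d x y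

theorem IsUltra.extD {d : V → V → ℕ} (h : IsUltra d) {δ : V → ℕ} (hpos : ∀ x, 0 < δ x)
    (h1 : ∀ x y, δ x ≤ max (δ y) (d x y)) (h2 : ∀ x y, d x y ≤ max (δ x) (δ y)) :
    IsUltra (extD d δ) where
  self x := by cases x <;> simp [Paper.extD, h.self]
  pos x y hxy := by
    cases x <;> cases y <;> simp_all [Paper.extD, h.pos]
  symm x y := by
    cases x <;> cases y <;> simp [Paper.extD, h.symm]
  tri x y z := by
    rcases x with _ | x <;> rcases y with _ | y <;> rcases z with _ | z <;> simp only [Paper.extD]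
    · omega
    · omega
    · omega
    · have := h1 z y; have := h.symm y z; omega
    · omega
    · have := h2 x z; omega
    · have := h1 x y; omega
    · have := h.tri x y z; omega

/-- Two distances induce the same comparisons on triples of distinct points. -/
def SameOrder (d e : V → V → ℕ) : Prop :=
  ∀ x y z, x ≠ y → x ≠ z → y ≠ z → (d x y < d x z ↔ e x y < e x z)

theorem exists_height {d : Option V → Option V → ℕ} {e : V → V → ℕ} [Finite V] (hd : IsUltra d)
    (he : IsUltra e) (h : SameOrder (fun x y => d (some x) (some y)) e) (x₀ : V) {μ : ℕ}
    (hμ : 0 < μ) : ∃ ν : ℕ, 0 < ν ∧ ∀ y, y ≠ x₀ → (2 * e x₀ y < ν ↔ d (some x₀) (some y) < μ) ∧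
      (ν < 2 * e x₀ y ↔ μ < d (some x₀) (some y)) := by
  by_cases hA : ∃ y, y ≠ x₀ ∧ d (some x₀) (some y) = μ
  · obtain ⟨z, hz, hzμ⟩ := hA
    refine ⟨2 * e x₀ z, by have := he.pos x₀ z hz.symm; omega, fun y hy => ?_⟩
    by_cases hyz : y = z
    · subst hyz; omega
    · have h1 := h x₀ y z hy.symm hz.symm hyz
      have h2 := h x₀ z y hz.symm hy.symm (Ne.symm hyz)
      simp only at h1 h2
      omega
  · push Not at hA
    obtain ⟨z, hz, hmax⟩ := Set.exists_max_image {y | d (some x₀) (some y) < μ} (e x₀)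
      (Set.toFinite _) ⟨x₀, by simpa [hd.self] using hμ⟩
    refine ⟨2 * e x₀ z + 1, by omega, fun y hy => ?_⟩
    have h0 := hA y hy
    have hz' : d (some x₀) (some z) < μ := hz
    have h1 : d (some x₀) (some y) < μ → e x₀ y ≤ e x₀ z := hmax y
    have h2 : μ < d (some x₀) (some y) → e x₀ z < e x₀ y := by
      intro h2
      by_cases hzx : z = x₀
      · subst hzx
        rw [he.self]
        exact he.pos _ _ hy.symm
      · have hyz : z ≠ y := by rintro rfl; omega
        refine (h x₀ z y (Ne.symm hzx) hy.symm hyz).mp ?_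
        simp only
        omega
    omega

theorem exists_extD_sameOrder [Finite V] {d : Option V → Option V → ℕ} {e : V → V → ℕ}
    (hd : IsUltra d) (he : IsUltra e) (h : SameOrder (fun x y => d (some x) (some y)) e) :
    ∃ δ : V → ℕ, IsUltra (extD (fun x y => 2 * e x y) δ) ∧
      SameOrder d (extD (fun x y => 2 * e x y) δ) := by
  have he2 : IsUltra (fun x y => 2 * e x y) :=
    ⟨fun x => by simp [he.self], fun x y hxy => by have := he.pos x y hxy; omega,
      fun x y => by rw [he.symm], fun x y z => by have := he.tri x y z; omega⟩
  rcases isEmpty_or_nonempty V with hV | hV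
  · refine ⟨fun _ => 1, he2.extD (fun x => hV.elim x) (fun x => hV.elim x) (fun x => hV.elim x), ?_⟩
    rintro (_ | x) (_ | y) z hxy
    · exact absurd rfl hxy
    · exact hV.elim y
    · exact hV.elim x
    · exact hV.elim x
  obtain ⟨x₀, hmin⟩ := Finite.exists_min (fun x : V => d none (some x))
  obtain ⟨ν, hν, key⟩ := exists_height hd he h x₀ (μ := d none (some x₀)) (hd.pos _ _ (by simp))
  have hδ : ∀ x, x ≠ x₀ → d none (some x) = max (d none (some x₀)) (d (some x₀) (some x)) := by
    intro x hx
    have h1 := hmin x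
    have h2 := hd.two_largest none (some x₀) (some x)
    omega
  have hself := he.self x₀
  have S : ∀ x, e x x₀ = e x₀ x := fun x => he.symm _ _
  refine ⟨fun x => max (2 * e x₀ x) ν, he2.extD (fun x => ?_) (fun x y => ?_) (fun x y => ?_), ?_⟩
  · omega
  · have := he.two_largest x₀ x y; omega
  · have := he.two_largest x₀ x y; omega
  have main : ∀ x y, x ≠ y → (2 * e x y < max (2 * e x₀ x) ν ↔
      d (some x) (some y) < d none (some x)) ∧
      (max (2 * e x₀ x) ν < 2 * e x y ↔ d none (some x) < d (some x) (some y)) ∧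
      (max (2 * e x₀ x) ν < max (2 * e x₀ y) ν ↔ d none (some x) < d none (some y)) := by
    intro x y hxy
    by_cases hx : x = x₀
    · subst hx
      have := key y hxy.symm
      have := hδ y hxy.symm
      omega
    · have k1 := key x hx
      have k2 := hδ x hx
      by_cases hy : y = x₀
      · subst hy
        have := S x
        have := hd.symm (some y) (some x)
        omega
      · have k3 := key y hy
        have k4 := hδ y hy
        have o1 := h x₀ x y (Ne.symm hx) (Ne.symm hy) hxy
        have o2 := h x₀ y x (Ne.symm hy) (Ne.symm hx) hxy.symm
        have o3 := h x x₀ y hx hxy (Ne.symm hy)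
        have o4 := h x y x₀ hxy hx hy
        have t1 := he.two_largest x₀ x y
        have t2 := hd.two_largest (some x₀) (some x) (some y)
        have s1 := S x
        have s2 := hd.symm (some x) (some x₀)
        simp only at o1 o2 o3 o4
        omega
  rintro (_ | x) (_ | y) (_ | z) hxy hxz hyz <;> simp only [extD]
  · exact absurd rfl hxy
  · exact absurd rfl hxy
  · exact absurd rfl hxz
  · exact ((main y z (fun h => hyz (congrArg some h))).2.2).symm
  · exact absurd rfl hyz
  · rw [hd.symm]; exact ((main x z (fun h => hxz (congrArg some h))).2.1).symm
  · rw [hd.symm (some x) none]; exact ((main x y (fun h => hxy (congrArg some h))).1).symm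
  · have := h x y z (fun h => hxy (congrArg some h)) (fun h => hxz (congrArg some h))
      (fun h => hyz (congrArg some h))
    simp only at this
    omega

/-- Two one-point extensions of an ultrametric have a common extension. -/
theorem exists_extD_extD {e : V → V → ℕ} {δ η : V → ℕ} (h1 : IsUltra (extD e δ))
    (h2 : IsUltra (extD e η)) : ∃ t, IsUltra (extD (extD e η) (fun x => x.elim t δ)) := by
  have p1 : ∀ x, 0 < δ x := fun x => h1.pos none (some x) (by simp)
  have p2 : ∀ x, 0 < η x := fun x => h2.pos none (some x) (by simp)
  have t1 : ∀ x y, (δ x = δ y ∧ e x y ≤ δ x) ∨ (δ x = e x y ∧ δ y ≤ δ x) ∨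
    (δ y = e x y ∧ δ x ≤ δ y) := fun x y => h1.two_largest none (some x) (some y)
  have t2 : ∀ x y, (η x = η y ∧ e x y ≤ η x) ∨ (η x = e x y ∧ η y ≤ η x) ∨
    (η y = e x y ∧ η x ≤ η y) := fun x y => h2.two_largest none (some x) (some y)
  obtain ⟨t, ht, h⟩ : ∃ t, 0 < t ∧ ∀ x, (δ x = η x ∧ t ≤ δ x) ∨ (t = max (δ x) (η x)) := by
    by_cases hx : ∃ x, δ x ≠ η x
    · obtain ⟨x, hx⟩ := hx
      refine ⟨max (δ x) (η x), by have := p1 x; omega, fun y => ?_⟩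
      have := t1 x y
      have := t2 x y
      omega
    · push Not at hx
      exact ⟨1, one_pos, fun x => Or.inl ⟨hx x, p1 x⟩⟩
  refine ⟨t, h2.extD ?_ ?_ ?_⟩
  · rintro (_ | x)
    · exact ht
    · exact p1 x
  · rintro (_ | x) (_ | y) <;> simp only [extD, Option.elim]
    · omega
    · have := h y; omega
    · have := h x; omega
    · have := t1 x y; omega
  · rintro (_ | x) (_ | y) <;> simp only [extD, Option.elim]
    · omega
    · have := h y; omega
    · have := h x; omega
    · have := t1 x y; omega

end Extend


section Glue

variable {V : Type}

/-- The quaternary relation defined by an ultrametric. -/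
def relOf (d : V → V → ℕ) (v : Fin 4 → V) : Prop :=
  Function.Injective v ∧ (Split d (v 0) (v 2) (v 1) (v 3) ∨ Split d (v 0) (v 3) (v 1) (v 2))

theorem rep_relOf [Finite V] {d : V → V → ℕ} (hd : IsUltra d) : Rep (mkS (relOf d)) d :=
  ⟨hd, fun _ => Iff.rfl⟩

theorem map_some_injective {X : Type} : Function.Injective (Option.map (some : X → Option X)) :=
  Option.map_injective (Option.some_injective X)

variable {X : Type} [Finite X] {τ τ₁ τ₂ : (Fin 4 → Option X) → Prop}

/-- The structure `ρ` glues the one-point extensions `τ₁` and `τ₂`, without identifying the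
added points. -/
structure IsGlue (τ₁ τ₂ : (Fin 4 → Option X) → Prop) (ρ : (Fin 4 → Option (Option X)) → Prop) :
    Prop where
  mem : mkS ρ ∈ TreeClass
  left : ∀ v, ρ (fun j => (v j).map some) ↔ τ₁ v
  right : ∀ v, ρ (fun j => some (v j)) ↔ τ₂ v

theorem isGlue_of_DD (h₁ : mkS τ₁ ∈ TreeClass) (h₂ : mkS τ₂ ∈ TreeClass)
    {ρ : (Fin 4 → Option (Option X)) → Prop} (hρ : mkS ρ ∈ TreeClass)
    (hl : ∀ x y z w, DD (mkS ρ) (x.map some) (y.map some) (z.map some) (w.map some) ↔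
      DD (mkS τ₁) x y z w)
    (hr : ∀ x y z w, DD (mkS ρ) (some x) (some y) (some z) (some w) ↔ DD (mkS τ₂) x y z w) :
    IsGlue τ₁ τ₂ ρ where
  mem := hρ
  left v := (embOfDD (X := mkS τ₁) (Y := mkS ρ) h₁ hρ _ map_some_injective hl).rel_iff () v
  right v := (embOfDD (X := mkS τ₂) (Y := mkS ρ) h₂ hρ some (Option.some_injective _) hr).rel_iff
    () v

theorem exists_reps (h₁ : mkS τ₁ ∈ TreeClass) (h₂ : mkS τ₂ ∈ TreeClass)
    (h : ∀ v : Fin 4 → X, τ₁ (fun j => some (v j)) ↔ τ₂ (fun j => some (v j))) :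
    ∃ d₁ d₂, Rep (mkS τ₁) d₁ ∧ Rep (mkS τ₂) d₂ ∧
      SameOrder (fun x y => d₁ (some x) (some y)) (fun x y => d₂ (some x) (some y)) := by
  rcases isEmpty_or_nonempty X with hX | ⟨⟨r⟩⟩
  · obtain ⟨d₁, hd₁⟩ := (mem_treeClass_iff _).mp h₁
    obtain ⟨d₂, hd₂⟩ := (mem_treeClass_iff _).mp h₂
    exact ⟨d₁, d₂, hd₁, hd₂, fun x => hX.elim x⟩
  · obtain ⟨d₁, N₁, hd₁⟩ := exists_rooted h₁ (some r)
    obtain ⟨d₂, N₂, hd₂⟩ := exists_rooted h₂ (some r)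
    refine ⟨d₁, d₂, hd₁.rep, hd₂.rep, ?_⟩
    intro x y z hxy hxz hyz
    refine Rooted.order_iff (X := mkS τ₁) (Y := mkS τ₂) (f := some) (f' := some) hd₁ hd₂ (Option.some_injective X)
      (Option.some_injective X) ?_ x y z hxy hxz hyz
    intro x y z _ _ _ _ _ _
    have e : ∀ x y z w : X, (τ₁ ![some x, some y, some z, some w] ↔
        τ₂ ![some x, some y, some z, some w]) := by
      intro x y z w
      rw [← comp_vec some x y z w]
      exact h _
    exact and_congr (e _ _ _ _).symm (e _ _ _ _).symm

theorem IsUltra.double {d : V → V → ℕ} (h : IsUltra d) : IsUltra (fun x y => 2 * d x y) :=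
  ⟨fun x => by simp [h.self], fun x y hxy => by have := h.pos x y hxy; omega,
    fun x y => by rw [h.symm], fun x y z => by have := h.tri x y z; omega⟩

theorem exists_glue (h₁ : mkS τ₁ ∈ TreeClass) (h₂ : mkS τ₂ ∈ TreeClass)
    (h : ∀ v : Fin 4 → X, τ₁ (fun j => some (v j)) ↔ τ₂ (fun j => some (v j))) :
    ∃ ρ, IsGlue τ₁ τ₂ ρ := by
  obtain ⟨d₁, d₂, hd₁, hd₂, hs⟩ := exists_reps h₁ h₂ h
  obtain ⟨δ, hδ, hδ'⟩ := exists_extD_sameOrder hd₁.ultra (hd₂.ultra.comap (Option.some_injective X)) hs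
  have he : extD (fun x y => 2 * d₂ (some x) (some y)) (fun x => 2 * d₂ none (some x)) =
      fun x y => 2 * d₂ x y := by
    funext x y
    rcases x with _ | x <;> rcases y with _ | y <;> simp only [extD]
    · rw [hd₂.ultra.self]
    · rw [hd₂.ultra.symm]
  obtain ⟨t, ht⟩ := exists_extD_extD hδ (he ▸ hd₂.ultra.double)
  have hrep := rep_relOf ht
  refine ⟨_, isGlue_of_DD h₁ h₂ hrep.mem_treeClass ?_ ?_⟩
  · refine DD_congr_of_order (X := mkS τ₁) hd₁ hrep _ map_some_injective ?_
    intro x y z hxy hxz hyz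
    rw [hδ' x y z hxy hxz hyz]
    rcases x with _ | x <;> rcases y with _ | y <;> rcases z with _ | z <;> exact Iff.rfl
  · refine DD_congr_of_order (X := mkS τ₂) hd₂ hrep _ (Option.some_injective _) ?_
    intro x y z _ _ _
    rw [he]
    simp only [extD]
    omega

/-- The set of common points of the two extensions. -/
def core (X : Type) : Set (Option (Option X)) := Set.range fun x : X => some (some x)

theorem exists_glue_of_height (hτ : mkS τ ∈ TreeClass) {d : Option X → Option X → ℕ} {N : ℕ}
    (hd : Rooted (mkS τ) d none N) (H : X → ℕ) (hpos : ∀ x, 0 < H x)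
    (h1 : ∀ x y, H x ≤ max (H y) (2 * d (some x) (some y)))
    (h2 : ∀ x y, 2 * d (some x) (some y) ≤ max (H x) (H y))
    (h3 : ∀ x y z, x ≠ y → x ≠ z → y ≠ z → (d (some x) (some y) < d (some x) (some z) ↔
      (2 * d (some x) (some y) < H x ∧ d (some x) (some y) < d (some x) (some z)) ∨
        (H z < H x ∧ H z < H y))) :
    ∃ ρ D K, IsGlue τ τ ρ ∧ Rooted (mkS ρ) D none K ∧
      (∀ x y : X, D (some (some x)) (some (some y)) = 2 * d (some x) (some y)) ∧
      ∀ x : X, D (some (some x)) (some none) = H x := by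
  have hu : IsUltra (extD (fun x y => 2 * d (some x) (some y)) H) :=
    IsUltra.extD (hd.rep.ultra.comap (Option.some_injective X)).double hpos h1 h2
  obtain ⟨K, hK⟩ : ∃ K, ∀ x y, extD (fun x y => 2 * d (some x) (some y)) H x y < K := by
    obtain ⟨K, hK⟩ := (Set.finite_range (fun p : Option X × Option X =>
      extD (fun x y => 2 * d (some x) (some y)) H p.1 p.2)).bddAbove
    exact ⟨K + 1, fun x y => Nat.lt_succ_of_le (hK ⟨(x, y), rfl⟩)⟩
  have hu' := hu.extD (δ := fun _ => K) (fun x => (Nat.zero_le _).trans_lt (hK x x))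
    (fun x y => le_max_left _ _) (fun x y => (hK x y).le.trans (le_max_left _ _))
  have hrep := rep_relOf hu'
  have hroot : Rooted (mkS (relOf (extD (extD (fun x y => 2 * d (some x) (some y)) H)
      (fun _ => K)))) (extD (extD (fun x y => 2 * d (some x) (some y)) H) (fun _ => K)) none K := by
    refine ⟨hrep, ?_, ?_⟩
    · rintro (_ | x) hx
      · exact absurd rfl hx
      · rfl
    · rintro (_ | x) (_ | y) hx hy
      · exact absurd rfl hx
      · exact absurd rfl hx
      · exact absurd rfl hy
      · exact hK x y
  refine ⟨_, _, K, isGlue_of_DD hτ hτ hrep.mem_treeClass ?_ ?_, hroot, fun _ _ => rfl, fun _ => rfl⟩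
  · refine DD_congr_of_order (X := mkS τ) hd.rep hrep _ map_some_injective ?_
    refine fun x y z hxy hxz hyz => Rooted.order_iff (X := mkS τ) (Y := mkS _) (f := id)
      (f' := Option.map some) (a := none) hd hroot Function.injective_id
      map_some_injective ?_ x y z hxy hxz hyz
    rintro (_ | x) (_ | y) (_ | z) hx hy hz hxy hxz hyz
    any_goals first | exact absurd rfl hx | exact absurd rfl hy | exact absurd rfl hz
    refine (hroot.DD_root (map_some_injective.ne hx) (map_some_injective.ne hy)
      (map_some_injective.ne hz) (map_some_injective.ne hxy) (map_some_injective.ne hxz)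
      (map_some_injective.ne hyz)).trans
      (Iff.trans ?_ (hd.DD_root hx hy hz hxy hxz hyz).symm)
    simp only [Option.map_some, extD]
    omega
  · refine DD_congr_of_root (X := mkS τ) hτ hrep.mem_treeClass _ (Option.some_injective _) none ?_
    rintro (_ | x) (_ | y) (_ | z) hx hy hz hxy hxz hyz
    any_goals first | exact absurd rfl hx | exact absurd rfl hy | exact absurd rfl hz
    rw [hd.DD_root hx hy hz hxy hxz hyz, hrep.DD_iff]
    have := h3 x y z (fun h => hxy (congrArg some h)) (fun h => hxz (congrArg some h))
      (fun h => hyz (congrArg some h))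
    rw [this]
    have hd4 : Distinct4 (some (some x)) (some (some y)) (some none) (some (some z)) := by
      simpa [Distinct4] using ⟨by simpa using hxy, by simpa using hxz, by simpa using hyz⟩
    simp only [hd4, true_and, Split, extD]
    omega

end Glue


section Embed

variable {X Y : Struc treeSig} (f : Emb X Y) {S : Set X.carrier} {a : X.carrier}

theorem Emb.eqv_iff {x y : X.carrier} :
    Eqv Y (f.toFun '' S) (f.toFun a) (f.toFun x) (f.toFun y) ↔ Eqv X S a x y := by
  refine or_congr f.inj.eq_iff ?_
  simp only [Set.exists_mem_image, f.DD_iff]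

theorem Emb.cls_image {x : X.carrier} :
    cls Y (f.toFun '' S) (f.toFun a) (f.toFun x) = f.toFun '' cls X S a x := by
  ext y
  constructor
  · rintro ⟨⟨y, hy, rfl⟩, h⟩
    exact ⟨y, ⟨hy, f.eqv_iff.mp h⟩, rfl⟩
  · rintro ⟨y, ⟨hy, h⟩, rfl⟩
    exact ⟨⟨y, hy, rfl⟩, f.eqv_iff.mpr h⟩

theorem Emb.numCls_image : numCls Y (f.toFun '' S) (f.toFun a) = numCls X S a := by
  unfold numCls
  rw [Set.image_image, ← Set.ncard_image_of_injective (cls X S a '' S) f.inj.image_injective,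
    Set.image_image]
  simp only [f.cls_image]

theorem Emb.numSing_image : numSing Y (f.toFun '' S) (f.toFun a) = numSing X S a := by
  unfold numSing
  rw [← Set.ncard_image_of_injective _ f.inj]
  congr 1
  ext y
  constructor
  · rintro ⟨⟨x, hx, rfl⟩, h⟩
    exact ⟨x, ⟨hx, fun y hy hxy => f.inj (h _ ⟨y, hy, rfl⟩ (f.eqv_iff.mpr hxy))⟩, rfl⟩
  · rintro ⟨x, ⟨hx, h⟩, rfl⟩
    refine ⟨⟨x, hx, rfl⟩, ?_⟩
    rintro _ ⟨y, hy, rfl⟩ hxy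
    rw [h y hy (f.eqv_iff.mp hxy)]

theorem Emb.code_image : code Y (f.toFun '' S) (f.toFun a) = code X S a := by
  unfold code
  rw [f.numCls_image, f.numSing_image]

end Embed

section GlueSum

variable {X : Type}

theorem none_notMem_core : (none : Option (Option X)) ∉ core X := by
  rintro ⟨x, hx⟩; cases hx

theorem some_none_notMem_core : (some none : Option (Option X)) ∉ core X := by
  rintro ⟨x, hx⟩; cases hx

theorem none_ne_some_none : (none : Option (Option X)) ≠ some none := nofun

theorem mem_core_of_ne : ∀ x : Option (Option X), x ≠ none → x ≠ some none → x ∈ core X := by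
  rintro (_ | _ | x) h1 h2
  · exact absurd rfl h1
  · exact absurd rfl h2
  · exact ⟨x, rfl⟩

theorem map_some_image_range : Option.map (some : X → Option X) '' Set.range some = core X := by
  unfold core
  rw [← Set.range_comp]
  rfl

variable [Finite X] {τ τ₁ τ₂ : (Fin 4 → Option X) → Prop}
  {ρ ρ' : (Fin 4 → Option (Option X)) → Prop}

namespace IsGlue

/-- The first extension as a substructure of the glued structure. -/
def embL (h : IsGlue τ₁ τ₂ ρ) : Emb (mkS τ₁) (mkS ρ) where
  toFun := Option.map some
  inj := map_some_injective
  rel_iff := fun _ v => h.left v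

/-- The second extension as a substructure of the glued structure. -/
def embR (h : IsGlue τ₁ τ₂ ρ) : Emb (mkS τ₂) (mkS ρ) where
  toFun := some
  inj := Option.some_injective _
  rel_iff := fun _ v => h.right v

theorem code_left (h : IsGlue τ₁ τ₂ ρ) :
    code (mkS ρ) (core X) none = code (mkS τ₁) (Set.range some) none := by
  rw [← h.embL.code_image]
  exact congrArg (fun S => code (mkS ρ) S none) map_some_image_range.symm

theorem numCls_left (h : IsGlue τ₁ τ₂ ρ) :
    numCls (mkS ρ) (core X) none = numCls (mkS τ₁) (Set.range some) none := by
  rw [← h.embL.numCls_image]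
  exact congrArg (fun S => numCls (mkS ρ) S none) map_some_image_range.symm

theorem numSing_left (h : IsGlue τ₁ τ₂ ρ) :
    numSing (mkS ρ) (core X) none = numSing (mkS τ₁) (Set.range some) none := by
  rw [← h.embL.numSing_image]
  exact congrArg (fun S => numSing (mkS ρ) S none) map_some_image_range.symm

theorem eqv_left (h : IsGlue τ₁ τ₂ ρ) {x y : X} :
    Eqv (mkS ρ) (core X) none (some (some x)) (some (some y)) ↔
      Eqv (mkS τ₁) (Set.range some) none (some x) (some y) := by
  rw [← h.embL.eqv_iff]
  exact iff_of_eq (congrArg (fun S => Eqv (mkS ρ) S none (some (some x)) (some (some y)))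
    map_some_image_range.symm)

theorem sameType_iff (h₁ : mkS τ₁ ∈ TreeClass) (h₂ : mkS τ₂ ∈ TreeClass) (h : IsGlue τ₁ τ₂ ρ) :
    SameType (mkS ρ) (core X) none (some none) ↔ τ₁ = τ₂ := by
  have hL : ∀ x y z : X, DD (mkS ρ) (some (some x)) (some (some y)) none (some (some z)) ↔
      DD (mkS τ₁) (some x) (some y) none (some z) := fun x y z =>
    h.embL.DD_iff (some x) (some y) none (some z)
  have hR : ∀ x y z : X, DD (mkS ρ) (some (some x)) (some (some y)) (some none) (some (some z)) ↔
      DD (mkS τ₂) (some x) (some y) none (some z) := fun x y z =>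
    h.embR.DD_iff (some x) (some y) none (some z)
  constructor
  · intro hs
    refine (eq_of_agreeOn_univ h₂ h₁ ?_).symm
    refine DD_congr_of_root (X := mkS τ₁) (Y := mkS τ₂) h₁ h₂ id Function.injective_id none ?_
    rintro (_ | x) (_ | y) (_ | z) hx hy hz - - -
    any_goals first | exact absurd rfl hx | exact absurd rfl hy | exact absurd rfl hz
    exact (hR x y z).symm.trans ((hs _ ⟨x, rfl⟩ _ ⟨y, rfl⟩ _ ⟨z, rfl⟩).symm.trans (hL x y z))
  · rintro rfl
    rintro _ ⟨x, rfl⟩ _ ⟨y, rfl⟩ _ ⟨z, rfl⟩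
    exact (hL x y z).trans (hR x y z).symm

theorem agree_left (h : IsGlue τ₁ τ₂ ρ) (h' : IsGlue τ₁ τ₂ ρ') :
    AgreeOn ρ ρ' (insert none (core X)) := by
  have key : ∀ x ∈ insert none (core X), ∃ x' : Option X, x'.map some = x := by
    rintro _ (rfl | ⟨x, rfl⟩)
    · exact ⟨none, rfl⟩
    · exact ⟨some x, rfl⟩
  intro x hx y hy z hz w hw
  obtain ⟨x, rfl⟩ := key x hx
  obtain ⟨y, rfl⟩ := key y hy
  obtain ⟨z, rfl⟩ := key z hz
  obtain ⟨w, rfl⟩ := key w hw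
  exact (h.embL.DD_iff x y z w).trans (h'.embL.DD_iff x y z w).symm

theorem agree_right (h : IsGlue τ₁ τ₂ ρ) (h' : IsGlue τ₁ τ₂ ρ') :
    AgreeOn ρ ρ' (insert (some none) (core X)) := by
  have key : ∀ x ∈ insert (some none) (core X), ∃ x' : Option X, some x' = x := by
    rintro _ (rfl | ⟨x, rfl⟩)
    · exact ⟨none, rfl⟩
    · exact ⟨some x, rfl⟩
  intro x hx y hy z hz w hw
  obtain ⟨x, rfl⟩ := key x hx
  obtain ⟨y, rfl⟩ := key y hy
  obtain ⟨z, rfl⟩ := key z hz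
  obtain ⟨w, rfl⟩ := key w hw
  exact (h.embR.DD_iff x y z w).trans (h'.embR.DD_iff x y z w).symm

theorem ext_of (h : IsGlue τ₁ τ₂ ρ) (h' : IsGlue τ₁ τ₂ ρ')
    (hC : Cherry (mkS ρ) (core X) none (some none) ↔ Cherry (mkS ρ') (core X) none (some none))
    (hN : Near (mkS ρ) (core X) none (some none) = Near (mkS ρ') (core X) none (some none)) :
    ρ = ρ' :=
  eq_of_agree h.mem h'.mem none_notMem_core some_none_notMem_core none_ne_some_none
    mem_core_of_ne (h.agree_left h') (h.agree_right h') hC hN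

end IsGlue

theorem near_subset_of_not_sameType {V : Type} [Finite V] {W : Set V} {a b : V}
    {R R' : (Fin 4 → V) → Prop} (hR : mkS R ∈ TreeClass) (hR' : mkS R' ∈ TreeClass)
    (hW : W.Nontrivial) (ha : a ∉ W) (hb : b ∉ W) (hab : a ≠ b)
    (h1 : AgreeOn R R' (insert a W)) (h2 : AgreeOn R R' (insert b W))
    (hs : ¬ SameType (mkS R) W a b) (hs' : ¬ SameType (mkS R') W a b) :
    Near (mkS R) W a b ⊆ Near (mkS R') W a b := by
  obtain ⟨d, N, M, c⟩ := exists_spread hR hW ha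
  obtain ⟨d', N', M', c'⟩ := exists_spread hR' hW ha
  have hN' : (Near (mkS R') W a b).Nonempty := by
    rw [Set.nonempty_iff_ne_empty]
    exact fun h => hs' (c'.sameType_of_node hb hab (fun hc => hs' (c'.sameType_of_cherry hb hab hc)) h)
  obtain ⟨y₀, hy₀⟩ := hN'
  rw [c'.mem_near_iff hb hab] at hy₀
  intro x₀ hx₀
  by_contra hx₀'
  rw [c.mem_near_iff hb hab] at hx₀
  rw [c'.mem_near_iff hb hab] at hx₀'
  obtain ⟨hxW, hx⟩ := hx₀
  obtain ⟨hyW, hy⟩ := hy₀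
  have hx' : ¬ d' x₀ b < M' := fun h => hx₀' ⟨hxW, h⟩
  have hu := c.rooted.rep.ultra
  have hu' := c'.rooted.rep.ultra
  have heq : ∀ x ∈ W, ∀ y ∈ W, (d x y < M ↔ d' x y < M') := fun x hx y hy =>
    (c.eqv_iff hx hy).symm.trans ((h1.eqv_iff hx hy).trans (c'.eqv_iff hx hy))
  have hA : ∀ x ∈ W, ∀ y ∈ W, ∀ z ∈ W, x ≠ y → x ≠ z → y ≠ z →
      (d x y < d x z ↔ d' x y < d' x z) := by
    intro x hx y hy z hz hxy hxz hyz
    have := h1 x (Or.inr hx) y (Or.inr hy) a (Or.inl rfl) z (Or.inr hz)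
    rw [c.DD_root' hx hy hz, c'.DD_root' hx hy hz] at this
    simpa only [ne_eq, hxy, hxz, hyz, not_false_eq_true, true_and] using this
  have hB : ∀ x ∈ W, ∀ y ∈ W, ∀ z ∈ W, x ≠ y → x ≠ z → y ≠ z →
      (((d x y < d x b ∧ d x y < d x z) ∨ (d z b < d x b ∧ d z b < d y b)) ↔
      ((d' x y < d' x b ∧ d' x y < d' x z) ∨ (d' z b < d' x b ∧ d' z b < d' y b))) := by
    intro x hx y hy z hz hxy hxz hyz
    have := h2 x (Or.inr hx) y (Or.inr hy) b (Or.inl rfl) z (Or.inr hz)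
    rw [c.DD_split hb hx hy hz, c'.DD_split hb hx hy hz] at this
    simpa only [ne_eq, hxy, hxz, hyz, not_false_eq_true, true_and] using this
  have hle := c.le_of_near hxW hx
  have hle' := c'.le_of_near hyW hy
  have hxy : x₀ ≠ y₀ := by rintro rfl; exact hx' hy
  have hpart : ∀ z ∈ W, (d z b < M ↔ ¬ d' z b < M') := by
    intro z hz
    have e1 := hu.symm y₀ x₀
    have e1' := hu'.symm y₀ x₀
    have e2 := hu.symm y₀ z
    have e2' := hu'.symm y₀ z
    have e3 := hu.symm x₀ z
    have e3' := hu'.symm x₀ z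
    have t1 := hu.two_largest x₀ y₀ b
    have t1' := hu'.two_largest x₀ y₀ b
    have q1 := heq x₀ hxW y₀ hyW
    rcases eq_or_ne z x₀ with rfl | hzx
    · omega
    rcases eq_or_ne z y₀ with rfl | hzy
    · omega
    have t2 := hu.two_largest z y₀ b
    have t2' := hu'.two_largest z y₀ b
    have t3 := hu.two_largest z x₀ b
    have t3' := hu'.two_largest z x₀ b
    have q2 := heq z hz x₀ hxW
    have q3 := heq z hz y₀ hyW
    have l1 := hle z hz
    have l1' := hle' z hz
    have l2 := hle y₀ hyW
    have l2' := hle' x₀ hxW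
    have b1 := hB z hz y₀ hyW x₀ hxW hzy hzx hxy.symm
    have b2 := hB z hz x₀ hxW y₀ hyW hzx hzy hxy
    omega
  have hrel : ∀ x ∈ W, ∀ y ∈ W, (d x y < M ↔ (d x b < M ↔ d y b < M)) := by
    intro x hx y hy
    have q := heq x hx y hy
    have p1 := hpart x hx
    have p2 := hpart y hy
    have t := hu.two_largest x y b
    have t' := hu'.two_largest x y b
    omega
  apply hs
  intro x hx y hy z hz
  rw [c.DD_root' hx hy hz, c.DD_split hb hx hy hz]
  refine and_congr_right fun h => ?_
  obtain ⟨hxy, hxz, hyz⟩ := h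
  have a1 := hA x hx y hy z hz hxy hxz hyz
  have b1 := hB x hx y hy z hz hxy hxz hyz
  have p1 := hpart x hx
  have p2 := hpart y hy
  have p3 := hpart z hz
  have l1 := hle x hx
  have l2 := hle y hy
  have l3 := hle z hz
  have l1' := hle' x hx
  have l2' := hle' y hy
  have l3' := hle' z hz
  have s1 := hrel x hx y hy
  have s2 := hrel x hx z hz
  have s3 := hrel y hy z hz
  have m2 := c.le x hx z hz
  have m2' := c'.le x hx z hz
  by_cases k1 : d x b < M <;> by_cases k2 : d y b < M <;> by_cases k3 : d z b < M <;>
    simp only [k1, k2, k3, true_iff, iff_true, iff_false, false_iff, not_true,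
      not_lt] at p1 p2 p3 s1 s2 s3 <;> omega

end GlueSum

section GlueSum

variable {X : Type}

theorem core_nontrivial [Nontrivial X] : (core X).Nontrivial := by
  obtain ⟨x, y, h⟩ := exists_pair_ne X
  exact ⟨_, ⟨x, rfl⟩, _, ⟨y, rfl⟩, fun e => h (Option.some_injective _ (Option.some_injective _ e))⟩

theorem range_some_nontrivial [Nontrivial X] : (Set.range (some : X → Option X)).Nontrivial := by
  obtain ⟨x, y, h⟩ := exists_pair_ne X
  exact ⟨_, ⟨x, rfl⟩, _, ⟨y, rfl⟩, fun e => h (Option.some_injective _ e)⟩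

theorem core_ncard : (core X).ncard = Nat.card X := by
  have h := Set.ncard_image_of_injective (Set.univ : Set X)
    ((Option.some_injective (Option X)).comp (Option.some_injective X))
  rwa [Set.image_univ, Set.ncard_univ] at h

variable [Finite X] {τ τ₁ τ₂ : (Fin 4 → Option X) → Prop}
  {ρ ρ' : (Fin 4 → Option (Option X)) → Prop}

theorem exists_glue_spread (hτ : mkS τ ∈ TreeClass) {d : Option X → Option X → ℕ} {N M : ℕ}
    (c : Spread (mkS τ) (Set.range some) none d N M) (H : X → ℕ) (hpos : ∀ x, 0 < H x)
    (h1 : ∀ x y, H x ≤ max (H y) (2 * d (some x) (some y)))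
    (h2 : ∀ x y, 2 * d (some x) (some y) ≤ max (H x) (H y))
    (h3 : ∀ x y z, x ≠ y → x ≠ z → y ≠ z → (d (some x) (some y) < d (some x) (some z) ↔
      (2 * d (some x) (some y) < H x ∧ d (some x) (some y) < d (some x) (some z)) ∨
        (H z < H x ∧ H z < H y))) :
    ∃ ρ D K, IsGlue τ τ ρ ∧ Spread (mkS ρ) (core X) none D K (2 * M) ∧
      ∀ x : X, D (some (some x)) (some none) = H x := by
  obtain ⟨ρ, D, K, hρ, hD, e1, e2⟩ := exists_glue_of_height hτ c.rooted H hpos h1 h2 h3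
  refine ⟨ρ, D, K, hρ, ⟨hD, none_notMem_core, ?_, ?_, by have := c.pos; omega⟩, e2⟩
  · rintro _ ⟨x, rfl⟩ _ ⟨y, rfl⟩
    have : d (some x) (some y) ≤ M := c.le (some x) ⟨x, rfl⟩ (some y) ⟨y, rfl⟩
    rw [e1]
    omega
  · obtain ⟨_, ⟨x, rfl⟩, _, ⟨y, rfl⟩, h⟩ := c.att
    exact ⟨_, ⟨x, rfl⟩, _, ⟨y, rfl⟩, by rw [e1, h]⟩

theorem exists_glue_cherry [Nontrivial X] (hτ : mkS τ ∈ TreeClass) :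
    ∃ ρ, IsGlue τ τ ρ ∧ Cherry (mkS ρ) (core X) none (some none) ∧
      Near (mkS ρ) (core X) none (some none) = ∅ := by
  obtain ⟨d, N, M, c⟩ := exists_spread (S := Set.range some) (a := none) hτ
    range_some_nontrivial (by simp)
  have hle : ∀ x y, d (some x) (some y) ≤ M := fun x y => c.le (some x) ⟨x, rfl⟩ (some y) ⟨y, rfl⟩
  obtain ⟨ρ, D, K, hρ, c', hH⟩ := exists_glue_spread hτ c (fun _ => 2 * M + 1) (fun _ => by omega)
    (fun x y => by omega) (fun x y => by have := hle x y; omega)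
    (fun x y z _ _ _ => by have := hle x y; omega)
  refine ⟨ρ, hρ, ?_, ?_⟩
  · rw [c'.cherry_iff some_none_notMem_core none_ne_some_none]
    rintro _ ⟨x, rfl⟩
    rw [hH]; omega
  · ext x
    rw [c'.mem_near_iff some_none_notMem_core none_ne_some_none]
    simp only [Set.mem_empty_iff_false, iff_false, not_and, not_lt]
    rintro ⟨x, rfl⟩
    rw [hH]; omega

theorem exists_glue_node [Nontrivial X] (hτ : mkS τ ∈ TreeClass) :
    ∃ ρ, IsGlue τ τ ρ ∧ ¬ Cherry (mkS ρ) (core X) none (some none) ∧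
      Near (mkS ρ) (core X) none (some none) = ∅ := by
  obtain ⟨d, N, M, c⟩ := exists_spread (S := Set.range some) (a := none) hτ
    range_some_nontrivial (by simp)
  have hle : ∀ x y, d (some x) (some y) ≤ M := fun x y => c.le (some x) ⟨x, rfl⟩ (some y) ⟨y, rfl⟩
  obtain ⟨ρ, D, K, hρ, c', hH⟩ := exists_glue_spread hτ c (fun _ => 2 * M)
    (fun _ => by have := c.pos; omega)
    (fun x y => by omega) (fun x y => by have := hle x y; omega)
    (fun x y z _ _ _ => by have := hle x y; have := hle x z; omega)
  refine ⟨ρ, hρ, ?_, ?_⟩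
  · rw [c'.cherry_iff some_none_notMem_core none_ne_some_none]
    intro h
    obtain ⟨x⟩ := (inferInstance : Nonempty X)
    have := h _ ⟨x, rfl⟩
    rw [hH] at this; omega
  · ext x
    rw [c'.mem_near_iff some_none_notMem_core none_ne_some_none]
    simp only [Set.mem_empty_iff_false, iff_false, not_and, not_lt]
    rintro ⟨x, rfl⟩
    rw [hH]

theorem exists_glue_edge (hτ : mkS τ ∈ TreeClass) {d : Option X → Option X → ℕ} {N M : ℕ}
    (c : Spread (mkS τ) (Set.range some) none d N M) {p q : X} (hpq : d (some p) (some q) = M)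
    (h2 : numCls (mkS τ) (Set.range some) none = 2) :
    ∃ ρ, IsGlue τ τ ρ ∧ ∀ x : X, some (some x) ∈ Near (mkS ρ) (core X) none (some none) ↔
      d (some x) (some p) < M := by
  classical
  have hu := c.rooted.rep.ultra
  have hle : ∀ x y, d (some x) (some y) ≤ M := fun x y => c.le (some x) ⟨x, rfl⟩ (some y) ⟨y, rfl⟩
  rw [c.numCls_eq_two_iff (x₀ := some p) (y₀ := some q) ⟨p, rfl⟩ ⟨q, rfl⟩ hpq] at h2
  have hcl : ∀ x : X, d (some x) (some p) < M ∨ d (some x) (some q) < M :=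
    fun x => h2 (some x) ⟨x, rfl⟩
  have hrel : ∀ x y : X, d (some x) (some y) < M ↔
      (d (some x) (some p) < M ↔ d (some y) (some p) < M) := by
    intro x y
    have t1 := hu.two_largest (some x) (some y) (some p)
    have t2 := hu.two_largest (some x) (some y) (some q)
    have t3 := hu.two_largest (some x) (some p) (some q)
    have t4 := hu.two_largest (some y) (some p) (some q)
    have := hcl x
    have := hcl y
    omega
  obtain ⟨ρ, D, K, hρ, c', hH⟩ := exists_glue_spread hτ c
    (fun x => if d (some x) (some p) < M then 2 * M - 1 else 2 * M)
    (fun _ => by have := c.pos; split_ifs <;> omega)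
    (fun x y => by
      have := hle x y; have := hrel x y
      split_ifs <;> omega)
    (fun x y => by
      have := hle x y; have := hrel x y
      split_ifs <;> omega)
    (fun x y z _ _ _ => by
      have := hle x y; have := hle x z; have := hrel x y
      have := hrel x z; split_ifs <;> omega)
  refine ⟨ρ, hρ, fun x => ?_⟩
  rw [c'.mem_near_iff some_none_notMem_core none_ne_some_none, hH]
  have := c.pos
  refine ⟨fun h => ?_, fun h => ⟨⟨x, rfl⟩, ?_⟩⟩
  · have := h.2
    split_ifs at this <;> omega
  · rw [if_pos h]; omega

theorem sum_glue_of_ne (h₁ : mkS τ₁ ∈ TreeClass) (h₂ : mkS τ₂ ∈ TreeClass)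
    (h : ∀ v : Fin 4 → X, τ₁ (fun j => some (v j)) ↔ τ₂ (fun j => some (v j))) (hne : τ₁ ≠ τ₂) :
    ∃ ρ, {ρ | IsGlue τ₁ τ₂ ρ} = {ρ} ∧
      code (mkS ρ) (insert (some none) (core X)) none = code (mkS τ₁) (Set.range some) none := by
  obtain ⟨ρ, hρ⟩ := exists_glue h₁ h₂ h
  have hns : ∀ ρ, IsGlue τ₁ τ₂ ρ → ¬ SameType (mkS ρ) (core X) none (some none) :=
    fun ρ hρ hs => hne ((hρ.sameType_iff h₁ h₂).mp hs)
  have hX : Nontrivial X := by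
    by_contra hX
    rw [not_nontrivial_iff_subsingleton] at hX
    refine hns ρ hρ ?_
    rintro _ ⟨x, rfl⟩ _ ⟨y, rfl⟩ _ -
    rw [Subsingleton.elim x y]
    exact iff_of_false (fun h => (DD_distinct hρ.mem h).1 rfl) (fun h => (DD_distinct hρ.mem h).1 rfl)
  have hW : (core X).Nontrivial := core_nontrivial
  refine ⟨ρ, ?_, ?_⟩
  · ext ρ'
    simp only [Set.mem_ofPred_eq, Set.mem_singleton_iff]
    refine ⟨fun hρ' => ?_, fun h => h ▸ hρ⟩
    refine hρ'.ext_of hρ (iff_of_false (fun hc => hns _ hρ' ?_) (fun hc => hns _ hρ ?_)) ?_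
    · exact sameType_of_cherry hρ'.mem hW none_notMem_core some_none_notMem_core none_ne_some_none hc
    · exact sameType_of_cherry hρ.mem hW none_notMem_core some_none_notMem_core none_ne_some_none hc
    · exact Set.Subset.antisymm
        (near_subset_of_not_sameType hρ'.mem hρ.mem hW none_notMem_core some_none_notMem_core
          none_ne_some_none (hρ'.agree_left hρ) (hρ'.agree_right hρ) (hns _ hρ') (hns _ hρ))
        (near_subset_of_not_sameType hρ.mem hρ'.mem hW none_notMem_core some_none_notMem_core
          none_ne_some_none (hρ.agree_left hρ') (hρ.agree_right hρ') (hns _ hρ) (hns _ hρ'))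
  · rw [code_insert_of_not_sameType hρ.mem hW none_notMem_core some_none_notMem_core
      none_ne_some_none (hns _ hρ), hρ.code_left]

theorem exists_glue_of_subsingleton [Subsingleton X] (hτ : mkS τ ∈ TreeClass) :
    ∃ ρ, {ρ | IsGlue τ τ ρ} = {ρ} ∧ mkS ρ ∈ TreeClass := by
  obtain ⟨ρ, hρ⟩ := exists_glue hτ hτ fun _ => Iff.rfl
  have hC : ∀ ρ : (Fin 4 → Option (Option X)) → Prop, Cherry (mkS ρ) (core X) none (some none) := by
    rintro ρ _ ⟨x, rfl⟩ _ ⟨y, rfl⟩ hxy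
    exact absurd (by rw [Subsingleton.elim x y]) hxy
  have hN : ∀ ρ, IsGlue τ τ ρ → Near (mkS ρ) (core X) none (some none) = ∅ := by
    intro ρ hρ
    rw [Set.eq_empty_iff_forall_notMem]
    rintro _ ⟨⟨x, rfl⟩, _, ⟨y, rfl⟩, h⟩
    exact (DD_distinct hρ.mem h).2.2.1 (by rw [Subsingleton.elim x y])
  refine ⟨ρ, ?_, hρ.mem⟩
  ext ρ'
  simp only [Set.mem_ofPred_eq, Set.mem_singleton_iff]
  refine ⟨fun hρ' => ?_, fun h => h ▸ hρ⟩
  exact hρ'.ext_of hρ (iff_of_true (hC _) (hC _)) ((hN _ hρ').trans (hN _ hρ).symm)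

/-- The possible values of the sum of `G` over the self-glueings of an extension of a given
code. -/
inductive GlueVal {A : Type*} [CommRing A] (G : ℕ × ℕ → A) : ℕ × ℕ → A → Prop
  | zero : GlueVal G (0, 0) (G (1, 0))
  | one : GlueVal G (1, 0) (G (2, 2))
  | two (s t : ℕ) (hs : s ≤ 1) (ht : t ≤ 1) :
      GlueVal G (2, s + t) (G (3, 0) + G (2, 1) + (G (2, s) + G (2, t)))
  | large (k : ℕ) (hk : 3 ≤ k) : GlueVal G (k, 0) (G (k + 1, 0) + G (2, 1))

theorem glueVal_sum {A : Type*} [CommRing A] (G : ℕ × ℕ → A) (hτ : mkS τ ∈ TreeClass) :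
    GlueVal G (code (mkS τ) (Set.range some) none)
      (∑ᶠ ρ ∈ {ρ | IsGlue τ τ ρ}, G (code (mkS ρ) (insert (some none) (core X)) none)) := by
  rcases subsingleton_or_nontrivial X with hX | hX
  · obtain ⟨ρ, hρ, hmem⟩ := exists_glue_of_subsingleton hτ
    have hcard : Nat.card X ≤ 1 := Finite.card_le_one_iff_subsingleton.mpr hX
    have h1 : (insert (some none) (core X)).ncard = Nat.card X + 1 := by
      rw [Set.ncard_insert_of_notMem some_none_notMem_core, core_ncard]
    have h2 : (Set.range (some : X → Option X)).ncard = Nat.card X := by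
      rw [← Set.image_univ, Set.ncard_image_of_injective _ (Option.some_injective _), Set.ncard_univ]
    rw [hρ, finsum_mem_singleton, code_of_ncard_le_two hmem (by omega),
      code_of_ncard_le_two (Z := mkS τ) hτ (by omega), h1, h2]
    interval_cases Nat.card X
    · exact .zero
    · exact .one
  have hW : (core X).Nontrivial := core_nontrivial
  have hsame : ∀ ρ, IsGlue τ τ ρ → SameType (mkS ρ) (core X) none (some none) :=
    fun ρ hρ => (hρ.sameType_iff hτ hτ).mpr rfl
  have hcherry : ∀ ρ, IsGlue τ τ ρ → Cherry (mkS ρ) (core X) none (some none) →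
      Near (mkS ρ) (core X) none (some none) = ∅ := by
    intro ρ hρ h
    rw [Set.eq_empty_iff_forall_notMem]
    rintro x ⟨hx, y, hy, hxy⟩
    have hne : x ≠ y := by
      rintro rfl
      exact (DD_distinct hρ.mem hxy).2.2.1 rfl
    exact (DD_of_cherry hρ.mem h hx hy hne).2 hxy
  obtain ⟨ρc, hc, hcC, hcN⟩ := exists_glue_cherry hτ
  obtain ⟨ρn, hn, hnC, hnN⟩ := exists_glue_node hτ
  have hcn : ρc ≠ ρn := by rintro rfl; exact hnC hcC
  have hcode := code_insert_of_cherry hc.mem hW none_notMem_core some_none_notMem_core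
    none_ne_some_none hcC
  have hcode' := code_insert_of_node hn.mem hW none_notMem_core some_none_notMem_core
    none_ne_some_none hnC hnN
  rw [hn.numCls_left] at hcode'
  have hall : ∀ ρ, IsGlue τ τ ρ → Near (mkS ρ) (core X) none (some none) = ∅ → ρ = ρc ∨ ρ = ρn := by
    intro ρ hρ hN
    by_cases hC : Cherry (mkS ρ) (core X) none (some none)
    · exact Or.inl (hρ.ext_of hc (iff_of_true hC hcC) (hN.trans hcN.symm))
    · exact Or.inr (hρ.ext_of hn (iff_of_false hC hnC) (hN.trans hnN.symm))
  have hle := two_le_numCls (Z := mkS τ) (a := none) hτ range_some_nontrivial (by simp)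
  have hcd : code (mkS τ) (Set.range some) none = (numCls (mkS τ) (Set.range some) none,
    if numCls (mkS τ) (Set.range some) none = 2 then numSing (mkS τ) (Set.range some) none else 0) :=
    rfl
  by_cases h2 : numCls (mkS τ) (Set.range some) none = 2
  · obtain ⟨d, N, M, c⟩ := exists_spread (S := Set.range some) (a := none) hτ
      range_some_nontrivial (by simp)
    obtain ⟨_, ⟨p, rfl⟩, _, ⟨q, rfl⟩, hpq⟩ := c.att
    have hu := c.rooted.rep.ultra
    have hqp : d (some q) (some p) = M := by rw [hu.symm, hpq]
    have hcl := (c.numCls_eq_two_iff ⟨p, rfl⟩ ⟨q, rfl⟩ hpq).mp h2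
    have hcl' : ∀ x : X, d (some x) (some p) < M ∨ d (some x) (some q) < M :=
      fun x => hcl (some x) ⟨x, rfl⟩
    have hpos := c.pos
    obtain ⟨ρ₁, h1, hN1⟩ := exists_glue_edge hτ c hpq h2
    obtain ⟨ρ₂, h2', hN2⟩ := exists_glue_edge hτ c hqp h2
    have hp1 : some (some p) ∈ Near (mkS ρ₁) (core X) none (some none) :=
      (hN1 p).mpr (by rw [hu.self]; exact c.pos)
    have hq2 : some (some q) ∈ Near (mkS ρ₂) (core X) none (some none) :=
      (hN2 q).mpr (by rw [hu.self]; exact c.pos)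
    have hq1 : some (some q) ∉ Near (mkS ρ₁) (core X) none (some none) := by
      rw [hN1, hqp]; exact lt_irrefl _
    have hcompl : core X \ Near (mkS ρ₁) (core X) none (some none) =
        Near (mkS ρ₂) (core X) none (some none) := by
      ext x
      constructor
      · rintro ⟨⟨x, rfl⟩, hx⟩
        exact (hN2 x).mpr ((hcl' x).resolve_left fun h => hx ((hN1 x).mpr h))
      · intro hx
        obtain ⟨x, rfl⟩ := near_subset hx
        refine ⟨⟨x, rfl⟩, fun hx' => ?_⟩
        have e1 := (hN1 x).mp hx'
        have e2 := (hN2 x).mp hx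
        have := hu.two_largest (some x) (some p) (some q)
        omega
    have hcompl' : core X \ Near (mkS ρ₂) (core X) none (some none) =
        Near (mkS ρ₁) (core X) none (some none) := by
      rw [← hcompl, Set.sdiff_sdiff_right_self]
      exact Set.inter_eq_right.mpr near_subset
    obtain ⟨-, c1, s1, -⟩ := edge_of_near h1.mem hW none_notMem_core some_none_notMem_core
      none_ne_some_none (hsame _ h1) ⟨_, hp1⟩
    obtain ⟨-, c2, -⟩ := edge_of_near h2'.mem hW none_notMem_core some_none_notMem_core
      none_ne_some_none (hsame _ h2') ⟨_, hq2⟩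
    rw [hcompl] at c1 s1
    rw [hcompl'] at c2
    rw [h1.numSing_left] at s1
    have n12 : ρ₁ ≠ ρ₂ := by rintro rfl; exact hq1 hq2
    have nc1 : ρc ≠ ρ₁ := by rintro rfl; rw [hcN] at hp1; exact hp1
    have nc2 : ρc ≠ ρ₂ := by rintro rfl; rw [hcN] at hq2; exact hq2
    have nn1 : ρn ≠ ρ₁ := by rintro rfl; rw [hnN] at hp1; exact hp1
    have nn2 : ρn ≠ ρ₂ := by rintro rfl; rw [hnN] at hq2; exact hq2
    have hset : {ρ | IsGlue τ τ ρ} = {ρc, ρn, ρ₁, ρ₂} := by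
      ext ρ
      simp only [Set.mem_ofPred_eq, Set.mem_insert_iff, Set.mem_singleton_iff]
      refine ⟨fun hρ => ?_, by rintro (rfl | rfl | rfl | rfl) <;> assumption⟩
      by_cases hN : Near (mkS ρ) (core X) none (some none) = ∅
      · exact (hall ρ hρ hN).elim Or.inl fun h => Or.inr (Or.inl h)
      right; right
      obtain ⟨z, hz⟩ := Set.nonempty_iff_ne_empty.mpr hN
      obtain ⟨z, rfl⟩ := near_subset hz
      obtain ⟨-, -, -, -, hcls⟩ := edge_of_near hρ.mem hW none_notMem_core some_none_notMem_core
        none_ne_some_none (hsame _ hρ) ⟨_, hz⟩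
      have hmem : ∀ x : X, some (some x) ∈ Near (mkS ρ) (core X) none (some none) ↔
          d (some z) (some x) < M := by
        intro x
        rw [hcls _ hz]
        refine (and_iff_right ⟨x, rfl⟩).trans (hρ.eqv_left.trans ?_)
        exact c.eqv_iff ⟨z, rfl⟩ ⟨x, rfl⟩
      have hfin : ∀ r : X, d (some z) (some r) < M → ∀ ρ', IsGlue τ τ ρ' →
          (∀ x : X, some (some x) ∈ Near (mkS ρ') (core X) none (some none) ↔
            d (some x) (some r) < M) → ρ = ρ' := by
        intro r hr ρ' hρ' hN'
        have hNN : Near (mkS ρ) (core X) none (some none) =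
            Near (mkS ρ') (core X) none (some none) := by
          ext x
          by_cases hx : x ∈ core X
          · obtain ⟨x, rfl⟩ := hx
            rw [hmem, hN']
            have := hu.two_largest (some z) (some x) (some r)
            omega
          · exact iff_of_false (fun h => hx (near_subset h))
              (fun h => hx (near_subset (Z := mkS ρ') h))
        refine hρ.ext_of hρ' (iff_of_false (fun h => hN (hcherry _ hρ h)) fun h => ?_) hNN
        exact hN (hNN.trans (hcherry _ hρ' h))
      exact (hcl' z).imp (fun h => hfin p h _ h1 hN1) (fun h => hfin q h _ h2' hN2)
    rw [hset, finsum_mem_insert _ (by simp [hcn, nc1, nc2]) (Set.toFinite _),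
      finsum_mem_insert _ (by simp [nn1, nn2]) (Set.toFinite _), finsum_mem_pair n12, hcode, hcode',
      c1, c2, hcd, if_pos h2, h2, s1, ← add_assoc, add_comm (G (2, 1)), add_comm (G (2, sg _)) (G (2, sg _))]
    exact GlueVal.two (G := G) _ _ (sg_le_one _) (sg_le_one _)
  · have hset : {ρ | IsGlue τ τ ρ} = {ρc, ρn} := by
      ext ρ
      simp only [Set.mem_ofPred_eq, Set.mem_insert_iff, Set.mem_singleton_iff]
      refine ⟨fun hρ => hall ρ hρ ?_, by rintro (rfl | rfl) <;> assumption⟩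
      by_contra hN
      have := (edge_of_near hρ.mem hW none_notMem_core some_none_notMem_core none_ne_some_none
        (hsame ρ hρ) (Set.nonempty_iff_ne_empty.mpr hN)).1
      exact h2 (hρ.numCls_left.symm.trans this)
    rw [hset, finsum_mem_pair hcn, hcode, hcode', hcd, if_neg h2, add_comm]
    exact GlueVal.large (G := G) _ (by omega)

theorem sum_glue_self {A : Type*} [CommRing A] {G : ℕ × ℕ → A} (hG : GCond G)
    (hτ : mkS τ ∈ TreeClass) :
    G (code (mkS τ) (Set.range some) none) =
      1 + ∑ᶠ ρ ∈ {ρ | IsGlue τ τ ρ}, G (code (mkS ρ) (insert (some none) (core X)) none) := by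
  have key : ∀ (c : ℕ × ℕ) (S : A), GlueVal G c S → G c = 1 + S := by
    rintro c S (_ | _ | ⟨s, t, hs, ht⟩ | ⟨k, hk⟩)
    · exact hG.zero
    · exact hG.one
    · rw [hG.two s t hs ht]
      ring
    · rw [hG.large k hk]
      ring
  exact key _ _ (glueVal_sum G hτ)

end GlueSum

section Systems

variable {X Y Y' X' X'' : Struc treeSig}

/-- The inverse of an isomorphism. -/
noncomputable def Emb.inv (f : Emb X Y) (h : f.IsIso) : Emb Y X where
  toFun := Function.surjInv h
  inj := Function.injective_surjInv h
  rel_iff := fun i v => by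
    rw [← f.rel_iff]
    simp only [Function.surjInv_eq h]

theorem Emb.apply_inv (f : Emb X Y) (h : f.IsIso) (y : Y.carrier) : f.toFun ((f.inv h).toFun y) = y :=
  Function.surjInv_eq h y

theorem Emb.inv_apply (f : Emb X Y) (h : f.IsIso) (x : X.carrier) : (f.inv h).toFun (f.toFun x) = x :=
  f.inj (f.apply_inv h _)

theorem Emb.inv_isIso (f : Emb X Y) (h : f.IsIso) : (f.inv h).IsIso :=
  fun x => ⟨f.toFun x, f.inv_apply h x⟩

theorem Emb.ext {f g : Emb X Y} (h : ∀ x, f.toFun x = g.toFun x) : f = g := by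
  cases f; cases g
  congr
  exact funext h

/-- Interchanging the roles of the two structures in an amalgamation. -/
def Amalg.swap {i : Emb X Y} {f : Emb X X'} (A : Amalg i f) : Amalg f i where
  Z := A.Z
  j₁ := A.j₂
  j₂ := A.j₁
  comm := fun x => (A.comm x).symm
  surj := fun z => Or.symm (A.surj z)

theorem Amalg.Iso.swap {i : Emb X Y} {f : Emb X X'} {A B : Amalg i f} (h : A.Iso B) :
    A.swap.Iso B.swap := by
  obtain ⟨g, h1, h2, h3⟩ := h
  exact ⟨g, h1, h3, h2⟩

/-- A complete irredundant system of representatives of the amalgamations in `𝔗`. -/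
structure System {i : Emb X Y} {f : Emb X X'} {ι : Type} (r : ι → Amalg i f) : Prop where
  mem : ∀ α, (r α).Z ∈ TreeClass
  complete : ∀ A : Amalg i f, A.Z ∈ TreeClass → ∃ α, A.Iso (r α)
  irred : ∀ α β, (r α).Iso (r β) → α = β

theorem System.swap {i : Emb X Y} {f : Emb X X'} {ι : Type} {r : ι → Amalg i f} (h : System r) :
    System fun α => (r α).swap where
  mem := h.mem
  complete A hA := (h.complete A.swap hA).imp fun _ hα => hα.swap
  irred α β hαβ := h.irred α β hαβ.swap

theorem Amalg.Iso.symm {i : Emb X Y} {f : Emb X X'} {A B : Amalg i f} (h : A.Iso B) :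
    B.Iso A := by
  obtain ⟨g, h1, h2, h3⟩ := h
  exact ⟨g.inv h1, g.inv_isIso h1, fun y => by rw [← h2, g.inv_apply],
    fun y => by rw [← h3, g.inv_apply]⟩

theorem Amalg.Iso.trans {i : Emb X Y} {f : Emb X X'} {A B C : Amalg i f} (h : A.Iso B)
    (hBC : B.Iso C) : A.Iso C := by
  obtain ⟨g, h1, h2, h3⟩ := h
  obtain ⟨k, k1, k2, k3⟩ := hBC
  exact ⟨k.comp g, k1.comp h1, fun y => (congrArg k.toFun (h2 y)).trans (k2 y),
    fun y => (congrArg k.toFun (h3 y)).trans (k3 y)⟩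

/-- Amalgamating in two steps. -/
def Amalg.comp {i : Emb X Y} {f : Emb X X'} (i' : Emb Y Y') (A : Amalg i f) (B : Amalg i' A.j₁) :
    Amalg (i'.comp i) f where
  Z := B.Z
  j₁ := B.j₁
  j₂ := B.j₂.comp A.j₂
  comm := fun x => (B.comm _).trans (congrArg B.j₂.toFun (A.comm x))
  surj := fun z => by
    rcases B.surj z with h | ⟨w, rfl⟩
    · exact Or.inl h
    · rcases A.surj w with ⟨y, rfl⟩ | ⟨x, rfl⟩
      · exact Or.inl ⟨i'.toFun y, B.comm y⟩
      · exact Or.inr ⟨x, rfl⟩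

/-- Corestriction of an embedding. -/
def Emb.codRestrict (f : Emb X Y) (S : Set Y.carrier) (h : ∀ x, f.toFun x ∈ S) :
    Emb X (Y.restrict S) where
  toFun := fun x => ⟨f.toFun x, h x⟩
  inj := fun _ _ e => f.inj (congrArg Subtype.val e)
  rel_iff := fun i v => f.rel_iff i v

theorem System.comp {i : Emb X Y} {f : Emb X X'} {i' : Emb Y Y'} {ι : Type} {κ : ι → Type}
    {r : ι → Amalg i f} (hr : System r) {r' : ∀ α, κ α → Amalg i' (r α).j₁}
    (hr' : ∀ α, System (r' α)) :
    System fun p : Σ α, κ α => (r p.1).comp i' (r' p.1 p.2) where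
  mem p := (hr' p.1).mem p.2
  complete A hA := by
    let S : Set A.Z.carrier := Set.range (A.j₁.comp i').toFun ∪ Set.range A.j₂.toFun
    let B : Amalg i f :=
      { Z := A.Z.restrict S
        j₁ := (A.j₁.comp i').codRestrict S fun x => Or.inl ⟨x, rfl⟩
        j₂ := A.j₂.codRestrict S fun x => Or.inr ⟨x, rfl⟩
        comm := fun x => Subtype.ext (A.comm x)
        surj := by
          rintro ⟨z, ⟨y, rfl⟩ | ⟨x, rfl⟩⟩
          · exact Or.inl ⟨y, rfl⟩
          · exact Or.inr ⟨x, rfl⟩ }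
    obtain ⟨α, g, h1, h2, h3⟩ := hr.complete B (treeClass_of_emb (A.Z.subEmb S) hA)
    let C : Amalg i' (r α).j₁ :=
      { Z := A.Z
        j₁ := A.j₁
        j₂ := (A.Z.subEmb S).comp (g.inv h1)
        comm := fun y => by
          have : (g.inv h1).toFun ((r α).j₁.toFun y) = B.j₁.toFun y := by
            rw [← h2, g.inv_apply]
          exact (congrArg Subtype.val this).symm
        surj := fun z => by
          rcases A.surj z with h | ⟨x, rfl⟩
          · exact Or.inl h
          · refine Or.inr ⟨g.toFun (B.j₂.toFun x), ?_⟩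
            exact congrArg Subtype.val (g.inv_apply h1 (B.j₂.toFun x)) }
    obtain ⟨β, g', h1', h2', h3'⟩ := (hr' α).complete C hA
    refine ⟨⟨α, β⟩, g', h1', h2', fun x => ?_⟩
    refine Eq.trans ?_ ((h3' ((r α).j₂.toFun x)).trans rfl)
    refine congrArg g'.toFun ?_
    have : (g.inv h1).toFun ((r α).j₂.toFun x) = B.j₂.toFun x := by
      rw [← h3, g.inv_apply]
    exact (congrArg Subtype.val this).symm
  irred := by
    rintro ⟨α, β⟩ ⟨α', β'⟩ ⟨g, h1, h2, h3⟩
    have key : ∀ z : (r α).Z.carrier, ∃ w : (r α').Z.carrier,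
        (r' α' β').j₂.toFun w = g.toFun ((r' α β).j₂.toFun z) ∧
        (∀ y, z = (r α).j₁.toFun y → w = (r α').j₁.toFun y) ∧
        (∀ x, z = (r α).j₂.toFun x → w = (r α').j₂.toFun x) := by
      have e1 : ∀ y, g.toFun ((r' α β).j₂.toFun ((r α).j₁.toFun y)) =
          (r' α' β').j₂.toFun ((r α').j₁.toFun y) := fun y => by
        rw [← (r' α β).comm, ← (r' α' β').comm]; exact h2 _
      have e2 : ∀ x, g.toFun ((r' α β).j₂.toFun ((r α).j₂.toFun x)) =
          (r' α' β').j₂.toFun ((r α').j₂.toFun x) := h3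
      intro z
      obtain ⟨w, hw⟩ : ∃ w, (r' α' β').j₂.toFun w = g.toFun ((r' α β).j₂.toFun z) := by
        rcases (r α).surj z with ⟨y, rfl⟩ | ⟨x, rfl⟩
        · exact ⟨_, (e1 y).symm⟩
        · exact ⟨_, (e2 x).symm⟩
      refine ⟨w, hw, ?_, ?_⟩
      · rintro y rfl
        exact (r' α' β').j₂.inj (hw.trans (e1 y))
      · rintro y rfl
        exact (r' α' β').j₂.inj (hw.trans (e2 y))
    choose k hk hk1 hk2 using key
    have hα : α = α' := by
      refine hr.irred α α' ⟨⟨k, ?_, ?_⟩, ?_, fun y => hk1 _ y rfl, fun x => hk2 _ x rfl⟩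
      · intro z z' e
        refine (r' α β).j₂.inj (g.inj ?_)
        rw [← hk, ← hk, e]
      · intro u v
        rw [← (r' α' β').j₂.rel_iff, ← (r' α β).j₂.rel_iff]
        simp only [hk]
        exact g.rel_iff u fun j => (r' α β).j₂.toFun (v j)
      · intro w
        rcases (r α').surj w with ⟨y, rfl⟩ | ⟨x, rfl⟩
        · exact ⟨_, hk1 _ y rfl⟩
        · exact ⟨_, hk2 _ x rfl⟩
    subst hα
    have : β = β' := by
      refine (hr' α).irred β β' ⟨g, h1, h2, fun z => ?_⟩
      rcases (r α).surj z with ⟨y, rfl⟩ | ⟨x, rfl⟩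
      · rw [← hk, hk1 _ y rfl]
      · exact h3 x
    rw [this]

/-- Multiplicative functions on the embeddings of tree structures. -/
structure IsMult {A : Type*} [CommRing A] (φ : ∀ X Y : Struc treeSig, Emb X Y → A) : Prop where
  iso : ∀ {X Y : Struc treeSig} (f : Emb X Y), Y ∈ TreeClass → f.IsIso → φ X Y f = 1
  comp : ∀ {X Y Z : Struc treeSig} (g : Emb Y Z) (f : Emb X Y), Z ∈ TreeClass →
    φ X Z (g.comp f) = φ Y Z g * φ X Y f

variable {A : Type*} [CommRing A] {φ : ∀ X Y : Struc treeSig, Emb X Y → A}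

theorem IsMult.eq_of_iso (hφ : IsMult φ) {i : Emb X Y} {f : Emb X X'} {B C : Amalg i f}
    (hC : C.Z ∈ TreeClass) (h : B.Iso C) : φ _ _ B.j₂ = φ _ _ C.j₂ := by
  obtain ⟨g, h1, -, h3⟩ := h
  have : C.j₂ = g.comp B.j₂ := Emb.ext fun x => (h3 x).symm
  rw [this, hφ.comp g B.j₂ hC, hφ.iso g hC h1, one_mul]

theorem System.sum_eq (hφ : IsMult φ) {i : Emb X Y} {f : Emb X X'} {ι κ : Type} [Fintype ι]
    [Fintype κ] {r : ι → Amalg i f} {s : κ → Amalg i f} (hr : System r) (hs : System s) :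
    ∑ α, φ _ _ (r α).j₂ = ∑ β, φ _ _ (s β).j₂ := by
  choose k hk using fun α => hs.complete (r α) (hr.mem α)
  refine Fintype.sum_bijective k ⟨?_, ?_⟩ _ _ fun α => hφ.eq_of_iso (hs.mem _) (hk α)
  · intro α β h
    exact hr.irred α β ((hk α).trans (h ▸ (hk β).symm))
  · intro β
    obtain ⟨α, hα⟩ := hr.complete (s β) (hs.mem β)
    exact ⟨α, hs.irred _ _ ((hk α).symm.trans hα.symm)⟩

/-- The amalgamation relation holds for `φ` at the pair `(i, f)`. -/
def Good (φ : ∀ X Y : Struc treeSig, Emb X Y → A) (i : Emb X Y) (f : Emb X X') : Prop :=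
  ∃ (ι : Type) (_ : Fintype ι) (r : ι → Amalg i f), System r ∧ φ _ _ i = ∑ α, φ _ _ (r α).j₂

theorem Good.comp_left (hφ : IsMult φ) {i : Emb X Y} {f : Emb X X'} {i' : Emb Y Y'}
    (hY' : Y' ∈ TreeClass) (h : Good φ i f)
    (h' : ∀ B : Amalg i f, B.Z ∈ TreeClass → Good φ i' B.j₁) : Good φ (i'.comp i) f := by
  obtain ⟨ι, _, r, hr, e⟩ := h
  choose κ hκ r' hr' e' using fun α => h' (r α) (hr.mem α)
  refine ⟨Σ α, κ α, inferInstance, _, hr.comp hr', ?_⟩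
  rw [Fintype.sum_sigma, hφ.comp _ _ hY', e, Finset.mul_sum]
  refine Finset.sum_congr rfl fun α _ => ?_
  rw [e' α, Finset.sum_mul]
  exact Finset.sum_congr rfl fun β _ => (hφ.comp _ _ ((hr' α).mem β)).symm

theorem Good.comp_right {i : Emb X Y} {f : Emb X X'} {f' : Emb X' X''}
    (h : Good φ i f) (h' : ∀ B : Amalg i f, B.Z ∈ TreeClass → Good φ B.j₂ f') :
    Good φ i (f'.comp f) := by
  obtain ⟨ι, _, r, hr, e⟩ := h
  choose κ hκ r' hr' e' using fun α => h' (r α) (hr.mem α)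
  refine ⟨Σ α, κ α, inferInstance, _,
    (System.comp hr.swap (i' := f') (r' := fun α β => (r' α β).swap) fun α => (hr' α).swap).swap, ?_⟩
  rw [Fintype.sum_sigma, e]
  exact Finset.sum_congr rfl fun α _ => e' α

theorem system_of_isIso_left {i : Emb X Y} (hi : i.IsIso) (f : Emb X X') (hX' : X' ∈ TreeClass) :
    ∃ B : Amalg i f, B.j₂.IsIso ∧ System fun _ : Unit => B := by
  let B : Amalg i f :=
    { Z := X'
      j₁ := f.comp (i.inv hi)
      j₂ := Emb.id X'
      comm := fun x => congrArg f.toFun (i.inv_apply hi x)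
      surj := fun z => Or.inr ⟨z, rfl⟩ }
  have hid : B.j₂.IsIso := fun x => ⟨x, rfl⟩
  refine ⟨B, hid, fun _ => hX', fun C hC => ⟨(), ?_⟩, fun _ _ _ => rfl⟩
  have key : ∀ y, C.j₁.toFun y = C.j₂.toFun (f.toFun ((i.inv hi).toFun y)) := fun y => by
    rw [← C.comm, i.apply_inv]
  have hs : C.j₂.IsIso := fun z => by
    rcases C.surj z with ⟨y, rfl⟩ | h
    · exact ⟨_, (key y).symm⟩
    · exact h
  exact ⟨C.j₂.inv hs, C.j₂.inv_isIso hs, fun y => by rw [key, C.j₂.inv_apply]; rfl,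
    fun x => C.j₂.inv_apply hs x⟩

theorem good_of_isIso_left (hφ : IsMult φ) {i : Emb X Y} (hi : i.IsIso) (f : Emb X X')
    (hY : Y ∈ TreeClass) (hX' : X' ∈ TreeClass) : Good φ i f := by
  obtain ⟨B, hB, hs⟩ := system_of_isIso_left hi f hX'
  refine ⟨Unit, inferInstance, _, hs, ?_⟩
  rw [Fintype.sum_unique, hφ.iso i hY hi, hφ.iso B.j₂ (hs.mem ()) hB]

theorem good_of_isIso_right (hφ : IsMult φ) (i : Emb X Y) {f : Emb X X'} (hf : f.IsIso)
    (hY : Y ∈ TreeClass) : Good φ i f := by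
  obtain ⟨B, hB, hs⟩ := system_of_isIso_left hf i hY
  have hs' := hs.swap
  refine ⟨Unit, inferInstance, _, hs', ?_⟩
  rw [Fintype.sum_unique]
  have hB' : B.j₂.IsIso := hB
  have h1 := hφ.comp B.j₂ i (hs.mem ())
  have h2 := hφ.comp B.j₁ f (hs.mem ())
  have h3 : B.j₂.comp i = B.j₁.comp f := Emb.ext fun x => (B.comm x).symm
  rw [hφ.iso B.j₂ (hs.mem ()) hB', one_mul] at h1
  rw [hφ.iso f (treeClass_of_emb B.j₁ (hs.mem ())) hf, mul_one] at h2
  rw [← h1, h3, h2]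
  rfl

end Systems

section Standard

/-- The standard one-point extension. -/
def stdEmb (X : Struc treeSig) (τ : (Fin 4 → Option X.carrier) → Prop)
    (h : ∀ v, τ (fun j => some (v j)) ↔ X.rel () v) : Emb X (mkS τ) where
  toFun := some
  inj := Option.some_injective _
  rel_iff := fun _ v => h v

theorem exists_std {W X : Struc treeSig} (g : Emb W X) {a : X.carrier} (ha : IsOnePointExt g a) :
    ∃ τ, ∃ h : ∀ v, τ (fun j => some (v j)) ↔ W.rel () v, ∃ e : Emb (mkS τ) X,
      e.IsIso ∧ g = e.comp (stdEmb W τ h) ∧ e.toFun none = a := by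
  have hne : ∀ w, g.toFun w ≠ a := fun w =>
    (Set.ext_iff.mp ha (g.toFun w)).mp ⟨w, rfl⟩
  let k : Option W.carrier → X.carrier := fun o => o.elim a g.toFun
  have hk : Function.Injective k := by
    rintro (_ | x) (_ | y) e
    · rfl
    · exact absurd e.symm (hne y)
    · exact absurd e (hne x)
    · exact congrArg some (g.inj e)
  refine ⟨fun v => X.rel () fun j => k (v j), fun v => g.rel_iff () v,
    ⟨k, hk, fun _ _ => Iff.rfl⟩, fun x => ?_, rfl, rfl⟩
  by_cases hx : x = a
  · exact ⟨none, hx.symm⟩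
  · obtain ⟨w, hw⟩ := (Set.ext_iff.mp ha x).mpr hx
    exact ⟨some w, hw⟩

variable {X : Struc treeSig} {τ₁ τ₂ : (Fin 4 → Option X.carrier) → Prop}
  (c₁ : ∀ v, τ₁ (fun j => some (v j)) ↔ X.rel () v)
  (c₂ : ∀ v, τ₂ (fun j => some (v j)) ↔ X.rel () v)

/-- The amalgamation given by a glueing. -/
def glueAmalg {ρ : (Fin 4 → Option (Option X.carrier)) → Prop} (hρ : IsGlue τ₁ τ₂ ρ) :
    Amalg (stdEmb X τ₁ c₁) (stdEmb X τ₂ c₂) where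
  Z := mkS ρ
  j₁ := hρ.embL
  j₂ := hρ.embR
  comm := fun _ => rfl
  surj := by
    rintro (_ | x)
    · exact Or.inl ⟨none, rfl⟩
    · exact Or.inr ⟨x, rfl⟩

/-- The amalgamation identifying the two added points. -/
def diagAmalg (h : τ₁ = τ₂) : Amalg (stdEmb X τ₁ c₁) (stdEmb X τ₂ c₂) where
  Z := mkS τ₂
  j₁ := ⟨fun x => x, fun _ _ h => h, fun _ v => by rw [h]⟩
  j₂ := Emb.id _
  comm := fun _ => rfl
  surj := fun x => Or.inl ⟨x, rfl⟩

/-- The amalgamations of two standard one-point extensions. -/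
def stdAmalg : {ρ // IsGlue τ₁ τ₂ ρ} ⊕ PLift (τ₁ = τ₂) → Amalg (stdEmb X τ₁ c₁) (stdEmb X τ₂ c₂)
  | Sum.inl ρ => glueAmalg c₁ c₂ ρ.2
  | Sum.inr h => diagAmalg c₁ c₂ h.down

theorem stdAmalg_complete (A : Amalg (stdEmb X τ₁ c₁) (stdEmb X τ₂ c₂)) (hA : A.Z ∈ TreeClass) :
    ∃ α, A.Iso (stdAmalg c₁ c₂ α) := by
  have hcomm : ∀ x : X.carrier, A.j₁.toFun (some x) = A.j₂.toFun (some x) := A.comm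
  by_cases h0 : A.j₁.toFun none = A.j₂.toFun none
  · have h : ∀ x, A.j₁.toFun x = A.j₂.toFun x := by
      rintro (_ | x)
      exacts [h0, hcomm x]
    have hτ : τ₁ = τ₂ := by
      funext v
      refine propext ((A.j₁.rel_iff () v).symm.trans (Iff.trans ?_ (A.j₂.rel_iff () v)))
      simp only [h]
    have hs : A.j₂.IsIso := fun z => by
      rcases A.surj z with ⟨y, rfl⟩ | h'
      · exact ⟨y, (h y).symm⟩
      · exact h'
    refine ⟨Sum.inr ⟨hτ⟩, A.j₂.inv hs, A.j₂.inv_isIso hs, fun y => ?_, A.j₂.inv_apply hs⟩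
    rw [h]
    exact A.j₂.inv_apply hs y
  · let k : Option (Option X.carrier) → A.Z.carrier := fun o => o.elim (A.j₁.toFun none) A.j₂.toFun
    have hne : ∀ y, A.j₁.toFun none ≠ A.j₂.toFun y := by
      rintro (_ | x) e
      · exact h0 e
      · rw [← hcomm] at e
        exact Option.some_ne_none x (A.j₁.inj e).symm
    have hk : Function.Injective k := by
      rintro (_ | x) (_ | y) e
      · rfl
      · exact absurd e (hne y)
      · exact absurd e.symm (hne x)
      · exact congrArg some (A.j₂.inj e)
    have hk1 : ∀ y : Option X.carrier, k (y.map some) = A.j₁.toFun y := by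
      rintro (_ | x)
      exacts [rfl, (hcomm x).symm]
    let e : Emb (mkS fun v => A.Z.rel () fun j => k (v j)) A.Z := ⟨k, hk, fun _ _ => Iff.rfl⟩
    have he : e.IsIso := fun z => by
      rcases A.surj z with ⟨y, rfl⟩ | ⟨y, rfl⟩
      · exact ⟨_, hk1 y⟩
      · exact ⟨some y, rfl⟩
    have hρ : IsGlue τ₁ τ₂ fun v => A.Z.rel () fun j => k (v j) := by
      refine ⟨treeClass_of_emb e hA, fun v => ?_, fun v => A.j₂.rel_iff () v⟩
      simp only [hk1]
      exact A.j₁.rel_iff () v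
    refine ⟨Sum.inl ⟨_, hρ⟩, e.inv he, e.inv_isIso he, fun y => ?_, fun y => ?_⟩
    · rw [← hk1]
      exact e.inv_apply he _
    · exact e.inv_apply he (some y)

theorem stdAmalg_system (h₂ : mkS τ₂ ∈ TreeClass) : System (stdAmalg c₁ c₂) where
  mem := by
    rintro (ρ | h)
    · exact ρ.2.mem
    · exact h₂
  complete := stdAmalg_complete c₁ c₂
  irred := by
    rintro (⟨ρ, hρ⟩ | h) (⟨ρ', hρ'⟩ | h') ⟨k, h1, h2, h3⟩
    · have hk : ∀ z : Option (Option X.carrier), k.toFun z = z := by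
        rintro (_ | x)
        · exact h2 none
        · exact h3 x
      congr 2
      funext v
      refine propext ((k.rel_iff () v).symm.trans ?_)
      simp only [hk]
      exact Iff.rfl
    · exact absurd (k.inj ((h2 none).trans (h3 none).symm)) nofun
    · exact absurd ((h2 none).symm.trans (h3 none)) nofun
    · exact congrArg _ (Subsingleton.elim _ _)

variable {A : Type*} [CommRing A] {φ : ∀ X Y : Struc treeSig, Emb X Y → A}

theorem IsGlue.isOnePointExt_embR {ρ : (Fin 4 → Option (Option X.carrier)) → Prop}
    (hρ : IsGlue τ₁ τ₂ ρ) : IsOnePointExt hρ.embR none := by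
  ext z
  constructor
  · rintro ⟨x, rfl⟩
    exact nofun
  · rintro h
    rcases z with _ | x
    · exact absurd rfl h
    · exact ⟨x, rfl⟩

theorem isOnePointExt_stdEmb : IsOnePointExt (stdEmb X τ₁ c₁) none := by
  ext z
  constructor
  · rintro ⟨x, rfl⟩
    exact nofun
  · rintro h
    rcases z with _ | x
    · exact absurd rfl h
    · exact ⟨x, rfl⟩

/-- The sum over the amalgamations of two standard one-point extensions. -/
theorem finsum_stdAmalg (hφ : IsMult φ) {w : ∀ X : Struc treeSig, X.carrier → A}
    (hw : ∀ {W X : Struc treeSig} (g : Emb W X) (a : X.carrier), X ∈ TreeClass →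
      IsOnePointExt g a → φ W X g = w X a) (h₂ : mkS τ₂ ∈ TreeClass) :
    ∑ᶠ α, φ _ _ (stdAmalg c₁ c₂ α).j₂ =
      (∑ᶠ _ : PLift (τ₁ = τ₂), 1) + ∑ᶠ ρ ∈ {ρ | IsGlue τ₁ τ₂ ρ}, w (mkS ρ) none := by
  classical
  let : Fintype {ρ // IsGlue τ₁ τ₂ ρ} := Fintype.ofFinite _
  let : Fintype (PLift (τ₁ = τ₂)) := Fintype.ofFinite _
  rw [← finsum_set_coe_eq_finsum_mem, finsum_eq_sum_of_fintype, Fintype.sum_sum_type,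
    finsum_eq_sum_of_fintype]
  rw [add_comm]
  congr 1
  · exact Finset.sum_congr rfl fun h _ => hφ.iso _ h₂ fun x => ⟨x, rfl⟩
  · exact (Finset.sum_congr rfl fun ρ _ => hw ρ.2.embR none ρ.2.mem ρ.2.isOnePointExt_embR).trans
      (finsum_eq_sum_of_fintype _).symm

theorem compl_none : ({none} : Set (Option (Option X.carrier)))ᶜ =
    insert (some none) (core X.carrier) := by
  ext z
  rcases z with _ | _ | x <;> simp [core]

theorem good_stdEmb (hφ : IsMult φ) {G : ℕ × ℕ → A} (hG : GCond G)
    (hw : ∀ {W X : Struc treeSig} (g : Emb W X) (a : X.carrier), X ∈ TreeClass →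
      IsOnePointExt g a → φ W X g = G (code X {a}ᶜ a))
    (h₁ : mkS τ₁ ∈ TreeClass) (h₂ : mkS τ₂ ∈ TreeClass) :
    Good φ (stdEmb X τ₁ c₁) (stdEmb X τ₂ c₂) := by
  let : Fintype ({ρ // IsGlue τ₁ τ₂ ρ} ⊕ PLift (τ₁ = τ₂)) := Fintype.ofFinite _
  refine ⟨_, inferInstance, _, stdAmalg_system c₁ c₂ h₂, ?_⟩
  have hr : ({none}ᶜ : Set (Option X.carrier)) = Set.range some :=
    (isOnePointExt_stdEmb (τ₁ := τ₁) c₁).symm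
  rw [← finsum_eq_sum_of_fintype, finsum_stdAmalg c₁ c₂ hφ (w := fun X a => G (code X {a}ᶜ a)) hw h₂,
    hw _ none h₁ (isOnePointExt_stdEmb c₁)]
  simp only [compl_none]
  refine (congrArg (fun S => G (code (mkS τ₁) S none)) hr).trans ?_
  by_cases h : τ₁ = τ₂
  · subst h
    let : Unique (PLift (τ₁ = τ₁)) := ⟨⟨⟨rfl⟩⟩, fun _ => rfl⟩
    rw [sum_glue_self hG h₁, finsum_unique fun _ : PLift (τ₁ = τ₁) => (1 : A)]
  · have : IsEmpty (PLift (τ₁ = τ₂)) := ⟨fun h' => h h'.down⟩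
    obtain ⟨ρ, hρ, hc⟩ := sum_glue_of_ne h₁ h₂ (fun v => (c₁ v).trans (c₂ v).symm) h
    rw [hρ, finsum_mem_singleton, finsum_of_isEmpty, zero_add, hc]

end Standard

section GoodAll

variable {A : Type*} [CommRing A] {φ : ∀ X Y : Struc treeSig, Emb X Y → A} {X Y X' : Struc treeSig}

theorem isOnePointExt_subEmb (X : Struc treeSig) (a : X.carrier) :
    IsOnePointExt (X.subEmb {a}ᶜ) a :=
  Subtype.range_coe

theorem Emb.exists_factor {f : Emb X Y} (hf : ¬ f.IsIso) :
    ∃ (W : Struc treeSig) (f₁ : Emb X W) (f₂ : Emb W Y) (a : Y.carrier), f = f₂.comp f₁ ∧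
      IsOnePointExt f₂ a ∧ Nat.card W.carrier < Nat.card Y.carrier := by
  obtain ⟨a, ha⟩ := not_forall.mp hf
  refine ⟨Y.restrict {a}ᶜ, f.codRestrict _ fun x h => ha ⟨x, h⟩, Y.subEmb _, a, rfl,
    isOnePointExt_subEmb Y a, ?_⟩
  exact Finite.card_subtype_lt (p := fun x => x ∈ ({a} : Set Y.carrier)ᶜ) (x := a) (by simp)

theorem Amalg.isIso_or_isOnePointExt {i : Emb X Y} {f : Emb X X'} (B : Amalg i f) {a : Y.carrier}
    (ha : IsOnePointExt i a) : B.j₂.IsIso ∨ ∃ b, IsOnePointExt B.j₂ b := by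
  have key : ∀ z, z ∈ Set.range B.j₂.toFun ∨ z = B.j₁.toFun a := by
    intro z
    rcases B.surj z with ⟨y, rfl⟩ | h
    · by_cases hy : y = a
      · exact Or.inr (congrArg _ hy)
      · obtain ⟨x, rfl⟩ := (Set.ext_iff.mp ha y).mpr hy
        exact Or.inl ⟨f.toFun x, (B.comm x).symm⟩
    · exact Or.inl h
  by_cases h : B.j₁.toFun a ∈ Set.range B.j₂.toFun
  · exact Or.inl fun z => (key z).elim id fun e => e ▸ h
  · refine Or.inr ⟨B.j₁.toFun a, ?_⟩
    ext z
    exact ⟨fun hz e => h (e ▸ hz), fun hz => (key z).resolve_right hz⟩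

theorem good_of_isOnePointExt (hφ : IsMult φ) {G : ℕ × ℕ → A} (hG : GCond G)
    (hw : ∀ {W X : Struc treeSig} (g : Emb W X) (a : X.carrier), X ∈ TreeClass →
      IsOnePointExt g a → φ W X g = G (code X {a}ᶜ a))
    {i : Emb X Y} {f : Emb X X'} {a : Y.carrier} {b : X'.carrier}
    (hi : IsOnePointExt i a) (hf : IsOnePointExt f b) (hY : Y ∈ TreeClass) (hX' : X' ∈ TreeClass) :
    Good φ i f := by
  obtain ⟨τ₁, c₁, e₁, h₁, rfl, -⟩ := exists_std i hi
  obtain ⟨τ₂, c₂, e₂, h₂, rfl, -⟩ := exists_std f hf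
  have m₁ := treeClass_of_emb e₁ hY
  have m₂ := treeClass_of_emb e₂ hX'
  refine Good.comp_left hφ hY ?_ fun B hB => good_of_isIso_left hφ h₁ _ hY hB
  refine Good.comp_right ?_ fun B hB => good_of_isIso_right hφ _ h₂ hB
  exact good_stdEmb c₁ c₂ hφ hG hw m₁ m₂

theorem good_of_isOnePointExt_left (hφ : IsMult φ) {G : ℕ × ℕ → A} (hG : GCond G)
    (hw : ∀ {W X : Struc treeSig} (g : Emb W X) (a : X.carrier), X ∈ TreeClass →
      IsOnePointExt g a → φ W X g = G (code X {a}ᶜ a))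
    {i : Emb X Y} {a : Y.carrier} (hi : IsOnePointExt i a)
    (hY : Y ∈ TreeClass) : ∀ (n : ℕ) {X' : Struc treeSig} (f : Emb X X'), X' ∈ TreeClass →
    Nat.card X'.carrier = n → Good φ i f := by
  intro n
  induction n using Nat.strong_induction_on with
  | _ n ih =>
    rintro X' f hX' rfl
    by_cases hf : f.IsIso
    · exact good_of_isIso_right hφ i hf hY
    obtain ⟨W, f₁, f₂, b, rfl, hb, hlt⟩ := Emb.exists_factor hf
    refine Good.comp_right (ih _ hlt f₁ (treeClass_of_emb f₂ hX') rfl) fun B hB => ?_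
    rcases B.isIso_or_isOnePointExt hi with h | ⟨c, hc⟩
    · exact good_of_isIso_left hφ h f₂ hB hX'
    · exact good_of_isOnePointExt hφ hG hw hc hb hB hX'

theorem good_all (hφ : IsMult φ) {G : ℕ × ℕ → A} (hG : GCond G)
    (hw : ∀ {W X : Struc treeSig} (g : Emb W X) (a : X.carrier), X ∈ TreeClass →
      IsOnePointExt g a → φ W X g = G (code X {a}ᶜ a)) :
    ∀ (n : ℕ) {X Y X' : Struc treeSig} (i : Emb X Y) (f : Emb X X'),
    Y ∈ TreeClass → X' ∈ TreeClass → Nat.card Y.carrier = n → Good φ i f := by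
  intro n
  induction n using Nat.strong_induction_on with
  | _ n ih =>
    rintro X Y X' i f hY hX' rfl
    by_cases hi : i.IsIso
    · exact good_of_isIso_left hφ hi f hY hX'
    obtain ⟨W, i₁, i₂, a, rfl, ha, hlt⟩ := Emb.exists_factor hi
    refine Good.comp_left hφ hY (ih _ hlt i₁ f (treeClass_of_emb i₂ hY) hX' rfl) fun B hB => ?_
    exact good_of_isOnePointExt_left hφ hG hw ha hY _ B.j₁ hB rfl

end GoodAll

section Weight

variable {A : Type*} [CommRing A] (G : ℕ × ℕ → A) {X Y Z : Struc treeSig}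

/-- The weight of adding the points of a list one after another. -/
noncomputable def listWeight (Z : Struc treeSig) : Set Z.carrier → List Z.carrier → A
  | _, [] => 1
  | W, a :: l => G (code Z W a) * listWeight Z (insert a W) l

theorem listWeight_append (l l' : List Z.carrier) : ∀ W : Set Z.carrier,
    listWeight G Z W (l ++ l') = listWeight G Z W l * listWeight G Z (W ∪ {x | x ∈ l}) l' := by
  induction l with
  | nil => intro W; simp [listWeight]
  | cons a l ih =>
    intro W
    have : insert a W ∪ {x | x ∈ l} = W ∪ {x | x ∈ a :: l} := by
      ext x
      simp only [Set.mem_union, Set.mem_insert_iff, Set.mem_ofPred_eq, List.mem_cons]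
      tauto
    rw [List.cons_append, listWeight, listWeight, ih, this, mul_assoc]

theorem listWeight_map (f : Emb X Y) (l : List X.carrier) : ∀ W : Set X.carrier,
    listWeight G Y (f.toFun '' W) (l.map f.toFun) = listWeight G X W l := by
  induction l with
  | nil => intro W; rfl
  | cons a l ih =>
    intro W
    rw [List.map_cons, listWeight, listWeight, f.code_image, ← Set.image_insert_eq, ih]

/-- The multiplicative function on embeddings with the given values on one-point extensions. -/
noncomputable def weight (X Y : Struc treeSig) (f : Emb X Y) : A :=
  listWeight G Y (Set.range f.toFun) (Set.toFinite (Set.range f.toFun)ᶜ).toFinset.toList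

variable {G}

theorem listWeight_perm (hG : GCond G) (hZ : Z ∈ TreeClass) {l l' : List Z.carrier}
    (h : l.Perm l') : ∀ W : Set Z.carrier, l.Nodup → (∀ x ∈ l, x ∉ W) →
    listWeight G Z W l = listWeight G Z W l' := by
  induction h with
  | nil => intro W _ _; rfl
  | cons a _ ih =>
    intro W hn hd
    rw [List.nodup_cons] at hn
    rw [listWeight, listWeight, ih _ hn.2]
    intro x hx
    rw [Set.mem_insert_iff, not_or]
    exact ⟨fun e => hn.1 (e ▸ hx), hd x (List.mem_cons_of_mem _ hx)⟩
  | swap a b l =>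
    intro W hn hd
    simp only [listWeight]
    rw [← mul_assoc, ← mul_assoc, Set.insert_comm, weight_comm hG hZ (hd b (by simp)) (hd a (by simp))]
    rintro rfl
    simp at hn
  | trans h₁ _ ih₁ ih₂ =>
    intro W hn hd
    rw [ih₁ W hn hd]
    exact ih₂ W (h₁.nodup_iff.mp hn) fun x hx => hd x (h₁.mem_iff.mpr hx)

theorem weight_eq (hG : GCond G) (hY : Y ∈ TreeClass) (f : Emb X Y) {l : List Y.carrier}
    (hl : l.Nodup) (h : ∀ x, x ∈ l ↔ x ∉ Set.range f.toFun) :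
    weight G X Y f = listWeight G Y (Set.range f.toFun) l := by
  refine listWeight_perm hG hY ?_ _ (Finset.nodup_toList _) (by simp)
  rw [List.perm_ext_iff_of_nodup (Finset.nodup_toList _) hl]
  intro x
  simp [h]

theorem isMult_weight (hG : GCond G) : IsMult (weight G) where
  iso f hY hf := by
    rw [weight_eq hG hY f (l := []) List.nodup_nil fun x => by simpa using hf x]
    rfl
  comp {X Y Z} g f hZ := by
    have hY := treeClass_of_emb g hZ
    set l := (Set.toFinite (Set.range f.toFun)ᶜ).toFinset.toList with hl
    set l' := (Set.toFinite (Set.range g.toFun)ᶜ).toFinset.toList with hl'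
    have ml : ∀ x, x ∈ l ↔ x ∉ Set.range f.toFun := fun x => by simp [hl]
    have ml' : ∀ x, x ∈ l' ↔ x ∉ Set.range g.toFun := fun x => by simp [hl']
    have hr : Set.range (g.comp f).toFun = g.toFun '' Set.range f.toFun :=
      Set.range_comp g.toFun f.toFun
    rw [weight_eq hG hZ (g.comp f) (l := l.map g.toFun ++ l'), listWeight_append, hr,
      listWeight_map, mul_comm]
    · have : g.toFun '' Set.range f.toFun ∪ {x | x ∈ l.map g.toFun} = Set.range g.toFun := by
        ext x
        simp only [Set.mem_union, Set.mem_ofPred_eq, List.mem_map, ml]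
        constructor
        · rintro (⟨y, -, rfl⟩ | ⟨y, -, rfl⟩) <;> exact ⟨y, rfl⟩
        · rintro ⟨y, rfl⟩
          by_cases hy : y ∈ Set.range f.toFun
          · exact Or.inl ⟨y, hy, rfl⟩
          · exact Or.inr ⟨y, hy, rfl⟩
      rw [this]
      rfl
    · refine List.Nodup.append ((Finset.nodup_toList _).map g.inj) (Finset.nodup_toList _) ?_
      intro x hx hx'
      obtain ⟨y, -, rfl⟩ := List.mem_map.mp hx
      exact (ml' _).mp hx' ⟨y, rfl⟩
    · intro x
      rw [List.mem_append, List.mem_map, ml', hr]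
      constructor
      · rintro (⟨y, hy, rfl⟩ | hx)
        · rw [g.inj.mem_set_image]
          exact (ml y).mp hy
        · rintro ⟨y, -, rfl⟩
          exact hx ⟨y, rfl⟩
      · intro hx
        by_cases h : x ∈ Set.range g.toFun
        · obtain ⟨y, rfl⟩ := h
          rw [g.inj.mem_set_image] at hx
          exact Or.inl ⟨y, (ml y).mpr hx, rfl⟩
        · exact Or.inr h

theorem weight_of_isOnePointExt (hG : GCond G) (g : Emb X Y) (a : Y.carrier) (hY : Y ∈ TreeClass)
    (h : IsOnePointExt g a) : weight G X Y g = G (code Y {a}ᶜ a) := by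
  have h' : Set.range g.toFun = {a}ᶜ := h
  rw [weight_eq hG hY g (l := [a]) (List.nodup_singleton a) (by simp [h']), h']
  simp [listWeight]

theorem good_weight (hG : GCond G) {X' : Struc treeSig} (i : Emb X Y) (f : Emb X X')
    (hY : Y ∈ TreeClass) (hX' : X' ∈ TreeClass) : Good (weight G) i f :=
  good_all (isMult_weight hG) hG (weight_of_isOnePointExt hG) _ i f hY hX' rfl

end Weight

section Lift

variable {A : Type*} [CommRing A] {G : ℕ × ℕ → A} {X Y X' : Struc treeSig}

theorem system_of_forall_memUpIso {i : Emb X Y} {f : Emb X X'} {ι : Type} {r : ι → Amalg i f}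
    (hr : ∀ α, (r α).Z ∈ TreeClass)
    (hc : ∀ A : Amalg i f, MemUpIso TreeClass A.Z → ∃ α, A.Iso (r α))
    (hi : ∀ α β, (r α).Iso (r β) → α = β) : System r :=
  ⟨hr, fun A hA => hc A (memUpIso_of_mem hA), hi⟩

/-- The evaluation of the generators of `Θ(𝔗)` at weights. -/
noncomputable def polyLift (G : ℕ × ℕ → A) : ThetaPoly TreeClass →+* A :=
  MvPolynomial.eval₂Hom (Int.castRingHom A)
    fun g : ThetaGen TreeClass => weight G g.1.1 g.2.1.1 g.2.2

theorem polyLift_thetaVar (hX : X ∈ TreeClass) (hY : Y ∈ TreeClass) (f : Emb X Y) :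
    polyLift G (thetaVar X Y hX hY f) = weight G X Y f :=
  MvPolynomial.eval₂Hom_X' _ _ _

theorem polyLift_eq_zero (hG : GCond G) {p : ThetaPoly TreeClass}
    (hp : p ∈ Ideal.span (ThetaRels TreeClass)) : polyLift G p = 0 := by
  have hm := isMult_weight hG
  rw [← RingHom.mem_ker]
  refine (Ideal.span_le.mpr ?_) hp
  rintro p ((⟨X, Y, hX, hY, f, hf, rfl⟩ | ⟨X, Y, Z, hX, hY, hZ, f, g, rfl⟩) |
    ⟨X, Y, X', hX, hY, hX', i, f, m, r, hr, hc, hi, rfl⟩) <;>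
    simp only [SetLike.mem_coe, RingHom.mem_ker, map_sub, map_mul, map_one, map_sum,
      polyLift_thetaVar, sub_eq_zero]
  · exact hm.iso f hY hf
  · exact hm.comp g f hZ
  · obtain ⟨ι, _, s, hs, e⟩ := good_weight hG i f hY hX'
    rw [e]
    exact System.sum_eq hm hs (system_of_forall_memUpIso hr hc hi)

/-- The ring homomorphism on `Θ(𝔗)` determined by the values on one-point extensions. -/
noncomputable def thetaLift (hG : GCond G) : ThetaRing TreeClass →+* A :=
  Ideal.Quotient.lift _ (polyLift G) fun _ => polyLift_eq_zero hG

theorem thetaLift_thetaClass (hG : GCond G) (hX : X ∈ TreeClass) (hY : Y ∈ TreeClass)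
    (f : Emb X Y) : thetaLift hG (thetaClass X Y hX hY f) = weight G X Y f := by
  rw [thetaLift, thetaClass, Ideal.Quotient.lift_mk, polyLift_thetaVar]

end Lift

section Universal

open Classical in
/-- The universal multiplicative function on embeddings of tree structures. -/
noncomputable def thetaFun (X Y : Struc treeSig) (f : Emb X Y) : ThetaRing TreeClass :=
  if h : X ∈ TreeClass ∧ Y ∈ TreeClass then thetaClass X Y h.1 h.2 f else 0

variable {X Y X' : Struc treeSig}

theorem thetaFun_eq (hX : X ∈ TreeClass) (hY : Y ∈ TreeClass) (f : Emb X Y) :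
    thetaFun X Y f = thetaClass X Y hX hY f :=
  dif_pos ⟨hX, hY⟩

theorem isMult_thetaFun : IsMult thetaFun where
  iso {X Y} f hY hf := by
    have hX := treeClass_of_emb f hY
    rw [thetaFun_eq hX hY, thetaClass, ← map_one (Ideal.Quotient.mk _), Ideal.Quotient.eq]
    exact Ideal.subset_span (Or.inl (Or.inl ⟨X, Y, hX, hY, f, hf, rfl⟩))
  comp {X Y Z} g f hZ := by
    have hY := treeClass_of_emb g hZ
    have hX := treeClass_of_emb f hY
    rw [thetaFun_eq hX hZ, thetaFun_eq hY hZ, thetaFun_eq hX hY, thetaClass, thetaClass, thetaClass,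
      ← map_mul, Ideal.Quotient.eq]
    exact Ideal.subset_span (Or.inl (Or.inr ⟨X, Y, Z, hX, hY, hZ, f, g, rfl⟩))

theorem thetaFun_eq_sum {i : Emb X Y} {f : Emb X X'} {ι : Type} [Fintype ι] {r : ι → Amalg i f}
    (hr : System r) (hY : Y ∈ TreeClass) (hX' : X' ∈ TreeClass) :
    thetaFun X Y i = ∑ α, thetaFun X' (r α).Z (r α).j₂ := by
  have hX := treeClass_of_emb i hY
  let e := Fintype.equivFin ι
  rw [thetaFun_eq hX hY, ← e.symm.sum_comp]
  simp only [thetaFun_eq hX' (hr.mem _), thetaClass]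
  rw [← map_sum, Ideal.Quotient.eq]
  exact Ideal.subset_span (Or.inr ⟨X, Y, X', hX, hY, hX', i, f, _, fun α => r (e.symm α),
    fun α => hr.mem _, fun A hA => by
      obtain ⟨α, hα⟩ := hr.complete A (memUpIso_treeClass.mp hA)
      exact ⟨e α, by simpa only [e.symm_apply_apply] using hα⟩,
    fun α β h => e.symm.injective (hr.irred _ _ h), rfl⟩)

/-- The class of a marked tree structure. -/
noncomputable def markedClass (X : Struc treeSig) (a : X.carrier) : ThetaRing TreeClass :=
  thetaFun (X.restrict {a}ᶜ) X (X.subEmb {a}ᶜ)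

theorem thetaFun_of_isOnePointExt (g : Emb X Y) (a : Y.carrier) (hY : Y ∈ TreeClass)
    (h : IsOnePointExt g a) : thetaFun X Y g = markedClass Y a := by
  have hm : ∀ x, g.toFun x ∈ ({a} : Set Y.carrier)ᶜ := fun x => by
    rw [← show Set.range g.toFun = {a}ᶜ from h]
    exact ⟨x, rfl⟩
  have e : g = (Y.subEmb {a}ᶜ).comp (g.codRestrict _ hm) := rfl
  rw [e, isMult_thetaFun.comp _ _ hY, isMult_thetaFun.iso (g.codRestrict _ hm), mul_one]
  · rfl
  · exact treeClass_of_emb (Y.subEmb _) hY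
  · rintro ⟨y, hy⟩
    obtain ⟨x, hx⟩ := (Set.ext_iff.mp h y).mpr hy
    exact ⟨x, Subtype.ext hx⟩

theorem markedClass_congr (e : Emb X Y) (he : e.IsIso) (a : X.carrier) (hY : Y ∈ TreeClass) :
    markedClass Y (e.toFun a) = markedClass X a := by
  rw [← thetaFun_of_isOnePointExt (e.comp (X.subEmb {a}ᶜ)) (e.toFun a) hY,
    isMult_thetaFun.comp _ _ hY, isMult_thetaFun.iso e hY he, one_mul]
  · rfl
  · ext y
    obtain ⟨x, rfl⟩ := he y
    constructor
    · rintro ⟨⟨z, hz⟩, h⟩ h'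
      exact hz (e.inj (h.trans h'))
    · intro h
      exact ⟨⟨x, fun h' => h (congrArg _ h')⟩, rfl⟩

theorem markedClass_eq_add {X : Struc treeSig} {τ₁ τ₂ : (Fin 4 → Option X.carrier) → Prop}
    (c₁ : ∀ v, τ₁ (fun j => some (v j)) ↔ X.rel () v)
    (c₂ : ∀ v, τ₂ (fun j => some (v j)) ↔ X.rel () v)
    (h₁ : mkS τ₁ ∈ TreeClass) (h₂ : mkS τ₂ ∈ TreeClass) :
    markedClass (mkS τ₁) none =
      (∑ᶠ _ : PLift (τ₁ = τ₂), 1) + ∑ᶠ ρ ∈ {ρ | IsGlue τ₁ τ₂ ρ}, markedClass (mkS ρ) none := by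
  let : Fintype ({ρ // IsGlue τ₁ τ₂ ρ} ⊕ PLift (τ₁ = τ₂)) := Fintype.ofFinite _
  rw [← finsum_stdAmalg c₁ c₂ isMult_thetaFun thetaFun_of_isOnePointExt h₂,
    finsum_eq_sum_of_fintype, ← thetaFun_eq_sum (stdAmalg_system c₁ c₂ h₂) h₁ h₂]
  exact (thetaFun_of_isOnePointExt _ none h₁ (isOnePointExt_stdEmb c₁)).symm

theorem markedClass_eq_one_add {X : Type} [Finite X] {τ : (Fin 4 → Option X) → Prop}
    (h : mkS τ ∈ TreeClass) : markedClass (mkS τ) none =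
      1 + ∑ᶠ ρ ∈ {ρ | IsGlue τ τ ρ}, markedClass (mkS ρ) none := by
  let : Unique (PLift (τ = τ)) := ⟨⟨⟨rfl⟩⟩, fun _ => rfl⟩
  have := markedClass_eq_add (X := mkS fun v => τ fun j => some (v j)) (fun _ => Iff.rfl)
    (fun _ => Iff.rfl) h h
  rwa [finsum_unique fun _ : PLift (τ = τ) => (1 : ThetaRing TreeClass)] at this

theorem exists_markedClass_eq {X : Type} [Finite X] {τ₁ τ₂ : (Fin 4 → Option X) → Prop}
    (h : ∀ v : Fin 4 → X, τ₁ (fun j => some (v j)) ↔ τ₂ (fun j => some (v j)))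
    (h₁ : mkS τ₁ ∈ TreeClass) (h₂ : mkS τ₂ ∈ TreeClass) {ρ : (Fin 4 → Option (Option X)) → Prop}
    (hρ : IsGlue τ₁ τ₂ ρ) (hne : τ₁ ≠ τ₂) :
    markedClass (mkS τ₁) none = markedClass (mkS ρ) none := by
  have : IsEmpty (PLift (τ₁ = τ₂)) := ⟨fun h' => hne h'.down⟩
  have e := markedClass_eq_add (X := mkS fun v => τ₂ fun j => some (v j)) h (fun _ => Iff.rfl) h₁ h₂
  obtain ⟨ρ', hρ', -⟩ := sum_glue_of_ne h₁ h₂ h hne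
  have : ρ = ρ' := (Set.ext_iff.mp hρ' ρ).mp hρ
  rwa [hρ', finsum_mem_singleton, finsum_of_isEmpty, zero_add, ← this] at e

end Universal

section Patterns

theorem isLaminar_of_isEmpty {E V : Type} [IsEmpty E] (S : E → V → Prop) : IsLaminar S :=
  fun e => isEmptyElim e

theorem XmStruc_mem (m : ℕ) : XmStruc m ∈ TreeClass :=
  ((isLaminar_of_isEmpty (E := Empty) fun _ (_ : Fin m) => True).rep (Y := XmStruc m)
    fun _ => ⟨False.elim, fun h => h.2.elim fun e => isEmptyElim e⟩).mem_treeClass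

theorem YStruc_mem : YStruc ∈ TreeClass := by
  have h : IsLaminar fun (_ : Unit) (x : Fin 4) => (x : ℕ) < 2 := fun _ _ => Or.inl fun _ h => h
  exact (h.rep (Y := YStruc) fun v => by
    refine and_congr_right fun _ => ⟨fun h => ⟨(), h⟩, fun ⟨_, h⟩ => h⟩).mem_treeClass

theorem ZStruc_mem : ZStruc ∈ TreeClass := by
  have h : IsLaminar fun (e : Bool) (x : Fin 5) => if e then ZsideA x else ZsideC x := by
    rintro (_ | _) (_ | _)
    · exact Or.inl fun _ h => h
    · exact Or.inr (Or.inr fun x h => absurd h.2 (not_lt.mpr h.1.1))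
    · exact Or.inr (Or.inr fun x h => absurd h.1 (not_lt.mpr h.2.1))
    · exact Or.inl fun _ h => h
  refine (h.rep (Y := ZStruc) fun v => and_congr_right fun _ => ?_).mem_treeClass
  constructor
  · rintro (h | h)
    · exact ⟨true, h⟩
    · exact ⟨false, h⟩
  · rintro ⟨_ | _, h⟩
    · exact Or.inr h
    · exact Or.inl h

theorem not_DD_XmStruc {m : ℕ} (x y z w : Fin m) : ¬ DD (XmStruc m) x y z w := fun h => h.1

/-- The quartets of the tree `Y`. -/
def YSplit (x y z w : Fin 4) : Prop :=
  (x ≠ y ∧ x ≠ z ∧ x ≠ w ∧ y ≠ z ∧ y ≠ w ∧ z ≠ w) ∧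
    ((x : ℕ) < 2 ↔ (y : ℕ) < 2) ∧ ((z : ℕ) < 2 ↔ (w : ℕ) < 2)

instance (x y z w : Fin 4) : Decidable (YSplit x y z w) :=
  inferInstanceAs (Decidable (_ ∧ _))

theorem DD_YStruc (x y z w : Fin 4) : DD YStruc x y z w ↔ YSplit x y z w := by
  have h1 : DD YStruc x y z w ↔ (Distinct4 x z y w ∧ ((x : ℕ) < 2 ↔ ¬ (z : ℕ) < 2) ∧
      ((y : ℕ) < 2 ↔ ¬ (w : ℕ) < 2)) ∧ (Distinct4 x w y z ∧ ((x : ℕ) < 2 ↔ ¬ (w : ℕ) < 2) ∧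
      ((y : ℕ) < 2 ↔ ¬ (z : ℕ) < 2)) := by
    rw [← injective_vec x z y w, ← injective_vec x w y z]
    rfl
  rw [h1]
  unfold Distinct4
  clear h1
  revert x y z w
  decide

/-- The quartets of the tree `Z`. -/
def ZSplit (x y z w : Fin 5) : Prop :=
  (x ≠ y ∧ x ≠ z ∧ x ≠ w ∧ y ≠ z ∧ y ≠ w ∧ z ≠ w) ∧
    (((x : ℕ) < 2 ↔ (y : ℕ) < 2) ∧ ((z : ℕ) < 2 ↔ (w : ℕ) < 2) ∧ ((x : ℕ) < 2 ↔ ¬ (z : ℕ) < 2) ∨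
      ((2 ≤ (x : ℕ) ∧ (x : ℕ) < 4) ↔ (2 ≤ (y : ℕ) ∧ (y : ℕ) < 4)) ∧
      ((2 ≤ (z : ℕ) ∧ (z : ℕ) < 4) ↔ (2 ≤ (w : ℕ) ∧ (w : ℕ) < 4)) ∧
      ((2 ≤ (x : ℕ) ∧ (x : ℕ) < 4) ↔ ¬ (2 ≤ (z : ℕ) ∧ (z : ℕ) < 4)))

instance (x y z w : Fin 5) : Decidable (ZSplit x y z w) :=
  inferInstanceAs (Decidable (_ ∧ _))

set_option maxRecDepth 4000 in
set_option synthInstance.maxHeartbeats 200000 in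
set_option synthInstance.maxSize 1000 in
theorem DD_ZStruc (x y z w : Fin 5) : DD ZStruc x y z w ↔ ZSplit x y z w := by
  have h1 : DD ZStruc x y z w ↔ (Distinct4 x z y w ∧
      ((((x : ℕ) < 2 ↔ ¬ (z : ℕ) < 2) ∧ ((y : ℕ) < 2 ↔ ¬ (w : ℕ) < 2)) ∨
      (((2 ≤ (x : ℕ) ∧ (x : ℕ) < 4) ↔ ¬ (2 ≤ (z : ℕ) ∧ (z : ℕ) < 4)) ∧
        ((2 ≤ (y : ℕ) ∧ (y : ℕ) < 4) ↔ ¬ (2 ≤ (w : ℕ) ∧ (w : ℕ) < 4))))) ∧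
      (Distinct4 x w y z ∧
      ((((x : ℕ) < 2 ↔ ¬ (w : ℕ) < 2) ∧ ((y : ℕ) < 2 ↔ ¬ (z : ℕ) < 2)) ∨
      (((2 ≤ (x : ℕ) ∧ (x : ℕ) < 4) ↔ ¬ (2 ≤ (w : ℕ) ∧ (w : ℕ) < 4)) ∧
        ((2 ≤ (y : ℕ) ∧ (y : ℕ) < 4) ↔ ¬ (2 ≤ (z : ℕ) ∧ (z : ℕ) < 4))))) := by
    rw [← injective_vec x z y w, ← injective_vec x w y z]
    rfl
  rw [h1]
  unfold Distinct4
  clear h1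
  revert x y z w
  decide

theorem code_of_col {Z : Struc treeSig} {S : Set Z.carrier} {a : Z.carrier} (c : Z.carrier → ℕ)
    (h : ∀ x ∈ S, ∀ y ∈ S, (Eqv Z S a x y ↔ c x = c y)) :
    code Z S a = ((c '' S).ncard,
      if (c '' S).ncard = 2 then {x | x ∈ S ∧ ∀ y ∈ S, c x = c y → y = x}.ncard else 0) := by
  have h1 : numCls Z S a = (c '' S).ncard := by
    refine ncard_image_eq_of_ker _ _ fun x hx y hy => ⟨fun e => ?_, fun e => ?_⟩
    · have : y ∈ cls Z S a x := e ▸ ⟨hy, Or.inl rfl⟩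
      exact (h x hx y hy).mp this.2
    · ext z
      exact and_congr_right fun hz => by rw [h x hx z hz, h y hy z hz, e]
  have h2 : numSing Z S a = {x | x ∈ S ∧ ∀ y ∈ S, c x = c y → y = x}.ncard := by
    refine congrArg Set.ncard (Set.ext fun x => and_congr_right fun hx => ?_)
    exact forall₂_congr fun y hy => by rw [h x hx y hy]
  rw [code, h1, h2]

theorem code_XmStruc (m : ℕ) (hm : 0 < m) : code (XmStruc m) {⟨0, hm⟩}ᶜ ⟨0, hm⟩ =
    (m - 1, if m - 1 = 2 then 2 else 0) := by
  have h : ({⟨0, hm⟩}ᶜ : Set (Fin m)).ncard = m - 1 := by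
    rw [Set.ncard_compl, Set.ncard_singleton, Nat.card_eq_fintype_card, Fintype.card_fin]
  rw [← h]
  refine code_of_star (Z := XmStruc m) fun x _ y _ e => e.resolve_right ?_
  rintro ⟨z, -, hz⟩
  exact not_DD_XmStruc _ _ _ _ hz

theorem code_eq_two {Z : Struc treeSig} {S : Set Z.carrier} {a : Z.carrier} (c : Z.carrier → ℕ)
    (n : ℕ) (h : ∀ x ∈ S, ∀ y ∈ S, (Eqv Z S a x y ↔ c x = c y)) (h' : c '' S = {0, 1})
    (hn : {x | x ∈ S ∧ ∀ y ∈ S, c x = c y → y = x}.ncard = n) : code Z S a = (2, n) := by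
  rw [code_of_col c h, h', Set.ncard_pair zero_ne_one, if_pos rfl, hn]

theorem Eqv_YStruc (S : Set (Fin 4)) (a x y : Fin 4) :
    Eqv YStruc S a x y ↔ x = y ∨ ∃ z, z ∈ S ∧ YSplit x y a z :=
  or_congr Iff.rfl (exists_congr fun z => and_congr Iff.rfl (DD_YStruc x y a z))

theorem Eqv_ZStruc (S : Set (Fin 5)) (a x y : Fin 5) :
    Eqv ZStruc S a x y ↔ x = y ∨ ∃ z, z ∈ S ∧ ZSplit x y a z :=
  or_congr Iff.rfl (exists_congr fun z => and_congr Iff.rfl (DD_ZStruc x y a z))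

theorem code_YStruc_of_dec (S : Finset (Fin 4)) (a : Fin 4) (n : ℕ) (c : Fin 4 → ℕ)
    (h : ∀ x ∈ S, ∀ y ∈ S, ((x = y ∨ ∃ z, z ∈ S ∧ YSplit x y a z) ↔ c x = c y))
    (h' : S.image c = {0, 1}) (hn : (S.filter fun x => ∀ y ∈ S, c x = c y → y = x).card = n) :
    code YStruc (S : Set (Fin 4)) a = (2, n) := by
  refine code_eq_two (Z := YStruc) c n (fun x hx y hy => (Eqv_YStruc _ _ _ _).trans (h x hx y hy))
    ?_ ?_
  · exact (Finset.coe_image (s := S)).symm.trans (by rw [h']; simp)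
  · rw [← hn, ← Set.ncard_coe_finset]
    congr 1
    ext x
    exact (Finset.mem_filter (s := S) (p := fun x => ∀ y ∈ S, c x = c y → y = x)).symm

theorem code_ZStruc_of_dec (S : Finset (Fin 5)) (a : Fin 5) (n : ℕ) (c : Fin 5 → ℕ)
    (h : ∀ x ∈ S, ∀ y ∈ S, ((x = y ∨ ∃ z, z ∈ S ∧ ZSplit x y a z) ↔ c x = c y))
    (h' : S.image c = {0, 1}) (hn : (S.filter fun x => ∀ y ∈ S, c x = c y → y = x).card = n) :
    code ZStruc (S : Set (Fin 5)) a = (2, n) := by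
  refine code_eq_two (Z := ZStruc) c n (fun x hx y hy => (Eqv_ZStruc _ _ _ _).trans (h x hx y hy))
    ?_ ?_
  · exact (Finset.coe_image (s := S)).symm.trans (by rw [h']; simp)
  · rw [← hn, ← Set.ncard_coe_finset]
    congr 1
    ext x
    exact (Finset.mem_filter (s := S) (p := fun x => ∀ y ∈ S, c x = c y → y = x)).symm

theorem code_YStruc : code YStruc {(0 : Fin 4)}ᶜ (0 : Fin 4) = (2, 1) := by
  have := code_YStruc_of_dec {0}ᶜ 0 1 (fun x => if x = 1 then 0 else 1) (by decide) (by decide)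
    (by decide)
  rwa [Finset.coe_compl, Finset.coe_singleton] at this

theorem code_ZStruc : code ZStruc {(4 : Fin 5)}ᶜ (4 : Fin 5) = (2, 0) := by
  have := code_ZStruc_of_dec {4}ᶜ 4 0 (fun x => if x < 2 then 0 else 1) (by decide) (by decide)
    (by decide)
  rwa [Finset.coe_compl, Finset.coe_singleton] at this

theorem code_ZStruc_one : code ZStruc {(1 : Fin 5)}ᶜ (1 : Fin 5) = (2, 1) := by
  have := code_ZStruc_of_dec {1}ᶜ 1 1 (fun x => if x = 0 then 0 else 1) (by decide) (by decide)
    (by decide)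
  rwa [Finset.coe_compl, Finset.coe_singleton] at this

theorem code_ZStruc_four_one : code ZStruc ({4, 1}ᶜ : Set (Fin 5)) (1 : Fin 5) = (2, 1) := by
  have := code_ZStruc_of_dec {4, 1}ᶜ 1 1 (fun x => if x = 0 then 0 else 1) (by decide) (by decide)
    (by decide)
  rwa [Finset.coe_compl, Finset.coe_pair] at this

theorem code_ZStruc_one_four : code ZStruc ({1, 4}ᶜ : Set (Fin 5)) (4 : Fin 5) = (2, 1) := by
  have := code_ZStruc_of_dec {1, 4}ᶜ 4 1 (fun x => if x = 0 then 0 else 1) (by decide) (by decide)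
    (by decide)
  rwa [Finset.coe_compl, Finset.coe_pair] at this

end Patterns

section Minimal

variable {Y : Struc treeSig} {a : Y.carrier}

theorem DD_root_cases (hY : Y ∈ TreeClass) {p q r : Y.carrier} (h : DD Y p q a r) :
    DD Y q p a r ∧ ¬ DD Y p r a q ∧ ¬ DD Y r p a q ∧ ¬ DD Y q r a p ∧ ¬ DD Y r q a p := by
  have h1 := DD_swap_left hY h
  have e1 := DD_exclusive hY (DD_swap_right hY h)
  have e2 := DD_exclusive hY (DD_swap_right hY h1)
  refine ⟨h1, fun h' => e1 (DD_swap_right hY h'), fun h' => e1 (DD_swap_right hY (DD_swap_left hY h')),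
    fun h' => e2 (DD_swap_right hY h'), fun h' => e2 (DD_swap_right hY (DD_swap_left hY h'))⟩

theorem isMarkedXm_of_forall_not_DD (hY : Y ∈ TreeClass) (h : ∀ x y z, ¬ DD Y x y a z) :
    ∃ m hm, IsMarkedXm m hm Y a := by
  have : Nonempty Y.carrier := ⟨a⟩
  have hm : 0 < Nat.card Y.carrier := Nat.card_pos
  let e₀ : Y.carrier ≃ Fin (Nat.card Y.carrier) := Finite.equivFin _
  let e := (e₀.trans (Equiv.swap (e₀ a) ⟨0, hm⟩)).symm
  have he : e ⟨0, hm⟩ = a := by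
    rw [Equiv.symm_apply_eq]
    simp
  refine ⟨_, hm, embOfDD (XmStruc_mem _) hY e e.injective ?_, e.surjective, he⟩
  refine DD_congr_of_root (XmStruc_mem _) hY e e.injective ⟨0, hm⟩ fun x y z _ _ _ _ _ _ => ?_
  rw [he]
  exact iff_of_false (h _ _ _) (not_DD_XmStruc _ _ _ _)

theorem DD_of_minimal (hY : Y ∈ TreeClass) (hmin : ∀ b, b ≠ a → SameType Y {a, b}ᶜ a b)
    {x y z b : Y.carrier} (h : DD Y x y a z) (ha : b ≠ a) (hx : b ≠ x) (hy : b ≠ y) (hz : b ≠ z) :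
    DD Y z b a y := by
  obtain ⟨xy, xa, xz, ya, yz, az⟩ := DD_distinct hY h
  have h1 : DD Y x y b z := (hmin b ha x (by simp [hx.symm, xa]) y (by simp [hy.symm, ya]) z
    (by simp [hz.symm, az.symm])).mp h
  exact (hmin x xa z (by simp [xz.symm, az.symm]) b (by simp [ha, hx]) y (by simp [ya, xy.symm])).mpr
    (DD_swap_left hY (DD_swap hY h1))

theorem marked_of_minimal (hY : Y ∈ TreeClass) (hmin : ∀ b, b ≠ a → SameType Y {a, b}ᶜ a b) :
    (∃ m hm, IsMarkedXm m hm Y a) ∨ IsMarkedY Y a ∨ IsMarkedZ Y a := by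
  by_cases hstar : ∀ x y z, ¬ DD Y x y a z
  · exact Or.inl (isMarkedXm_of_forall_not_DD hY hstar)
  push Not at hstar
  obtain ⟨x, y, z, h⟩ := hstar
  right
  obtain ⟨xy, xa, xz, ya, yz, az⟩ := DD_distinct hY h
  obtain ⟨h1, h2, h3, h4, h5⟩ := DD_root_cases hY h
  by_cases hb : ∃ b, b ≠ a ∧ b ≠ x ∧ b ≠ y ∧ b ≠ z
  · right
    obtain ⟨b, ba, bx, by', bz⟩ := hb
    have k := DD_of_minimal hY hmin h ba bx by' bz
    have l := DD_of_minimal hY hmin h1 ba by' bx bz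
    have m := DD_of_minimal hY hmin k xa xz bx.symm xy
    obtain ⟨k1, k2, k3, k4, k5⟩ := DD_root_cases hY k
    obtain ⟨l1, l2, l3, l4, l5⟩ := DD_root_cases hY l
    obtain ⟨m1, m2, m3, m4, m5⟩ := DD_root_cases hY m
    let f : Fin 5 → Y.carrier := ![x, y, z, b, a]
    have hf : Function.Injective f := by
      intro i j
      fin_cases i <;> fin_cases j <;> simp [f, xy, xa, xz, ya, yz, az, ba, bx, by', bz, xy.symm,
        xa.symm, xz.symm, ya.symm, yz.symm, az.symm, ba.symm, bx.symm, by'.symm, bz.symm]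
    refine ⟨embOfDD ZStruc_mem hY f hf (DD_congr_of_root ZStruc_mem hY f hf (4 : Fin 5) ?_),
      fun w => ?_, rfl⟩
    · suffices key : ∀ i j k : Fin 5, i ≠ 4 → j ≠ 4 → k ≠ 4 → i ≠ j → i ≠ k → j ≠ k →
          (DD Y (f i) (f j) (f 4) (f k) ↔ ZSplit i j 4 k) from fun i j k h1 h2 h3 h4 h5 h6 =>
        (key i j k h1 h2 h3 h4 h5 h6).trans (DD_ZStruc i j 4 k).symm
      intro i j k hi hj hk hij hik hjk
      fin_cases i <;> fin_cases j <;> fin_cases k <;>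
        first
          | exact absurd rfl ‹_›
          | exact iff_of_true ‹_› (by decide)
          | exact iff_of_false ‹_› (by decide)
    · by_contra hw
      have hne : ∀ i, w ≠ f i := fun i e => hw ⟨i, e.symm⟩
      have wk := DD_of_minimal hY hmin h (hne 4) (hne 0) (hne 1) (hne 2)
      have e1 := DD_of_minimal hY hmin k (hne 4) (hne 2) (hne 3) (hne 1)
      have e2 := DD_of_minimal hY hmin wk ba bz (hne 3).symm by'
      exact (DD_root_cases hY e1).2.1 e2
  · left
    push Not at hb
    let f : Fin 4 → Y.carrier := ![a, z, x, y]
    have hf : Function.Injective f := by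
      intro i j
      fin_cases i <;> fin_cases j <;> simp [f, xy, xa, xz, ya, yz, az, xy.symm,
        xa.symm, xz.symm, ya.symm, yz.symm, az.symm]
    refine ⟨embOfDD YStruc_mem hY f hf (DD_congr_of_root YStruc_mem hY f hf (0 : Fin 4) ?_),
      fun w => ?_, rfl⟩
    · suffices key : ∀ i j k : Fin 4, i ≠ 0 → j ≠ 0 → k ≠ 0 → i ≠ j → i ≠ k → j ≠ k →
          (DD Y (f i) (f j) (f 0) (f k) ↔ YSplit i j 0 k) from fun i j k h1 h2 h3 h4 h5 h6 =>
        (key i j k h1 h2 h3 h4 h5 h6).trans (DD_YStruc i j 0 k).symm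
      intro i j k hi hj hk hij hik hjk
      fin_cases i <;> fin_cases j <;> fin_cases k <;>
        first
          | exact absurd rfl ‹_›
          | exact iff_of_true ‹_› (by decide)
          | exact iff_of_false ‹_› (by decide)
    · by_contra hw
      have hne : ∀ i, w ≠ f i := fun i e => hw ⟨i, e.symm⟩
      exact hne 1 (hb w (hne 0) (hne 2) (hne 3))

end Minimal

section Codes

/-- The classes of the marked stars `X_m` and of the marked trees `Y` and `Z`, indexed by the
codes of the corresponding one-point extensions. -/
noncomputable def patternClass (c : ℕ × ℕ) : ThetaRing TreeClass :=
  if c.1 = 2 ∧ c.2 = 1 then markedClass YStruc (0 : Fin 4)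
  else if c.1 = 2 ∧ c.2 = 0 then markedClass ZStruc (4 : Fin 5)
  else markedClass (XmStruc (c.1 + 1)) (0 : Fin (c.1 + 1))

theorem patternClass_two_one : patternClass (2, 1) = markedClass YStruc (0 : Fin 4) :=
  if_pos ⟨rfl, rfl⟩

theorem patternClass_two_zero : patternClass (2, 0) = markedClass ZStruc (4 : Fin 5) :=
  (if_neg (by simp)).trans (if_pos ⟨rfl, rfl⟩)

theorem Emb.code_compl {X Y : Struc treeSig} (f : Emb X Y) (hf : f.IsIso) (a : X.carrier) :
    code Y {f.toFun a}ᶜ (f.toFun a) = code X {a}ᶜ a := by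
  rw [← f.code_image, Set.image_compl_eq ⟨f.inj, hf⟩, Set.image_singleton]

theorem markedClass_XmStruc (m : ℕ) (hm : 0 < m) :
    markedClass (XmStruc m) ⟨0, hm⟩ = patternClass (code (XmStruc m) {⟨0, hm⟩}ᶜ ⟨0, hm⟩) := by
  obtain ⟨k, rfl⟩ : ∃ k, m = k + 1 := ⟨m - 1, by omega⟩
  rw [code_XmStruc, patternClass, if_neg, if_neg]
  · rfl
  · rintro ⟨h1, h2⟩
    exact absurd ((if_pos h1).symm.trans h2) (by norm_num)
  · rintro ⟨h1, h2⟩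
    exact absurd ((if_pos h1).symm.trans h2) (by norm_num)

theorem patternClass_of_iso {X Y : Struc treeSig} (f : Emb X Y) (hf : f.IsIso) (a : X.carrier)
    (hY : Y ∈ TreeClass) (h : markedClass X a = patternClass (code X {a}ᶜ a)) :
    markedClass Y (f.toFun a) = patternClass (code Y {f.toFun a}ᶜ (f.toFun a)) := by
  rw [markedClass_congr f hf _ hY, f.code_compl hf, h]

theorem exists_two_point_std {Y : Struc treeSig} {a b : Y.carrier} (hab : b ≠ a) :
    ∃ (X : Type) (_ : Finite X) (ρ : (Fin 4 → Option (Option X)) → Prop) (e : Emb (mkS ρ) Y),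
      e.IsIso ∧ e.toFun none = a ∧ e.toFun (some none) = b := by
  let k : Option (Option {x : Y.carrier // x ≠ a ∧ x ≠ b}) → Y.carrier :=
    fun o => o.elim a fun o => o.elim b Subtype.val
  have hk : Function.Injective k := by
    rintro (_ | _ | ⟨x, hx⟩) (_ | _ | ⟨y, hy⟩) e
    · rfl
    · exact absurd e.symm hab
    · exact absurd e.symm hy.1
    · exact absurd e hab
    · rfl
    · exact absurd e.symm hy.2
    · exact absurd e hx.1
    · exact absurd e hx.2
    · exact congrArg (fun z => some (some z)) (Subtype.ext e)
  refine ⟨_, inferInstance, fun v => Y.rel () fun j => k (v j), ⟨k, hk, fun _ _ => Iff.rfl⟩,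
    fun x => ?_, rfl, rfl⟩
  by_cases ha : x = a
  · exact ⟨none, ha.symm⟩
  by_cases hb : x = b
  · exact ⟨some none, hb.symm⟩
  · exact ⟨some (some ⟨x, ha, hb⟩), rfl⟩

theorem exists_isGlue {X : Type} [Finite X] {ρ : (Fin 4 → Option (Option X)) → Prop}
    (hρ : mkS ρ ∈ TreeClass) : ∃ τ₁ τ₂, mkS τ₁ ∈ TreeClass ∧ mkS τ₂ ∈ TreeClass ∧
      IsGlue τ₁ τ₂ ρ ∧ ∀ v : Fin 4 → X, τ₁ (fun j => some (v j)) ↔ τ₂ (fun j => some (v j)) := by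
  have h : IsGlue (fun v : Fin 4 → Option X => ρ fun j => (v j).map some)
    (fun v => ρ fun j => some (v j)) ρ := ⟨hρ, fun _ => Iff.rfl, fun _ => Iff.rfl⟩
  exact ⟨_, _, treeClass_of_emb h.embL hρ, treeClass_of_emb h.embR hρ, h, fun _ => Iff.rfl⟩

theorem markedClass_eq_patternClass (n : ℕ) : ∀ (Y : Struc treeSig), Y ∈ TreeClass →
    ∀ a : Y.carrier, Nat.card Y.carrier = n →
      markedClass Y a = patternClass (code Y {a}ᶜ a) := by
  induction n using Nat.strong_induction_on with
  | _ n ih =>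
  intro Y hY a hn
  by_cases hmin : ∀ b, b ≠ a → SameType Y {a, b}ᶜ a b
  · rcases marked_of_minimal hY hmin with ⟨m, hm, f, hf, rfl⟩ | ⟨f, hf, rfl⟩ | ⟨f, hf, rfl⟩
    · exact patternClass_of_iso f hf _ hY (markedClass_XmStruc m hm)
    · exact patternClass_of_iso f hf _ hY (patternClass_two_one.symm.trans (congrArg _ code_YStruc.symm))
    · exact patternClass_of_iso f hf _ hY (patternClass_two_zero.symm.trans (congrArg _ code_ZStruc.symm))
  push Not at hmin
  obtain ⟨b, hab, hb⟩ := hmin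
  obtain ⟨X, hX, ρ, e, he, rfl, rfl⟩ := exists_two_point_std hab
  have hρ : mkS ρ ∈ TreeClass := treeClass_of_emb e hY
  obtain ⟨τ₁, τ₂, h₁, h₂, hg, hc⟩ := exists_isGlue hρ
  have hnot : ¬ SameType (mkS ρ) (core X) none (some none) := by
    refine fun h => hb fun x hx y hy z hz => ?_
    have hmem : ∀ {x}, x ∈ ({e.toFun none, e.toFun (some none)}ᶜ : Set Y.carrier) →
        ∃ x', x' ∈ core X ∧ e.toFun x' = x := by
      intro x hx
      obtain ⟨x', rfl⟩ := he x
      refine ⟨x', mem_core_of_ne _ ?_ ?_, rfl⟩ <;>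
        · rintro rfl
          exact hx (by simp)
    obtain ⟨x, hx', rfl⟩ := hmem hx
    obtain ⟨y, hy', rfl⟩ := hmem hy
    obtain ⟨z, hz', rfl⟩ := hmem hz
    rw [e.DD_iff, e.DD_iff]
    exact h x hx' y hy' z hz'
  have hW : (core X).Nontrivial := by
    by_contra hW
    rw [Set.not_nontrivial_iff] at hW
    refine hnot fun x hx y hy z hz => ?_
    obtain rfl := hW hx hy
    exact iff_of_false (fun h => (DD_distinct hρ h).1 rfl) (fun h => (DD_distinct hρ h).1 rfl)
  have hne : τ₁ ≠ τ₂ := fun h => hnot ((hg.sameType_iff h₁ h₂).mpr h)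
  have hcompl : ({none} : Set (Option X))ᶜ = Set.range some := by
    ext z
    rcases z with _ | z <;> simp
  have hlt : Nat.card (Option X) < n := by
    rw [← hn, ← Nat.card_congr (Equiv.ofBijective e.toFun ⟨e.inj, he⟩)]
    simp
  rw [markedClass_congr e he _ hY, e.code_compl he, ← exists_markedClass_eq hc h₁ h₂ hg hne,
    ih _ hlt (mkS τ₁) h₁ none rfl]
  refine congrArg patternClass (Eq.trans ?_ (congrArg (fun S => code (mkS ρ) S none)
    (compl_none (X := mkS fun v => τ₁ fun j => some (v j))).symm))
  rw [code_insert_of_not_sameType hρ hW none_notMem_core some_none_notMem_core none_ne_some_none hnot,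
    hg.code_left]
  exact congrArg (fun S => code (mkS τ₁) S none) hcompl

end Codes

section Relations

theorem exists_glueVal {Y : Struc treeSig} (hY : Y ∈ TreeClass) (a : Y.carrier) :
    ∃ S, GlueVal patternClass (code Y {a}ᶜ a) S ∧ patternClass (code Y {a}ᶜ a) = 1 + S := by
  obtain ⟨τ, h, e, he, -, hea⟩ := exists_std (Y.subEmb {a}ᶜ) (isOnePointExt_subEmb Y a)
  have hτ : mkS τ ∈ TreeClass := treeClass_of_emb e hY
  have hcompl : ({none} : Set (Option (Y.restrict {a}ᶜ).carrier))ᶜ = Set.range some := by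
    ext z
    rcases z with _ | z <;> simp
  have hcode : code (mkS τ) (Set.range some) none = code Y {a}ᶜ a := by
    have h1 := e.code_compl he none
    rw [hea] at h1
    rw [h1]
    exact congrArg (fun S => code (mkS τ) S none) hcompl.symm
  have hm : markedClass Y a = markedClass (mkS τ) none :=
    (congrArg (markedClass Y) hea.symm).trans (markedClass_congr e he _ hY)
  refine ⟨_, hcode ▸ glueVal_sum patternClass hτ, ?_⟩
  rw [← markedClass_eq_patternClass _ Y hY _ rfl, hm, markedClass_eq_one_add hτ]
  congr 1
  refine finsum_mem_congr rfl fun ρ hρ => ?_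
  exact (markedClass_eq_patternClass _ (mkS ρ) hρ.mem _ rfl).trans
    (congrArg (fun S => patternClass (code (mkS ρ) S none)) compl_none)

theorem thetaFun_subEmb {Z : Struc treeSig} (hZ : Z ∈ TreeClass) {a b : Z.carrier} (hab : a ≠ b)
    {S : Set Z.carrier} (hS : S = {a, b}ᶜ) :
    thetaFun (Z.restrict S) Z (Z.subEmb S) = markedClass Z a * patternClass (code Z S b) := by
  have hm : ∀ x, (Z.subEmb S).toFun x ∈ ({a} : Set Z.carrier)ᶜ := by
    rintro ⟨x, hx⟩ rfl
    rw [hS] at hx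
    exact hx (Or.inl rfl)
  have hW : Z.restrict {a}ᶜ ∈ TreeClass := treeClass_of_emb (Z.subEmb _) hZ
  have hb : b ∈ ({a} : Set Z.carrier)ᶜ := hab.symm
  let b' : (Z.restrict {a}ᶜ).carrier := ⟨b, hb⟩
  have hpt : IsOnePointExt ((Z.subEmb S).codRestrict {a}ᶜ hm) b' := by
    ext ⟨y, hy⟩
    constructor
    · rintro ⟨⟨x, hx⟩, h⟩ h'
      rw [hS] at hx
      exact hx (Or.inr ((congrArg Subtype.val h).trans (congrArg Subtype.val h')))
    · intro h
      refine ⟨⟨y, ?_⟩, rfl⟩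
      rw [hS]
      rintro (h' | h')
      · exact hy h'
      · exact h (Subtype.ext h')
  have e : Z.subEmb S = (Z.subEmb {a}ᶜ).comp ((Z.subEmb S).codRestrict _ hm) := rfl
  rw [e, isMult_thetaFun.comp _ _ hZ, thetaFun_of_isOnePointExt _ _ hW hpt,
    markedClass_eq_patternClass _ _ hW b' rfl, ← (Z.subEmb {a}ᶜ).code_image]
  refine congrArg (fun T => markedClass Z a * patternClass (code Z T b)) ?_
  rw [hS]
  ext x
  constructor
  · rintro ⟨⟨y, hy⟩, h, rfl⟩ (h' | h')
    · exact hy h'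
    · exact h (Subtype.ext h')
  · intro h
    exact ⟨⟨x, fun h' => h (Or.inl h')⟩, fun h' => h (Or.inr (congrArg Subtype.val h')), rfl⟩

theorem GlueVal.eq_zero {A : Type*} [CommRing A] {G : ℕ × ℕ → A} {S : A}
    (h : GlueVal G (0, 0) S) : S = G (1, 0) := by
  cases h with
  | zero => rfl
  | large _ hk => omega

theorem GlueVal.eq_one {A : Type*} [CommRing A] {G : ℕ × ℕ → A} {S : A}
    (h : GlueVal G (1, 0) S) : S = G (2, 2) := by
  cases h with
  | one => rfl
  | large _ hk => omega

theorem GlueVal.eq_large {A : Type*} [CommRing A] {G : ℕ × ℕ → A} {S : A} {k : ℕ} (hk : 3 ≤ k)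
    (h : GlueVal G (k, 0) S) : S = G (k + 1, 0) + G (2, 1) := by
  generalize hc : (k, 0) = c at h
  cases h <;> simp only [Prod.mk.injEq] at hc
  case large => rw [hc.1]
  all_goals omega

theorem GlueVal.eq_two {A : Type*} [CommRing A] {G : ℕ × ℕ → A} {S : A} {s t : ℕ} (hs : s ≤ 1)
    (ht : t ≤ 1) (h : GlueVal G (2, s + t) S) :
    S = G (3, 0) + G (2, 1) + (G (2, s) + G (2, t)) := by
  generalize hc : (2, s + t) = c at h
  cases h <;> simp only [Prod.mk.injEq] at hc
  case two s' t' hs' ht' =>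
    obtain ⟨rfl, rfl⟩ | ⟨rfl, rfl⟩ : s = s' ∧ t = t' ∨ s = t' ∧ t = s' := by omega
    · rfl
    · rw [add_comm (G (2, t))]
  all_goals omega

theorem patternClass_two {s t : ℕ} (hs : s ≤ 1) (ht : t ≤ 1) {Y : Struc treeSig}
    (hY : Y ∈ TreeClass) (a : Y.carrier) (h : code Y {a}ᶜ a = (2, s + t)) :
    patternClass (2, s + t) = 1 + patternClass (3, 0) + patternClass (2, 1) +
      (patternClass (2, s) + patternClass (2, t)) := by
  obtain ⟨S, h1, h2⟩ := exists_glueVal hY a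
  rw [h] at h1 h2
  rw [h2, h1.eq_two hs ht]
  ring

theorem gCond_patternClass : GCond patternClass where
  zero := by
    obtain ⟨S, h, h'⟩ := exists_glueVal (XmStruc_mem 1) ⟨0, one_pos⟩
    rw [code_XmStruc 1 one_pos] at h h'
    exact h'.trans (congrArg _ h.eq_zero)
  one := by
    obtain ⟨S, h, h'⟩ := exists_glueVal (XmStruc_mem 2) ⟨0, two_pos⟩
    rw [code_XmStruc 2 two_pos] at h h'
    exact h'.trans (congrArg _ h.eq_one)
  two s t hs ht := by
    obtain h | h | h : s + t = 0 ∨ s + t = 1 ∨ s + t = 2 := by omega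
    · exact patternClass_two hs ht ZStruc_mem (4 : Fin 5) (h ▸ code_ZStruc)
    · exact patternClass_two hs ht YStruc_mem (0 : Fin 4) (h ▸ code_YStruc)
    · exact patternClass_two hs ht (XmStruc_mem 3) ⟨0, three_pos⟩
        ((code_XmStruc 3 three_pos).trans (congrArg (Prod.mk 2) h.symm))
  large k hk := by
    obtain ⟨S, h, h'⟩ := exists_glueVal (XmStruc_mem (k + 1)) ⟨0, k.succ_pos⟩
    have hc : code (XmStruc (k + 1)) {⟨0, k.succ_pos⟩}ᶜ ⟨0, k.succ_pos⟩ = (k, 0) :=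
      (code_XmStruc (k + 1) k.succ_pos).trans
        (congrArg (Prod.mk k) (if_neg (by omega)))
    rw [hc] at h h'
    rw [h', h.eq_large hk, add_assoc]
  cross := by
    have h41 : (4 : Fin 5) ≠ 1 := by decide
    have h := (thetaFun_subEmb ZStruc_mem (a := (4 : Fin 5)) (b := (1 : Fin 5)) h41 rfl).symm.trans
      (thetaFun_subEmb ZStruc_mem (a := (1 : Fin 5)) (b := (4 : Fin 5)) h41.symm
        (congrArg _ (Set.pair_comm _ _)))
    have h4 : markedClass ZStruc (4 : Fin 5) = patternClass (2, 0) := patternClass_two_zero.symm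
    have h1 : markedClass ZStruc (1 : Fin 5) = patternClass (2, 1) :=
      (markedClass_eq_patternClass _ ZStruc ZStruc_mem (1 : Fin 5) rfl).trans
        (congrArg _ code_ZStruc_one)
    have hc1 := congrArg patternClass code_ZStruc_four_one
    rw [mul_comm, ← h4]
    refine (congrArg _ hc1.symm).trans (h.trans ?_)
    rw [h1]
    refine congrArg _ ((congrArg (fun T => patternClass (code ZStruc T (4 : Fin 5)))
      (congrArg _ (Set.pair_comm _ _))).trans (congrArg patternClass code_ZStruc_one_four))

end Relations

section Presentation

variable {A : Type*} [CommRing A]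

theorem IsMult.eq_of_isOnePointExt {φ ψ : ∀ X Y : Struc treeSig, Emb X Y → A} (hφ : IsMult φ)
    (hψ : IsMult ψ)
    (h : ∀ {X Y : Struc treeSig} (f : Emb X Y) (a : Y.carrier), Y ∈ TreeClass →
      IsOnePointExt f a → φ X Y f = ψ X Y f)
    (n : ℕ) {X Y : Struc treeSig} (f : Emb X Y) (hY : Y ∈ TreeClass)
    (hn : Nat.card Y.carrier = n) : φ X Y f = ψ X Y f := by
  induction n using Nat.strong_induction_on generalizing X Y with
  | _ n ih =>
    by_cases hf : f.IsIso
    · rw [hφ.iso f hY hf, hψ.iso f hY hf]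
    · obtain ⟨W, f₁, f₂, a, rfl, ha, hlt⟩ := Emb.exists_factor hf
      rw [hφ.comp _ _ hY, hψ.comp _ _ hY, h f₂ a hY ha,
        ih _ (hn ▸ hlt) f₁ (treeClass_of_emb f₂ hY) rfl]

theorem thetaLift_markedClass {G : ℕ × ℕ → A} (hG : GCond G) {Y : Struc treeSig}
    (hY : Y ∈ TreeClass) (a : Y.carrier) :
    thetaLift hG (markedClass Y a) = G (code Y {a}ᶜ a) := by
  rw [markedClass, thetaFun_eq (treeClass_of_emb (Y.subEmb _) hY) hY, thetaLift_thetaClass,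
    weight_of_isOnePointExt hG _ a hY (isOnePointExt_subEmb Y a)]

/-- The value in `ℤ[u,v]/(uv)` of a one-point extension with a given code. -/
noncomputable def uvValue (c : ℕ × ℕ) : UVQuot :=
  Ideal.Quotient.mk _
    (if c.1 = 0 then uP + vP + 2
    else if c.1 = 1 then uP + vP + 1
    else if c.1 = 2 then uP + ((c.2 : MvPolynomial (Fin 2) ℤ) - 1) * vP
    else vP + 1 - ((c.1 : MvPolynomial (Fin 2) ℤ) - 1) * (uP + 1))

theorem uvValue_two (s : ℕ) :
    uvValue (2, s) = Ideal.Quotient.mk _ (uP + ((s : MvPolynomial (Fin 2) ℤ) - 1) * vP) := by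
  simp [uvValue]

theorem uvValue_large {k : ℕ} (hk : 3 ≤ k) :
    uvValue (k, 0) =
      Ideal.Quotient.mk _ (vP + 1 - ((k : MvPolynomial (Fin 2) ℤ) - 1) * (uP + 1)) := by
  have h0 : k ≠ 0 := by omega
  have h1 : k ≠ 1 := by omega
  have h2 : k ≠ 2 := by omega
  simp [uvValue, h0, h1, h2]

theorem gCond_uvValue : GCond uvValue where
  zero := by
    simp only [uvValue, if_true, one_ne_zero, if_false, ← map_one (Ideal.Quotient.mk _), ← map_add]
    congr 1
    ring
  one := by
    rw [uvValue_two, uvValue, if_neg one_ne_zero, if_pos rfl, ← map_one (Ideal.Quotient.mk _),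
      ← map_add]
    congr 1
    push_cast
    ring
  two s t _ _ := by
    simp only [uvValue_two, uvValue_large le_rfl, ← map_one (Ideal.Quotient.mk _), ← map_add]
    congr 1
    push_cast
    ring
  large k hk := by
    rw [uvValue_two, uvValue_large hk, uvValue_large (by omega), ← map_one (Ideal.Quotient.mk _),
      ← map_add, ← map_add]
    congr 1
    push_cast
    ring
  cross := by
    rw [uvValue_two, uvValue_two, ← map_mul, ← map_mul, Ideal.Quotient.eq,
      Ideal.mem_span_singleton]
    exact ⟨-1, by push_cast; ring⟩

/-- The homomorphism out of `ℤ[u,v]/(uv)` determined by a family of values. -/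
noncomputable def uvLift {G : ℕ × ℕ → A} (hG : GCond G) : UVQuot →+* A :=
  Ideal.Quotient.lift _ (MvPolynomial.aeval ![G (2, 1), G (2, 1) - G (2, 0)]).toRingHom
    fun p hp => by
      obtain ⟨q, rfl⟩ := Ideal.mem_span_singleton.mp hp
      have h : G (2, 1) * (G (2, 1) - G (2, 0)) = 0 := by rw [mul_sub, hG.cross, sub_self]
      simp [uP, vP, h]

theorem uvLift_uP {G : ℕ × ℕ → A} (hG : GCond G) :
    uvLift hG (Ideal.Quotient.mk _ uP) = G (2, 1) := by
  exact (Ideal.Quotient.lift_mk _ _ _).trans (by simp [uP])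

theorem uvLift_vP {G : ℕ × ℕ → A} (hG : GCond G) :
    uvLift hG (Ideal.Quotient.mk _ vP) = G (2, 1) - G (2, 0) := by
  exact (Ideal.Quotient.lift_mk _ _ _).trans (by simp [vP])

theorem GCond.two_two {G : ℕ × ℕ → A} (hG : GCond G) : G (2, 2) = 2 * G (2, 1) - G (2, 0) := by
  linear_combination hG.two 1 1 le_rfl le_rfl - hG.two 0 0 zero_le_one zero_le_one

theorem GCond.large_eq {G : ℕ × ℕ → A} (hG : GCond G) {k : ℕ} (hk : 3 ≤ k) :
    G (k, 0) = G (2, 1) - G (2, 0) + 1 - ((k : A) - 1) * (G (2, 1) + 1) := by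
  induction k, hk using Nat.le_induction with
  | base =>
    push_cast
    linear_combination - hG.two 0 1 zero_le_one le_rfl
  | succ k hk ih =>
    push_cast
    linear_combination ih - hG.large k hk

theorem uvLift_uvValue {G : ℕ × ℕ → A} (hG : GCond G) {B : Type*} [CommRing B] {H : ℕ × ℕ → B}
    {c : ℕ × ℕ} {S : B} (h : GlueVal H c S) : uvLift hG (uvValue c) = G c := by
  have hu := uvLift_uP hG
  have hv := uvLift_vP hG
  cases h with
  | zero =>
    rw [uvValue, if_pos rfl]
    simp only [map_add, map_ofNat, hu, hv]
    linear_combination - hG.zero - hG.one - hG.two_two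
  | one =>
    rw [uvValue, if_neg one_ne_zero, if_pos rfl]
    simp only [map_add, map_one, hu, hv]
    linear_combination - hG.one - hG.two_two
  | two s t hs ht =>
    rw [uvValue_two]
    simp only [map_add, map_mul, map_sub, map_natCast, map_one, hu, hv]
    obtain h | h | h : s + t = 0 ∨ s + t = 1 ∨ s + t = 2 := by omega
    all_goals rw [h]; push_cast
    · ring
    · ring
    · linear_combination - hG.two_two
  | large k hk =>
    rw [uvValue_large hk, hG.large_eq hk]
    simp only [map_add, map_mul, map_sub, map_natCast, map_one, hu, hv]

/-- The isomorphism `Θ(𝔗) ≃ ℤ[u,v]/(uv)`. -/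
noncomputable def thetaEquiv : ThetaRing TreeClass ≃+* UVQuot :=
  RingEquiv.ofRingHom (thetaLift gCond_uvValue) (uvLift gCond_patternClass)
    (by
      have h1 : thetaLift gCond_uvValue (patternClass (2, 1)) = uvValue (2, 1) := by
        rw [patternClass_two_one]
        exact (thetaLift_markedClass _ YStruc_mem (0 : Fin 4)).trans (congrArg _ code_YStruc)
      have h0 : thetaLift gCond_uvValue (patternClass (2, 0)) = uvValue (2, 0) := by
        rw [patternClass_two_zero]
        exact (thetaLift_markedClass _ ZStruc_mem (4 : Fin 5)).trans (congrArg _ code_ZStruc)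
      refine Ideal.Quotient.ringHom_ext (MvPolynomial.ringHom_ext (fun r => by simp) fun i => ?_)
      fin_cases i
      · refine (congrArg (thetaLift gCond_uvValue) (uvLift_uP gCond_patternClass)).trans
          (h1.trans ((uvValue_two 1).trans ?_))
        change _ = Ideal.Quotient.mk _ uP
        congr 1
        push_cast
        ring
      · refine (congrArg (thetaLift gCond_uvValue) (uvLift_vP gCond_patternClass)).trans ?_
        change _ = Ideal.Quotient.mk _ vP
        rw [map_sub, h1, h0, uvValue_two, uvValue_two, ← map_sub]
        congr 1
        push_cast
        ring)
    (by
      refine Ideal.Quotient.ringHom_ext (MvPolynomial.ringHom_ext (fun r => by simp) ?_)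
      rintro ⟨⟨X, hX⟩, ⟨Y, hY⟩, f⟩
      have hmul : IsMult fun X Y f => uvLift gCond_patternClass (weight uvValue X Y f) :=
        { iso := fun f hY hf => by rw [(isMult_weight gCond_uvValue).iso f hY hf, map_one]
          comp := fun g f hZ => by rw [(isMult_weight gCond_uvValue).comp g f hZ, map_mul] }
      have h := hmul.eq_of_isOnePointExt isMult_thetaFun (fun {X Y} f a hY ha => by
        obtain ⟨S, hS, -⟩ := exists_glueVal hY a
        rw [weight_of_isOnePointExt gCond_uvValue f a hY ha, uvLift_uvValue _ hS,
          thetaFun_of_isOnePointExt f a hY ha, markedClass_eq_patternClass _ Y hY a rfl])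
        _ f hY rfl
      exact (congrArg _ (thetaLift_thetaClass gCond_uvValue hX hY f)).trans
        (h.trans (thetaFun_eq hX hY f)))

theorem sendsMarkedTo_thetaEquiv {Y : Struc treeSig} {a : Y.carrier} {p : MvPolynomial (Fin 2) ℤ}
    (h : uvValue (code Y {a}ᶜ a) = Ideal.Quotient.mk _ p) : SendsMarkedTo thetaEquiv Y a p := by
  rintro X hX _ ⟨f, hf, rfl⟩ W hW g hg
  refine (thetaLift_thetaClass gCond_uvValue hW hX g).trans ?_
  rw [weight_of_isOnePointExt gCond_uvValue g _ hX hg, f.code_compl hf, h]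

end Presentation

/-- **Theorem 3.6**: there is a ring isomorphism `i : Θ(𝔗) → ℤ[u,v]/(uv)` with
`i(x₁) = u+v+2`, `i(x₂) = u+v+1`, `i(x₃) = u+v`, `i(x_m) = v+1−(m−2)(u+1)` for `m ≥ 4`,
`i(y) = u` and `i(z) = u−v`, where `x_m`, `y`, `z` are the classes in `Θ(𝔗)` of the
marked trees `X_m`, `Y`, `Z`. -/
theorem theta_tree_iso :
    ∃ e : ThetaRing TreeClass ≃+* UVQuot,
      SendsMarkedTo e (XmStruc 1) ⟨0, by norm_num⟩ (uP + vP + 2) ∧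
      SendsMarkedTo e (XmStruc 2) ⟨0, by norm_num⟩ (uP + vP + 1) ∧
      SendsMarkedTo e (XmStruc 3) ⟨0, by norm_num⟩ (uP + vP) ∧
      (∀ (m : ℕ) (hm : 4 ≤ m),
        SendsMarkedTo e (XmStruc m) ⟨0, by omega⟩
          (vP + 1 - ((m : MvPolynomial (Fin 2) ℤ) - 2) * (uP + 1))) ∧
      SendsMarkedTo e YStruc (0 : Fin 4) uP ∧
      SendsMarkedTo e ZStruc (4 : Fin 5) (uP - vP) := by
  refine ⟨thetaEquiv, sendsMarkedTo_thetaEquiv ?_, sendsMarkedTo_thetaEquiv ?_,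
    sendsMarkedTo_thetaEquiv ?_, fun m hm => sendsMarkedTo_thetaEquiv ?_,
    sendsMarkedTo_thetaEquiv ?_, sendsMarkedTo_thetaEquiv ?_⟩
  · refine (congrArg _ (code_XmStruc 1 one_pos)).trans ?_
    simp [uvValue]
  · refine (congrArg _ (code_XmStruc 2 two_pos)).trans ?_
    simp [uvValue]
  · refine (congrArg _ ((code_XmStruc 3 three_pos).trans rfl)).trans ((uvValue_two 2).trans ?_)
    congr 1
    push_cast
    ring
  · refine (congrArg _ ((code_XmStruc m (by omega)).trans
      (congrArg (Prod.mk _) (if_neg (by omega))))).trans ((uvValue_large (by omega)).trans ?_)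
    congr 1
    rw [Nat.cast_sub (by omega)]
    push_cast
    ring
  · refine (congrArg _ code_YStruc).trans ((uvValue_two 1).trans ?_)
    congr 1
    push_cast
    ring
  · refine (congrArg _ code_ZStruc).trans ((uvValue_two 0).trans ?_)
    congr 1
    push_cast
    ring

end Paper
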